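/- Let G be a locally finite, connected metric graph with finite total length L > 0. Then for every k ≥ 2 the k-th eigenvalue of the Neumann extension satisfies μ_k(G) ≥ π²k²/(4L²), with equality if and only if G is a star consisting of k (finite or infinite) path subgraphs, each of total length L/k, glued together at a common vertex. -/

import Mathlib

open MeasureTheory Set Filter
open scoped ENNReal

/-- A metric graph structure on a metric space `X`: a countable collection of edges,
each parametrised by arc length over `[0, len e]`, together with vertices identified
with edge endpoints; the interiors of distinct edges are disjoint, the edges cover `X`,
and the metric of `X` is the induced path metric (characterised by the fact that the
edge parametrisations are `1`-Lipschitz and `dist x y` is the largest value `u x - u y`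
over all continuous, edgewise `1`-Lipschitz functions `u : X → ℝ`). -/
structure MetricGraphOn (X : Type) [MetricSpace X] where
  V : Type
  E : Type
  countableV : Countable V
  countableE : Countable E
  len : E → ℝ
  len_pos : ∀ e, 0 < len e
  edgeMap : E → ℝ → X
  vertexMap : V → X
  endpoint : E → Bool → V
  edgeMap_cont : ∀ e, ContinuousOn (edgeMap e) (Icc 0 (len e))
  edgeMap_injOn : ∀ e, InjOn (edgeMap e) (Ico 0 (len e))
  edgeMap_zero : ∀ e, edgeMap e 0 = vertexMap (endpoint e false)
  edgeMap_len : ∀ e, edgeMap e (len e) = vertexMap (endpoint e true)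
  interior_disjoint : ∀ e e', e ≠ e' → ∀ s ∈ Ioo 0 (len e), ∀ t ∈ Ioo 0 (len e'),
    edgeMap e s ≠ edgeMap e' t
  interior_not_vertex : ∀ e, ∀ s ∈ Ioo 0 (len e), ∀ v, edgeMap e s ≠ vertexMap v
  vertexMap_inj : Function.Injective vertexMap
  cover : ∀ x : X, ∃ e, ∃ t ∈ Icc 0 (len e), edgeMap e t = x
  dist_le : ∀ e, ∀ s ∈ Icc 0 (len e), ∀ t ∈ Icc 0 (len e),
    dist (edgeMap e s) (edgeMap e t) ≤ |s - t|
  dist_ge : ∀ u : X → ℝ, Continuous u →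
    (∀ e, ∀ s ∈ Icc 0 (len e), ∀ t ∈ Icc 0 (len e),
      |u (edgeMap e s) - u (edgeMap e t)| ≤ |s - t|) →
    ∀ x y, u x - u y ≤ dist x y

namespace MetricGraphOn

variable {X : Type} [MetricSpace X]

/-- The (a.e. defined) derivative of `f` along the edge `e`, in the arc-length
parametrisation of the edge. -/
noncomputable def edgeDeriv (G : MetricGraphOn X) (f : X → ℝ) (e : G.E) : ℝ → ℝ :=
  deriv (f ∘ G.edgeMap e)

/-- The subset of `X` consisting of the (closed) edges in `A`. -/
def subgraphSet (G : MetricGraphOn X) (A : Set G.E) : Set X :=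
  ⋃ e ∈ A, G.edgeMap e '' Icc 0 (G.len e)

/-- `∫_e |f|²` along a single edge. -/
noncomputable def edgeMass (G : MetricGraphOn X) (f : X → ℝ) (e : G.E) : ℝ :=
  ∫ t in Ioo 0 (G.len e), (f (G.edgeMap e t)) ^ 2

/-- `∫_e |f'|²` along a single edge. -/
noncomputable def edgeEnergy (G : MetricGraphOn X) (f : X → ℝ) (e : G.E) : ℝ :=
  ∫ t in Ioo 0 (G.len e), (G.edgeDeriv f e t) ^ 2

/-- Membership in the Sobolev space `H¹` of the subgraph given by the edge set `A`:
continuity on the subgraph, edgewise absolute continuity with square-integrable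
derivative, and finiteness of the total `H¹` norm. -/
def MemH1On (G : MetricGraphOn X) (A : Set G.E) (f : X → ℝ) : Prop :=
  ContinuousOn f (G.subgraphSet A) ∧
  (∀ e ∈ A, IntegrableOn (fun t => (G.edgeDeriv f e t) ^ 2) (Ioo 0 (G.len e))) ∧
  (∀ e ∈ A, ∀ t ∈ Icc (0:ℝ) (G.len e),
    f (G.edgeMap e t) = f (G.edgeMap e 0) + ∫ s in Ioo 0 t, G.edgeDeriv f e s) ∧
  Summable (fun e : A => G.edgeMass f (e : G.E) + G.edgeEnergy f (e : G.E))

/-- Membership in `H¹(G)`. -/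
def MemH1 (G : MetricGraphOn X) (f : X → ℝ) : Prop :=
  Continuous f ∧ G.MemH1On Set.univ f

/-- The squared `L²` norm of `f` over the edges in `A`. -/
noncomputable def l2normSqOn (G : MetricGraphOn X) (A : Set G.E) (f : X → ℝ) : ℝ :=
  ∑' e : A, G.edgeMass f (e : G.E)

/-- The squared `L²` norm of `f'` over the edges in `A`. -/
noncomputable def derivNormSqOn (G : MetricGraphOn X) (A : Set G.E) (f : X → ℝ) : ℝ :=
  ∑' e : A, G.edgeEnergy f (e : G.E)

/-- The squared `L²` norm of `f` on `G`. -/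
noncomputable def l2normSq (G : MetricGraphOn X) (f : X → ℝ) : ℝ :=
  G.l2normSqOn Set.univ f

/-- The squared `L²` norm of `f'` on `G` (the Dirichlet energy of `f`). -/
noncomputable def derivNormSq (G : MetricGraphOn X) (f : X → ℝ) : ℝ :=
  G.derivNormSqOn Set.univ f

/-- The squared `H¹` norm of `f`. -/
noncomputable def h1normSq (G : MetricGraphOn X) (f : X → ℝ) : ℝ :=
  G.l2normSq f + G.derivNormSq f

/-- The `L²` inner product on `G`. -/
noncomputable def l2inner (G : MetricGraphOn X) (f g : X → ℝ) : ℝ :=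
  ∑' e : G.E, ∫ t in Ioo 0 (G.len e), f (G.edgeMap e t) * g (G.edgeMap e t)

/-- The Dirichlet form (inner product of derivatives) on `G`. -/
noncomputable def derivInner (G : MetricGraphOn X) (f g : X → ℝ) : ℝ :=
  ∑' e : G.E, ∫ t in Ioo 0 (G.len e), G.edgeDeriv f e t * G.edgeDeriv g e t

/-- The `k`-th min-max (Courant–Fischer) value of the quadratic form
`f ↦ ∫ |f'|²` (over the edges of `A`) with form domain `K`: the infimum over all
`k`-dimensional subspaces of `K` of the largest Rayleigh quotient on the subspace.
For a self-adjoint Laplacian with purely discrete spectrum this is its `k`-th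
eigenvalue (`k = 1` giving the lowest one). -/
noncomputable def eigenOn (G : MetricGraphOn X) (A : Set G.E) (K : Set (X → ℝ))
    (k : ℕ) : ℝ :=
  sInf { μ : ℝ | ∃ φ : Fin k → X → ℝ, (∀ i, φ i ∈ K) ∧
    LinearIndependent ℝ (fun i => (G.subgraphSet A).restrict (φ i)) ∧
    ∀ c : Fin k → ℝ,
      G.derivNormSqOn A (∑ i, c i • φ i) ≤ μ * G.l2normSqOn A (∑ i, c i • φ i) }

/-- The `k`-th eigenvalue `μ_k(G)` of the Neumann extension (standard
continuity–Kirchhoff conditions at all vertices, Neumann conditions at all ends). -/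
noncomputable def neumannEigen (G : MetricGraphOn X) (k : ℕ) : ℝ :=
  G.eigenOn Set.univ {f | G.MemH1 f} k

/-- `f` vanishes at the point `y` of the completion of `X`. -/
def VanishesAt (f : X → ℝ) (y : UniformSpace.Completion X) : Prop :=
  Tendsto f (comap ((↑) : X → UniformSpace.Completion X) (nhds y)) (nhds 0)

/-- Membership in `H¹₀(G; 𝔙)`: `H¹`-functions vanishing on the set `𝔙` of
vertices and/or ends (viewed inside the completion of `X`). -/
def H10Mem (G : MetricGraphOn X) (𝔙 : Set (UniformSpace.Completion X))
    (f : X → ℝ) : Prop :=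
  G.MemH1 f ∧ ∀ y ∈ 𝔙, VanishesAt f y

/-- The `k`-th eigenvalue `λ_k(G; 𝔙)` of the Laplacian with Dirichlet conditions
on `𝔙` and standard (continuity–Kirchhoff/Neumann) conditions elsewhere. -/
noncomputable def dirichletEigen (G : MetricGraphOn X)
    (𝔙 : Set (UniformSpace.Completion X)) (k : ℕ) : ℝ :=
  G.eigenOn Set.univ {f | G.H10Mem 𝔙 f} k

/-- The set of (topological = graph) ends of `G`, realised as the points of the
completion of `X` that do not belong to `X`. -/
def Ends (_G : MetricGraphOn X) : Set (UniformSpace.Completion X) :=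
  {y | y ∉ Set.range ((↑) : X → UniformSpace.Completion X)}

/-- The set of vertices of `G`, viewed inside the completion of `X`. -/
def vertexPoints (G : MetricGraphOn X) : Set (UniformSpace.Completion X) :=
  Set.range (fun v => ((G.vertexMap v : X) : UniformSpace.Completion X))

/-- The degree of a vertex (loops counted twice). -/
noncomputable def degree (G : MetricGraphOn X) (v : G.V) : ℕ :=
  {p : G.E × Bool | G.endpoint p.1 p.2 = v}.ncard

/-- `G` is locally finite: every vertex has finite degree. -/
def LocallyFinite (G : MetricGraphOn X) : Prop :=
  ∀ v : G.V, {p : G.E × Bool | G.endpoint p.1 p.2 = v}.Finite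

/-- A cycle in `G`: a compact subset homeomorphic to a circle. -/
def IsCycle (_G : MetricGraphOn X) (C : Set X) : Prop :=
  IsCompact C ∧ Nonempty (C ≃ₜ Metric.sphere (0 : ℝ × ℝ) 1)

/-- `G` has (first) Betti number `β`: there is a minimal finite family of `β` cycles
whose union contains every cycle of `G`. -/
def HasBettiNumber (G : MetricGraphOn X) (β : ℕ) : Prop :=
  ∃ 𝒞 : Finset (Set X), 𝒞.card = β ∧ (∀ C ∈ 𝒞, G.IsCycle C) ∧
    (∀ C, G.IsCycle C → C ⊆ ⋃ C' ∈ 𝒞, C') ∧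
    ∀ 𝒞' : Finset (Set X), (∀ C ∈ 𝒞', G.IsCycle C) →
      (∀ C, G.IsCycle C → C ⊆ ⋃ C' ∈ 𝒞', C') → β ≤ 𝒞'.card

/-- The embedding of `K ⊆ H¹(G)` into `L²(G)` is compact: every sequence in `K`
bounded in the `H¹` norm has a subsequence which is Cauchy in the `L²` norm. -/
def CompactlyEmbedded (G : MetricGraphOn X) (K : Set (X → ℝ)) : Prop :=
  ∀ u : ℕ → X → ℝ, (∀ n, u n ∈ K) → (∀ n, G.h1normSq (u n) ≤ 1) →
    ∃ φ : ℕ → ℕ, StrictMono φ ∧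
      ∀ ε : ℝ, 0 < ε → ∃ N, ∀ m, N ≤ m → ∀ n, N ≤ n →
        G.l2normSq (u (φ m) - u (φ n)) ≤ ε

/-- The self-adjoint operator with form `f ↦ ∫ |f'|²` and form domain `K` has
purely discrete spectrum (equivalently, compact resolvent): its min-max values
tend to `+∞`. -/
def HasPurelyDiscreteSpectrumOn (G : MetricGraphOn X) (K : Set (X → ℝ)) : Prop :=
  Tendsto (fun k => G.eigenOn Set.univ K k) atTop atTop

/-- The volume (total length) of a subset `S` of `G`. -/
noncomputable def vol (G : MetricGraphOn X) (S : Set X) : ℝ≥0∞ :=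
  ∑' e : G.E, volume (G.edgeMap e ⁻¹' S ∩ Ioo 0 (G.len e))

/-- The set of vertices incident to some edge in `A`. -/
def vertexSetOf (G : MetricGraphOn X) (A : Set G.E) : Set G.V :=
  {v | ∃ e ∈ A, ∃ b, G.endpoint e b = v}

/-- Membership in `H¹₀(G)`, the closure in `H¹(G)` of the compactly supported
`H¹` functions (the form domain of the Friedrichs extension). -/
def H100Mem (G : MetricGraphOn X) (f : X → ℝ) : Prop :=
  G.MemH1 f ∧ ∃ u : ℕ → X → ℝ, (∀ n, G.MemH1 (u n) ∧ HasCompactSupport (u n)) ∧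
    Tendsto (fun n => G.h1normSq (f - u n)) atTop (nhds 0)

/-- The `k`-th eigenvalue `λ_k(G)` of the Friedrichs extension. -/
noncomputable def friedrichsEigen (G : MetricGraphOn X) (k : ℕ) : ℝ :=
  G.eigenOn Set.univ {f | G.H100Mem f} k

end MetricGraphOn

/-- The metric space `X` is an (equilateral) star with `k` arms of length `r`,
i.e. `k` path subgraphs of total length `r` each (possibly consisting of infinitely
many edges, hence possibly missing their far endpoint), glued at a common centre:
there is a coordinate map assigning to each point its arm and its distance to the
centre, realising the star metric. -/
def IsStar (X : Type) [MetricSpace X] (k : ℕ) (r : ℝ) : Prop :=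
  ∃ φ : X → Fin k × ℝ, Function.Injective φ ∧ (∃ x₀ : X, (φ x₀).2 = 0) ∧
    (∀ x, (φ x).2 ∈ Set.Icc 0 r) ∧
    (∀ i : Fin k, Set.Ioo (0 : ℝ) r ⊆ {t : ℝ | ∃ x, φ x = (i, t)}) ∧
    (∀ x y, dist x y =
      if (φ x).1 = (φ y).1 ∨ (φ x).2 = 0 ∨ (φ y).2 = 0
      then |(φ x).2 - (φ y).2| else (φ x).2 + (φ y).2)

/-! ### Absolutely continuous functions on an interval -/

theorem AbsolutelyContinuousOnInterval.of_dist_le {φ ψ : ℝ → ℝ} {a b K : ℝ}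
    (hφ : AbsolutelyContinuousOnInterval φ a b)
    (h : ∀ s ∈ uIcc a b, ∀ t ∈ uIcc a b, dist (ψ s) (ψ t) ≤ K * dist (φ s) (φ t)) :
    AbsolutelyContinuousOnInterval ψ a b := by
  refine squeeze_zero' (.of_forall fun E => Finset.sum_nonneg fun i _ => dist_nonneg) ?_
    (by simpa using Tendsto.const_mul K hφ)
  have : ∀ᶠ E in (AbsolutelyContinuousOnInterval.totalLengthFilter (X := ℝ)) ⊓
      𝓟 (AbsolutelyContinuousOnInterval.disjWithin a b),
      E ∈ AbsolutelyContinuousOnInterval.disjWithin a b :=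
    mem_inf_of_right (mem_principal_self _)
  filter_upwards [this] with E hE
  rw [Finset.mul_sum]
  exact Finset.sum_le_sum fun i hi => h _ (hE.1 i hi).1 _ (hE.1 i hi).2

theorem AbsolutelyContinuousOnInterval.enorm_sub_le {φ : ℝ → ℝ} {a b s t : ℝ}
    (hφ : AbsolutelyContinuousOnInterval φ a b) (hs : s ∈ Icc a b) (ht : t ∈ Icc a b) :
    ‖φ t - φ s‖ₑ ≤ ∫⁻ x in Ioo a b, ‖deriv φ x‖ₑ := by
  have hab : a ≤ b := hs.1.trans hs.2
  have key : ∀ s ∈ Icc a b, ∀ t ∈ Icc a b, s ≤ t →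
      ‖φ t - φ s‖ₑ ≤ ∫⁻ x in Ioo a b, ‖deriv φ x‖ₑ := by
    intro s hs t ht hst
    have h1 : AbsolutelyContinuousOnInterval φ s t := hφ.mono (by
      rw [uIcc_of_le hst, uIcc_of_le hab]; exact Icc_subset_Icc hs.1 ht.2)
    rw [← h1.integral_deriv_eq_sub, intervalIntegral.integral_of_le hst,
      integral_Ioc_eq_integral_Ioo]
    exact (enorm_integral_le_lintegral_enorm _).trans
      (lintegral_mono_set (Ioo_subset_Ioo hs.1 ht.2))
  rcases le_total s t with h | h
  · exact key s hs t ht h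
  · rw [← enorm_neg, neg_sub]; exact key t ht s hs h

theorem AbsolutelyContinuousOnInterval.volume_image_le {φ : ℝ → ℝ} {a b : ℝ} (hab : a ≤ b)
    (hφ : AbsolutelyContinuousOnInterval φ a b) :
    volume (φ '' Icc a b) ≤ ∫⁻ x in Ioo a b, ‖deriv φ x‖ₑ := by
  have hc : ContinuousOn φ (Icc a b) := by simpa [uIcc_of_le hab] using hφ.continuousOn
  have hne : (Icc a b).Nonempty := nonempty_Icc.2 hab
  obtain ⟨s, hs, hs'⟩ := isCompact_Icc.exists_isMinOn hne hc
  obtain ⟨t, ht, ht'⟩ := isCompact_Icc.exists_isMaxOn hne hc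
  have hsub : φ '' Icc a b ⊆ Icc (φ s) (φ t) := by
    rintro _ ⟨x, hx, rfl⟩
    exact ⟨hs' hx, ht' hx⟩
  refine (measure_mono hsub).trans ?_
  rw [Real.volume_Icc]
  refine le_trans ?_ (hφ.enorm_sub_le hs ht)
  rw [Real.enorm_eq_ofReal_abs]
  exact ENNReal.ofReal_le_ofReal (le_abs_self _)

namespace MetricGraphOn

variable {X : Type} [MetricSpace X] (G : MetricGraphOn X)

instance : Countable G.E := G.countableE
instance : MeasurableSpace G.E := ⊤
instance : MeasurableSingletonClass G.E := ⟨fun _ => trivial⟩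

/-- Lebesgue measure on the disjoint union of the edges. -/
noncomputable def edgeMeasure : Measure (G.E × ℝ) :=
  Measure.sum fun e => (volume.restrict (Ioo 0 (G.len e))).map (Prod.mk e)

/-- The map from the disjoint union of the edges onto the graph. -/
noncomputable def point (p : G.E × ℝ) : X := G.edgeMap p.1 (max 0 (min p.2 (G.len p.1)))

/-- The edgewise derivative as a function on the disjoint union of the edges. -/
noncomputable def dv (f : X → ℝ) (p : G.E × ℝ) : ℝ := deriv (f ∘ G.edgeMap p.1) p.2

theorem point_eq {e : G.E} {t : ℝ} (ht : t ∈ Icc 0 (G.len e)) :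
    G.point (e, t) = G.edgeMap e t := by
  simp [point, min_eq_left ht.2, max_eq_right ht.1]

theorem ae_edgeMeasure_iff {P : G.E × ℝ → Prop} :
    (∀ᵐ p ∂G.edgeMeasure, P p) ↔ ∀ e, ∀ᵐ t ∂volume.restrict (Ioo 0 (G.len e)), P (e, t) := by
  rw [edgeMeasure, Measure.ae_sum_iff]
  exact forall_congr' fun e => (measurableEmbedding_prodMk_left e).ae_map_iff

theorem lintegral_edgeMeasure (F : G.E × ℝ → ℝ≥0∞) :
    ∫⁻ p, F p ∂G.edgeMeasure = ∑' e, ∫⁻ t in Ioo 0 (G.len e), F (e, t) := by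
  rw [edgeMeasure, lintegral_sum_measure]
  exact tsum_congr fun e => (measurableEmbedding_prodMk_left e).lintegral_map F

theorem hasSum_integral_edgeMeasure {F : G.E × ℝ → ℝ} (hF : Integrable F G.edgeMeasure) :
    HasSum (fun e => ∫ t in Ioo 0 (G.len e), F (e, t)) (∫ p, F p ∂G.edgeMeasure) := by
  have h := hasSum_integral_measure hF
  simp only [(measurableEmbedding_prodMk_left _).integral_map] at h
  exact h

theorem integrableOn_edge {F : G.E × ℝ → ℝ} (hF : Integrable F G.edgeMeasure) (e : G.E) :
    IntegrableOn (fun t => F (e, t)) (Ioo 0 (G.len e)) := by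
  have h : Integrable F ((volume.restrict (Ioo 0 (G.len e))).map (Prod.mk e)) :=
    hF.mono_measure (Measure.le_sum _ e)
  exact ((measurableEmbedding_prodMk_left e).integrable_map_iff).1 h

theorem integrable_edgeMeasure {F : G.E × ℝ → ℝ}
    (h : ∀ e, IntegrableOn (fun t => F (e, t)) (Ioo 0 (G.len e)))
    (hs : Summable fun e => ∫ t in Ioo 0 (G.len e), ‖F (e, t)‖) :
    Integrable F G.edgeMeasure := by
  refine integrable_sum_measure
    (fun e => ((measurableEmbedding_prodMk_left e).integrable_map_iff).2 (h e)) ?_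
  simpa only [(measurableEmbedding_prodMk_left _).integral_map] using hs

theorem setLIntegral_edgeMeasure (e : G.E) {A : Set ℝ} (hA : MeasurableSet A)
    (F : G.E × ℝ → ℝ≥0∞) :
    ∫⁻ p in {e} ×ˢ A, F p ∂G.edgeMeasure = ∫⁻ t in A ∩ Ioo 0 (G.len e), F (e, t) := by
  rw [← lintegral_indicator ((MeasurableSet.singleton e).prod hA), lintegral_edgeMeasure,
    tsum_eq_single e]
  · rw [← Measure.restrict_restrict hA, ← lintegral_indicator hA]
    refine lintegral_congr fun t => ?_
    by_cases h : t ∈ A <;> simp [indicator, h]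
  · intro e' he'
    simp [indicator, he']

theorem edgeMeasure_prod (e : G.E) {A : Set ℝ} (hA : MeasurableSet A) :
    G.edgeMeasure ({e} ×ˢ A) = volume (A ∩ Ioo 0 (G.len e)) := by
  simpa using G.setLIntegral_edgeMeasure e hA 1

theorem measurable_dv (f : X → ℝ) : Measurable (G.dv f) :=
  measurable_from_prod_countable_right fun e => measurable_deriv (f ∘ G.edgeMap e)

theorem continuous_point (e : G.E) : Continuous fun t => G.point (e, t) := by
  refine (G.edgeMap_cont e).comp_continuous (by fun_prop) fun t => ?_
  exact ⟨le_max_left _ _, max_le (G.len_pos e).le (min_le_right _ _)⟩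

theorem measurable_comp_point {f : X → ℝ} (hf : Continuous f) :
    Measurable fun p => f (G.point p) :=
  measurable_from_prod_countable_right fun e => (hf.comp (G.continuous_point e)).measurable

theorem edgeMeasure_univ (hsum : Summable G.len) :
    G.edgeMeasure univ = ENNReal.ofReal (∑' e, G.len e) := by
  rw [← setLIntegral_one, Measure.restrict_univ, lintegral_edgeMeasure,
    ENNReal.ofReal_tsum_of_nonneg (fun e => (G.len_pos e).le) hsum]
  simp

theorem isFiniteMeasure_edgeMeasure (hsum : Summable G.len) : IsFiniteMeasure G.edgeMeasure :=
  ⟨by rw [G.edgeMeasure_univ hsum]; exact ENNReal.ofReal_lt_top⟩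

theorem edgeMeasure_real_univ (hsum : Summable G.len) :
    G.edgeMeasure.real univ = ∑' e, G.len e := by
  rw [Measure.real, G.edgeMeasure_univ hsum,
    ENNReal.toReal_ofReal (tsum_nonneg fun e => (G.len_pos e).le)]

theorem exists_point (x : X) : ∃ e, ∃ t ∈ Icc 0 (G.len e), G.point (e, t) = x := by
  obtain ⟨e, t, ht, rfl⟩ := G.cover x
  exact ⟨e, t, ht, G.point_eq ht⟩

end MetricGraphOn

theorem ofReal_sub_le_volume {X : Type*} {f : X → ℝ} {x y : X} {S : Set ℝ}
    (h : ∀ c, f x < c → c < f y → c ∈ S) : ENNReal.ofReal (f y - f x) ≤ volume S := by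
  rw [← Real.volume_Ioo]
  exact measure_mono fun c hc => h c hc.1 hc.2

namespace MetricGraphOn

variable {X : Type} [MetricSpace X] (G : MetricGraphOn X)

/-- Absolute continuity along every edge. -/
def EdgewiseAC (f : X → ℝ) : Prop :=
  ∀ e, AbsolutelyContinuousOnInterval (f ∘ G.edgeMap e) 0 (G.len e)

variable {G}

theorem ae_of_forall_Ioo {P : G.E × ℝ → Prop}
    (h : ∀ e, ∀ t ∈ Ioo 0 (G.len e), P (e, t)) : ∀ᵐ p ∂G.edgeMeasure, P p :=
  G.ae_edgeMeasure_iff.2 fun e => ae_restrict_of_forall_mem measurableSet_Ioo (h e)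

theorem ae_mem_Ioo : ∀ᵐ p ∂G.edgeMeasure, p.2 ∈ Ioo 0 (G.len p.1) :=
  ae_of_forall_Ioo fun _ _ ht => ht

theorem EdgewiseAC.ae_differentiableAt {f : X → ℝ} (hf : G.EdgewiseAC f) :
    ∀ᵐ p ∂G.edgeMeasure, DifferentiableAt ℝ (f ∘ G.edgeMap p.1) p.2 := by
  refine G.ae_edgeMeasure_iff.2 fun e => ?_
  rw [ae_restrict_iff' measurableSet_Ioo]
  filter_upwards [(hf e).ae_differentiableAt] with t ht h
  exact ht (by rw [uIcc_of_le (G.len_pos e).le]; exact Ioo_subset_Icc_self h)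

theorem dv_add_ae {f g : X → ℝ} (hf : G.EdgewiseAC f) (hg : G.EdgewiseAC g) :
    ∀ᵐ p ∂G.edgeMeasure, G.dv (f + g) p = G.dv f p + G.dv g p := by
  filter_upwards [hf.ae_differentiableAt, hg.ae_differentiableAt] with p h1 h2
  exact deriv_add h1 h2

theorem dv_smul (c : ℝ) (f : X → ℝ) (p : G.E × ℝ) : G.dv (c • f) p = c * G.dv f p :=
  deriv_const_smul_field (f := f ∘ G.edgeMap p.1) (x := p.2) c

theorem dv_const (c : ℝ) (p : G.E × ℝ) : G.dv (fun _ => c) p = 0 :=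
  deriv_const p.2 c

theorem EdgewiseAC.of_dist_le {f g : X → ℝ} {K : ℝ} (hf : G.EdgewiseAC f)
    (h : ∀ x y, dist (g x) (g y) ≤ K * dist (f x) (f y)) : G.EdgewiseAC g :=
  fun e => (hf e).of_dist_le fun _ _ _ _ => h _ _

/-- The image of an arc under an edgewise absolutely continuous function has measure at most the
total variation of the function along the arc. -/
theorem EdgewiseAC.volume_image_le {f : X → ℝ} (hf : G.EdgewiseAC f) (e : G.E) {s t : ℝ}
    (hs : 0 ≤ s) (hst : s ≤ t) (ht : t ≤ G.len e) :
    volume (f '' (G.edgeMap e '' Icc s t)) ≤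
      ∫⁻ p in {e} ×ˢ Ico s t, ‖G.dv f p‖ₑ ∂G.edgeMeasure := by
  rw [← image_comp, G.setLIntegral_edgeMeasure e measurableSet_Ico]
  refine (((hf e).mono ?_).volume_image_le hst).trans (lintegral_mono_set ?_)
  · rw [uIcc_of_le hst, uIcc_of_le (G.len_pos e).le]; exact Icc_subset_Icc hs ht
  · exact fun x hx => ⟨⟨hx.1.le, hx.2⟩, hs.trans_lt hx.1, hx.2.trans_le ht⟩

theorem EdgewiseAC.volume_image_edge_le {f : X → ℝ} (hf : G.EdgewiseAC f) (e : G.E) :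
    volume (f '' (G.edgeMap e '' Icc 0 (G.len e))) ≤
      ∫⁻ p in {e} ×ˢ univ, ‖G.dv f p‖ₑ ∂G.edgeMeasure :=
  (hf.volume_image_le e le_rfl (G.len_pos e).le le_rfl).trans
    (lintegral_mono_set (prod_mono_right (subset_univ _)))

theorem EdgewiseAC.volume_image_edges_le {f : X → ℝ} (hf : G.EdgewiseAC f) (A : Set G.E) :
    volume (⋃ e ∈ A, f '' (G.edgeMap e '' Icc 0 (G.len e))) ≤
      ∫⁻ p in A ×ˢ univ, ‖G.dv f p‖ₑ ∂G.edgeMeasure := by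
  have : A ×ˢ (univ : Set ℝ) = ⋃ e ∈ A, {e} ×ˢ univ := by ext ⟨e, t⟩; simp
  rw [this, lintegral_biUnion A.to_countable
    (fun e _ => (MeasurableSet.singleton e).prod MeasurableSet.univ)]
  · refine (measure_biUnion_le _ A.to_countable _).trans (ENNReal.tsum_le_tsum fun e => ?_)
    exact hf.volume_image_edge_le e
  · intro e _ e' _ h
    exact Set.disjoint_left.2 fun p hp hp' => h (hp.1.symm.trans hp'.1)

theorem EdgewiseAC.ofReal_sub_le [ConnectedSpace X] {f : X → ℝ} (hf : G.EdgewiseAC f)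
    (hc : Continuous f) (x y : X) :
    ENNReal.ofReal (f y - f x) ≤ ∫⁻ p, ‖G.dv f p‖ₑ ∂G.edgeMeasure := by
  have h := hf.volume_image_edges_le univ
  rw [univ_prod_univ, Measure.restrict_univ] at h
  refine (ofReal_sub_le_volume fun c h1 h2 => ?_).trans h
  obtain ⟨z, rfl⟩ := mem_range_of_exists_le_of_exists_ge hc ⟨x, h1.le⟩ ⟨y, h2.le⟩
  obtain ⟨e, t, ht, rfl⟩ := G.cover z
  simp only [mem_iUnion]
  exact ⟨e, trivial, _, ⟨t, ht, rfl⟩, rfl⟩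

variable (G) in
/-- The Sobolev space `H¹(G)` as a space of functions, without the (automatic) condition that the
functions be square integrable. -/
def sobolev : Submodule ℝ (X → ℝ) where
  carrier := {f | Continuous f ∧ G.EdgewiseAC f ∧
    Integrable (fun p => G.dv f p ^ 2) G.edgeMeasure}
  add_mem' := by
    rintro f g ⟨hf, hf', hf''⟩ ⟨hg, hg', hg''⟩
    refine ⟨hf.add hg, fun e => (hf' e).add (hg' e), ?_⟩
    refine ((hf''.const_mul 2).add (hg''.const_mul 2)).mono
      ((G.measurable_dv _).pow_const 2).aestronglyMeasurable ?_
    filter_upwards [dv_add_ae hf' hg'] with p hp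
    rw [hp, Real.norm_eq_abs, Real.norm_eq_abs, abs_of_nonneg (sq_nonneg _)]
    refine le_trans ?_ (le_abs_self _)
    simp only [Pi.add_apply]
    nlinarith [sq_nonneg (G.dv f p - G.dv g p)]
  zero_mem' := by
    refine ⟨continuous_const, fun e => ?_, ?_⟩
    · exact (LipschitzWith.const (0 : ℝ)).lipschitzOnWith.absolutelyContinuousOnInterval
    · have : (fun p => G.dv (0 : X → ℝ) p ^ 2) = fun _ => (0 : ℝ) := by
        ext p; rw [show G.dv (0 : X → ℝ) p = 0 from dv_const 0 p]; norm_num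
      rw [this]; exact integrable_zero _ _ _
  smul_mem' := by
    rintro c f ⟨hf, hf', hf''⟩
    refine ⟨hf.const_smul c, fun e => (hf' e).const_smul c, ?_⟩
    simp only [dv_smul, mul_pow]
    exact hf''.const_mul _

namespace sobolev

variable {f g : X → ℝ}

theorem continuous (hf : f ∈ G.sobolev) : Continuous f := hf.1

theorem edgewiseAC (hf : f ∈ G.sobolev) : G.EdgewiseAC f := hf.2.1

theorem memLp_dv (hf : f ∈ G.sobolev) : MemLp (G.dv f) 2 G.edgeMeasure :=
  (memLp_two_iff_integrable_sq (G.measurable_dv f).aestronglyMeasurable).2 hf.2.2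

theorem integrable_dv_mul (hf : f ∈ G.sobolev) (hg : g ∈ G.sobolev) :
    Integrable (fun p => G.dv f p * G.dv g p) G.edgeMeasure :=
  (memLp_dv hf).integrable_mul (memLp_dv hg)

theorem integrable_dv [IsFiniteMeasure G.edgeMeasure] (hf : f ∈ G.sobolev) :
    Integrable (G.dv f) G.edgeMeasure :=
  (memLp_dv hf).integrable one_le_two

theorem const_mem (c : ℝ) : (fun _ : X => c) ∈ G.sobolev := by
  refine ⟨continuous_const, fun e => ?_, ?_⟩
  · exact (LipschitzWith.const c).lipschitzOnWith.absolutelyContinuousOnInterval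
  · simp only [dv_const]; simp

theorem comp_mem (hf : f ∈ G.sobolev) {Y y : ℝ → ℝ} {K : ℝ} (hY : ∀ s, HasDerivAt Y (y s) s)
    (hK : ∀ s, |y s| ≤ K) : Y ∘ f ∈ G.sobolev ∧
      ∀ᵐ p ∂G.edgeMeasure, G.dv (Y ∘ f) p = y (f (G.point p)) * G.dv f p := by
  have hae : ∀ᵐ p ∂G.edgeMeasure, G.dv (Y ∘ f) p = y (f (G.point p)) * G.dv f p := by
    filter_upwards [(edgewiseAC hf).ae_differentiableAt, ae_mem_Ioo (G := G)] with p hp hp'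
    rw [show p = (p.1, p.2) from rfl, G.point_eq (Ioo_subset_Icc_self hp')]
    exact ((hY _).comp p.2 hp.hasDerivAt).deriv
  have hlip : ∀ s t, dist (Y s) (Y t) ≤ K * dist s t := by
    have hK0 : 0 ≤ K := (abs_nonneg _).trans (hK 0)
    intro s t
    have := Convex.norm_image_sub_le_of_norm_hasDerivWithin_le (f := Y) (f' := y) (C := K)
      (s := univ) (x := t) (y := s) (fun x _ => (hY x).hasDerivWithinAt) (fun x _ => hK x)
      convex_univ trivial trivial
    simpa [dist_eq_norm] using this
  refine ⟨⟨?_, (edgewiseAC hf).of_dist_le fun x y => hlip _ _, ?_⟩, hae⟩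
  · exact (continuous_iff_continuousAt.2 fun s => (hY s).continuousAt).comp hf.1
  · refine (hf.2.2.const_mul (K ^ 2)).mono
      ((G.measurable_dv _).pow_const 2).aestronglyMeasurable ?_
    filter_upwards [hae] with p hp
    rw [hp, Real.norm_eq_abs, Real.norm_eq_abs, abs_of_nonneg (sq_nonneg _), mul_pow,
      abs_of_nonneg (by positivity)]
    exact mul_le_mul_of_nonneg_right (sq_le_sq.2 ((hK _).trans (le_abs_self K))) (sq_nonneg _)

theorem posPart_mem (hf : f ∈ G.sobolev) : (fun x => max (f x) 0) ∈ G.sobolev ∧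
      ∀ᵐ p ∂G.edgeMeasure, G.dv (fun x => max (f x) 0) p =
        if 0 < f (G.point p) then G.dv f p else 0 := by
  have hae : ∀ᵐ p ∂G.edgeMeasure, G.dv (fun x => max (f x) 0) p =
        if 0 < f (G.point p) then G.dv f p else 0 := by
    refine ae_of_forall_Ioo fun e t ht => ?_
    rw [G.point_eq (Ioo_subset_Icc_self ht)]
    split_ifs with h
    · refine Filter.EventuallyEq.deriv_eq ?_
      have hc : ContinuousAt (f ∘ G.edgeMap e) t :=
        hf.1.continuousAt.comp ((G.edgeMap_cont e).continuousAt (Icc_mem_nhds ht.1 ht.2))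
      filter_upwards [hc.eventually (lt_mem_nhds h)] with s hs
      exact max_eq_left hs.le
    · refine IsLocalMin.deriv_eq_zero (.of_forall fun s => ?_)
      simp only [Function.comp_apply, max_eq_right (not_lt.1 h)]
      exact le_max_right _ _
  refine ⟨⟨hf.1.max continuous_const, (edgewiseAC hf).of_dist_le (K := 1) fun x y => ?_, ?_⟩, hae⟩
  · rw [one_mul, Real.dist_eq, Real.dist_eq]
    exact abs_max_sub_max_le_abs _ _ _
  · refine hf.2.2.mono ((G.measurable_dv _).pow_const 2).aestronglyMeasurable ?_
    filter_upwards [hae] with p hp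
    rw [hp]
    split_ifs
    · exact le_rfl
    · simp; positivity

theorem of_lipschitz [IsFiniteMeasure G.edgeMeasure] (hf : Continuous f) {K : ℝ}
    (hK : ∀ e, ∀ s ∈ Icc 0 (G.len e), ∀ t ∈ Icc 0 (G.len e),
      |f (G.edgeMap e s) - f (G.edgeMap e t)| ≤ K * |s - t|) : f ∈ G.sobolev ∧
      ∀ᵐ p ∂G.edgeMeasure, |G.dv f p| ≤ K := by
  have hae : ∀ᵐ p ∂G.edgeMeasure, |G.dv f p| ≤ K := by
    refine ae_of_forall_Ioo fun e t ht => ?_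
    have hK0 : 0 ≤ K := by
      have := (abs_nonneg _).trans (hK e 0 ⟨le_rfl, (G.len_pos e).le⟩ t (Ioo_subset_Icc_self ht))
      refine nonneg_of_mul_nonneg_left this (abs_pos.2 ?_)
      linarith [ht.1]
    refine norm_deriv_le_of_lip' (f := f ∘ G.edgeMap e) hK0 ?_
    filter_upwards [Ioo_mem_nhds ht.1 ht.2] with s hs
    exact hK e s (Ioo_subset_Icc_self hs) t (Ioo_subset_Icc_self ht)
  refine ⟨⟨hf, fun e => ?_, ?_⟩, hae⟩
  · refine AbsolutelyContinuousOnInterval.of_dist_le (φ := id) (K := K) ?_ ?_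
    · exact LipschitzWith.id.lipschitzOnWith.absolutelyContinuousOnInterval
    · rw [uIcc_of_le (G.len_pos e).le]
      exact fun s hs t ht => hK e s hs t ht
  · refine Integrable.of_bound ((G.measurable_dv _).pow_const 2).aestronglyMeasurable (K ^ 2) ?_
    filter_upwards [hae] with p hp
    rw [Real.norm_eq_abs, abs_pow]
    gcongr

variable [IsFiniteMeasure G.edgeMeasure]

theorem abs_sub_le [ConnectedSpace X] (hf : f ∈ G.sobolev) (x y : X) :
    |f x - f y| ≤ ∫ p, |G.dv f p| ∂G.edgeMeasure := by
  have h : ∀ x y, f y - f x ≤ ∫ p, |G.dv f p| ∂G.edgeMeasure := fun x y => by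
    have h1 := (edgewiseAC hf).ofReal_sub_le hf.1 x y
    have h2 := ofReal_integral_norm_eq_lintegral_enorm (integrable_dv hf)
    rw [← h2, ENNReal.ofReal_le_ofReal_iff (integral_nonneg fun _ => norm_nonneg _)] at h1
    exact h1
  exact abs_sub_le_iff.2 ⟨h y x, h x y⟩

theorem exists_bound [ConnectedSpace X] (hf : f ∈ G.sobolev) : ∃ B, ∀ x, |f x| ≤ B := by
  obtain ⟨x₀⟩ : Nonempty X := inferInstance
  refine ⟨|f x₀| + ∫ p, |G.dv f p| ∂G.edgeMeasure, fun x => ?_⟩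
  have := abs_sub_le hf x x₀
  have h2 := abs_sub_abs_le_abs_sub (f x) (f x₀)
  linarith

theorem memLp_val [ConnectedSpace X] (hf : f ∈ G.sobolev) :
    MemLp (fun p => f (G.point p)) 2 G.edgeMeasure := by
  obtain ⟨B, hB⟩ := exists_bound hf
  exact MemLp.of_bound (G.measurable_comp_point hf.1).aestronglyMeasurable B
    (.of_forall fun p => hB _)

theorem integrable_val_mul [ConnectedSpace X] (hf : f ∈ G.sobolev) (hg : g ∈ G.sobolev) :
    Integrable (fun p => f (G.point p) * g (G.point p)) G.edgeMeasure :=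
  (memLp_val hf).integrable_mul (memLp_val hg)

theorem integrable_val [ConnectedSpace X] (hf : f ∈ G.sobolev) :
    Integrable (fun p => f (G.point p)) G.edgeMeasure :=
  (memLp_val hf).integrable one_le_two

end sobolev

theorem edgeMass_eq (f : X → ℝ) (e : G.E) :
    G.edgeMass f e = ∫ t in Ioo 0 (G.len e), f (G.point (e, t)) ^ 2 :=
  setIntegral_congr_fun measurableSet_Ioo fun t ht => by
    simp only [G.point_eq (Ioo_subset_Icc_self ht)]

theorem derivNormSq_eq {f : X → ℝ} (hf : f ∈ G.sobolev) :
    HasSum (fun e => G.edgeEnergy f e) (∫ p, G.dv f p ^ 2 ∂G.edgeMeasure) :=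
  G.hasSum_integral_edgeMeasure hf.2.2

theorem subgraphSet_univ : G.subgraphSet univ = univ := by
  refine eq_univ_of_forall fun x => ?_
  obtain ⟨e, t, ht, rfl⟩ := G.cover x
  simp only [subgraphSet, mem_iUnion]
  exact ⟨e, trivial, t, ht, rfl⟩

theorem derivNormSqOn_univ {f : X → ℝ} (hf : f ∈ G.sobolev) :
    G.derivNormSqOn univ f = ∫ p, G.dv f p ^ 2 ∂G.edgeMeasure :=
  (tsum_univ _).trans (derivNormSq_eq hf).tsum_eq

variable [IsFiniteMeasure G.edgeMeasure] [ConnectedSpace X]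

theorem l2normSq_eq {f : X → ℝ} (hf : f ∈ G.sobolev) :
    HasSum (fun e => G.edgeMass f e) (∫ p, f (G.point p) ^ 2 ∂G.edgeMeasure) := by
  have h := G.hasSum_integral_edgeMeasure (sobolev.memLp_val hf).integrable_sq
  simpa only [edgeMass_eq] using h

theorem memH1_iff {f : X → ℝ} : G.MemH1 f ↔ f ∈ G.sobolev := by
  constructor
  · rintro ⟨hc, -, h2, h3, h4⟩
    have h2' : ∀ e, IntegrableOn (G.edgeDeriv f e) (Ioo 0 (G.len e)) := fun e =>
      ((memLp_two_iff_integrable_sq (measurable_deriv _).aestronglyMeasurable).2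
        (h2 e trivial)).integrable one_le_two
    refine ⟨hc, fun e => ?_, ?_⟩
    · have hle := (G.len_pos e).le
      have h_int : IntervalIntegrable (G.edgeDeriv f e) volume 0 (G.len e) := by
        rw [intervalIntegrable_iff_integrableOn_Ioo_of_le hle]; exact h2' e
      refine (h_int.absolutelyContinuousOnInterval_intervalIntegral
        (left_mem_uIcc : (0 : ℝ) ∈ uIcc 0 (G.len e))).of_dist_le (K := 1) fun s hs t ht => ?_
      rw [uIcc_of_le hle] at hs ht
      simp only [Function.comp_apply, h3 e trivial s hs, h3 e trivial t ht, one_mul,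
        intervalIntegral.integral_of_le hs.1, intervalIntegral.integral_of_le ht.1,
        integral_Ioc_eq_integral_Ioo, dist_add_left, le_refl]
    · refine integrable_edgeMeasure G (fun e => h2 e trivial) ?_
      rw [← (Equiv.Set.univ G.E).symm.summable_iff] at h4
      · refine h4.of_nonneg_of_le (fun e => integral_nonneg fun _ => norm_nonneg _) fun e => ?_
        have h5 : 0 ≤ G.edgeMass f e := integral_nonneg fun _ => sq_nonneg _
        have h6 : ∫ t in Ioo 0 (G.len e), ‖G.dv f (e, t) ^ 2‖ = G.edgeEnergy f e := by
          simp only [Real.norm_eq_abs, abs_sq]; rfl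
        simp only [Function.comp_apply, Equiv.Set.univ_symm_apply, h6]
        linarith
  · intro hf
    refine ⟨hf.1, hf.1.continuousOn, fun e _ => G.integrableOn_edge hf.2.2 e, ?_, ?_⟩
    · intro e _ t ht
      have h1 : AbsolutelyContinuousOnInterval (f ∘ G.edgeMap e) 0 t := (hf.2.1 e).mono (by
        rw [uIcc_of_le ht.1, uIcc_of_le (G.len_pos e).le]; exact Icc_subset_Icc_right ht.2)
      have h2 := h1.integral_deriv_eq_sub
      rw [intervalIntegral.integral_of_le ht.1, integral_Ioc_eq_integral_Ioo] at h2
      simp only [Function.comp_apply] at h2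
      have h3 : ∫ s in Ioo 0 t, G.edgeDeriv f e s = f (G.edgeMap e t) - f (G.edgeMap e 0) := h2
      rw [h3]; ring
    · exact ((l2normSq_eq hf).summable.add (derivNormSq_eq hf).summable).comp_injective
        Subtype.val_injective

theorem l2normSqOn_univ {f : X → ℝ} (hf : f ∈ G.sobolev) :
    G.l2normSqOn univ f = ∫ p, f (G.point p) ^ 2 ∂G.edgeMeasure :=
  (tsum_univ _).trans (l2normSq_eq hf).tsum_eq

end MetricGraphOn

/-- A finite set of vertices cannot be split into two nonempty parts without an adjacency between
the parts. -/
def NoCut {α : Type*} [DecidableEq α] (adj : α → α → Prop) (S : Finset α) : Prop :=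
  ∀ T ⊆ S, T.Nonempty → T ≠ S → ∃ i ∈ T, ∃ j ∈ S \ T, adj i j

theorem MeasureTheory.sq_setIntegral_abs_le {Ω : Type*} [MeasurableSpace Ω] {μ : Measure Ω}
    [IsFiniteMeasure μ] {g : Ω → ℝ} (hg : MemLp g 2 μ) (A : Set Ω) :
    (∫ p in A, |g p| ∂μ) ^ 2 ≤ μ.real A * ∫ p, g p ^ 2 ∂μ := by
  have hg2 : Integrable (fun p => g p ^ 2) μ := hg.integrable_sq
  have hg1 : Integrable (fun p => |g p|) μ := (hg.integrable one_le_two).abs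
  have hle : ∫ p in A, g p ^ 2 ∂μ ≤ ∫ p, g p ^ 2 ∂μ :=
    setIntegral_le_integral hg2 (.of_forall fun _ => sq_nonneg _)
  set I := ∫ p in A, |g p| ∂μ
  set m := μ.real A
  have hm : 0 ≤ m := measureReal_nonneg
  have hE : 0 ≤ ∫ p, g p ^ 2 ∂μ := integral_nonneg fun _ => sq_nonneg _
  have key : ∀ t : ℝ, 0 ≤ (∫ p, g p ^ 2 ∂μ) - 2 * t * I + t ^ 2 * m := fun t => by
    have h1 : 0 ≤ ∫ p in A, (|g p| - t) ^ 2 ∂μ := integral_nonneg fun _ => sq_nonneg _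
    have h2 : ∫ p in A, (|g p| - t) ^ 2 ∂μ = (∫ p in A, g p ^ 2 ∂μ) - 2 * t * I + t ^ 2 * m := by
      have : ∀ p, (|g p| - t) ^ 2 = g p ^ 2 - 2 * t * |g p| + t ^ 2 := fun p => by
        rw [sub_sq, sq_abs]; ring
      simp only [this]
      rw [integral_add, integral_sub, integral_const_mul]
      · simp [I, m, mul_comm]
      · exact hg2.restrict
      · exact (hg1.const_mul _).restrict
      · exact (hg2.sub (hg1.const_mul _)).restrict
      · exact integrable_const _
    linarith
  rcases hm.eq_or_lt with h0 | h0
  · have hI : I = 0 := by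
      by_contra hI
      have := key ((∫ p, g p ^ 2 ∂μ + 1) / (2 * I) )
      rw [← h0] at this
      have h3 : 2 * ((∫ p, g p ^ 2 ∂μ + 1) / (2 * I)) * I = ∫ p, g p ^ 2 ∂μ + 1 := by
        field_simp
      rw [h3] at this
      linarith
    rw [hI, ← h0]; simp
  · have := key (I / m)
    have h3 : (∫ p, g p ^ 2 ∂μ) - 2 * (I / m) * I + (I / m) ^ 2 * m =
        (m * (∫ p, g p ^ 2 ∂μ) - I ^ 2) / m := by field_simp; ring
    rw [h3] at this
    have := (div_nonneg_iff.1 this).resolve_right (fun h => by linarith [h.2])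
    linarith [this.1]

namespace MetricGraphOn

variable {X : Type} [MetricSpace X] (G : MetricGraphOn X)

/-- The length of the arcs subdividing the edge `e`: at level `n = (F, N)` every edge in `F` is
divided into `N + 1` equal arcs. -/
noncomputable def step (n : Finset G.E × ℕ) (e : G.E) : ℝ := G.len e / (n.2 + 1)

noncomputable def cell (n : Finset G.E × ℕ) (i : G.E × ℕ) : Set (G.E × ℝ) :=
  {i.1} ×ˢ Ico (i.2 * G.step n i.1) ((i.2 + 1) * G.step n i.1)

noncomputable def node (n : Finset G.E × ℕ) (i : G.E × ℕ) : X :=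
  G.point (i.1, i.2 * G.step n i.1)

noncomputable def arc (n : Finset G.E × ℕ) (i : G.E × ℕ) : Set X :=
  G.edgeMap i.1 '' Icc (i.2 * G.step n i.1) ((i.2 + 1) * G.step n i.1)

noncomputable def atoms (n : Finset G.E × ℕ) : Finset (G.E × ℕ) :=
  n.1 ×ˢ Finset.range (n.2 + 1)

/-- The edges which are not subdivided at level `n`. -/
def rest (n : Finset G.E × ℕ) : Set (G.E × ℝ) := {e | e ∉ n.1} ×ˢ univ

def restSet (n : Finset G.E × ℕ) : Set X :=
  ⋃ e ∈ {e | e ∉ n.1}, G.edgeMap e '' Icc 0 (G.len e)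

noncomputable def cells (n : Finset G.E × ℕ) (S : Finset (G.E × ℕ)) : Set (G.E × ℝ) :=
  ⋃ i ∈ S, G.cell n i

/-- Two atoms are adjacent if they cannot be separated by a continuous function without zeros on
the rest of the graph. -/
def Adj (n : Finset G.E × ℕ) (i j : G.E × ℕ) : Prop :=
  ∀ g : X → ℝ, Continuous g → (∀ x ∈ G.restSet n, g x ≠ 0) →
    ¬((∀ x ∈ G.arc n i, g x < 0) ∧ ∀ x ∈ G.arc n j, 0 < g x)

noncomputable def meshError (n : Finset G.E × ℕ) : ℝ :=
  √((∑' e, G.len e) / (n.2 + 1)) + √(G.edgeMeasure.real (G.rest n))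

variable {G} {n : Finset G.E × ℕ} {i j : G.E × ℕ} {S : Finset (G.E × ℕ)}

theorem Adj.symm (h : G.Adj n i j) : G.Adj n j i := by
  intro g hg hr ⟨h1, h2⟩
  exact h (fun x => - g x) hg.neg (fun x hx => neg_ne_zero.2 (hr x hx))
    ⟨fun x hx => neg_neg_iff_pos.2 (h2 x hx), fun x hx => neg_pos.2 (h1 x hx)⟩

theorem step_pos (n : Finset G.E × ℕ) (e : G.E) : 0 < G.step n e :=
  div_pos (G.len_pos e) (by positivity)

theorem arc_bounds (hi : i ∈ G.atoms n) : 0 ≤ i.2 * G.step n i.1 ∧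
    i.2 * G.step n i.1 ≤ (i.2 + 1) * G.step n i.1 ∧ (i.2 + 1) * G.step n i.1 ≤ G.len i.1 := by
  have hs := G.step_pos n i.1
  refine ⟨by positivity, by nlinarith, ?_⟩
  have h2 : i.2 < n.2 + 1 := by simpa using (Finset.mem_product.1 hi).2
  have h3 : ((i.2 : ℝ) + 1) ≤ n.2 + 1 := by exact_mod_cast h2
  calc ((i.2 : ℝ) + 1) * G.step n i.1 ≤ (n.2 + 1) * G.step n i.1 := by gcongr
    _ = G.len i.1 := by rw [step]; field_simp

theorem measurableSet_cell : MeasurableSet (G.cell n i) :=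
  (MeasurableSet.singleton _).prod measurableSet_Ico

theorem measurableSet_cells : MeasurableSet (G.cells n S) :=
  S.measurableSet_biUnion fun _ _ => measurableSet_cell

theorem measurableSet_rest : MeasurableSet (G.rest n) :=
  MeasurableSet.prod trivial MeasurableSet.univ

theorem exists_mem_cell_edge (n : Finset G.E × ℕ) {e : G.E} {t : ℝ} (h0 : 0 ≤ t)
    (h1 : t < G.len e) : ∃ m < n.2 + 1, t ∈ Ico (m * G.step n e) ((m + 1) * G.step n e) := by
  have hs := G.step_pos n e
  refine ⟨⌊t / G.step n e⌋₊, ?_, ?_, ?_⟩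
  · rw [Nat.floor_lt (by positivity), div_lt_iff₀ hs]
    refine h1.trans_eq ?_
    push_cast [step]
    field_simp
  · rw [← le_div_iff₀ hs]; exact Nat.floor_le (by positivity)
  · rw [← div_lt_iff₀ hs]; exact Nat.lt_floor_add_one _

theorem exists_mem_arc (n : Finset G.E × ℕ) (x : X) :
    (∃ i ∈ G.atoms n, x ∈ G.arc n i) ∨ x ∈ G.restSet n := by
  obtain ⟨e, t, ht, rfl⟩ := G.cover x
  by_cases he : e ∈ n.1
  · refine Or.inl ?_
    rcases ht.2.lt_or_eq with h | h
    · obtain ⟨m, hm, hm'⟩ := exists_mem_cell_edge n ht.1 h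
      exact ⟨(e, m), by simp [atoms, he, hm], t, Ico_subset_Icc_self hm', rfl⟩
    · refine ⟨(e, n.2), by simp [atoms, he], t, ?_, rfl⟩
      have h2 : ((n.2 : ℝ) + 1) * G.step n e = t := by rw [step, h]; field_simp
      refine ⟨?_, h2.ge⟩
      rw [← h2]
      have := G.step_pos n e
      simp only
      nlinarith
  · exact Or.inr (mem_biUnion (x := e) he ⟨t, ht, rfl⟩)

theorem ae_mem_cells (n : Finset G.E × ℕ) :
    ∀ᵐ p ∂G.edgeMeasure, p ∈ G.cells n (G.atoms n) ∪ G.rest n := by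
  refine ae_of_forall_Ioo fun e t ht => ?_
  by_cases he : e ∈ n.1
  · obtain ⟨m, hm, hm'⟩ := exists_mem_cell_edge n ht.1.le ht.2
    exact Or.inl (mem_biUnion (x := (e, m)) (by simp [atoms, he, hm]) ⟨rfl, hm'⟩)
  · exact Or.inr ⟨he, trivial⟩

theorem disjoint_cell (h : i ≠ j) : Disjoint (G.cell n i) (G.cell n j) := by
  refine Set.disjoint_left.2 fun p hp hp' => h ?_
  have h1 : i.1 = j.1 := hp.1.symm.trans hp'.1
  have hs := G.step_pos n i.1
  have h2 := hp.2
  have h3 := hp'.2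
  rw [← h1] at h3
  have a1 : (i.2 : ℝ) < j.2 + 1 := lt_of_mul_lt_mul_right (h2.1.trans_lt h3.2) hs.le
  have a2 : (j.2 : ℝ) < i.2 + 1 := lt_of_mul_lt_mul_right (h3.1.trans_lt h2.2) hs.le
  norm_cast at a1 a2
  exact Prod.ext h1 (by omega)

theorem disjoint_cells {T : Finset (G.E × ℕ)} (h : Disjoint S T) :
    Disjoint (G.cells n S) (G.cells n T) := by
  simp only [cells, disjoint_iUnion_left, disjoint_iUnion_right]
  exact fun i hi j hj => disjoint_cell (Finset.disjoint_iff_ne.1 h _ hj _ hi)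

theorem disjoint_cells_rest (hS : S ⊆ G.atoms n) : Disjoint (G.cells n S) (G.rest n) := by
  simp only [cells, disjoint_iUnion_left]
  intro i hi
  refine Set.disjoint_left.2 fun p hp hp' => hp'.1 ?_
  rw [show p.1 = i.1 from hp.1]
  exact (Finset.mem_product.1 (hS hi)).1

theorem cells_union [DecidableEq (G.E × ℕ)] {T : Finset (G.E × ℕ)} :
    G.cells n (S ∪ T) = G.cells n S ∪ G.cells n T :=
  Finset.set_biUnion_union _ _ _

theorem cells_singleton : G.cells n {i} = G.cell n i := Finset.set_biUnion_singleton _ _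

theorem isPreconnected_arc (hi : i ∈ G.atoms n) : IsPreconnected (G.arc n i) := by
  obtain ⟨h1, h2, h3⟩ := arc_bounds hi
  exact isPreconnected_Icc.image _ ((G.edgeMap_cont _).mono (Icc_subset_Icc h1 h3))

theorem node_mem_arc (hi : i ∈ G.atoms n) : G.node n i ∈ G.arc n i := by
  obtain ⟨h1, h2, h3⟩ := arc_bounds hi
  exact ⟨_, left_mem_Icc.2 h2, (G.point_eq ⟨h1, h2.trans h3⟩).symm⟩

theorem point_mem_arc (hi : i ∈ G.atoms n) {p : G.E × ℝ} (hp : p ∈ G.cell n i) :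
    G.point p ∈ G.arc n i := by
  obtain ⟨h1, h2, h3⟩ := arc_bounds hi
  have hp1 : p.1 = i.1 := hp.1
  refine ⟨p.2, Ico_subset_Icc_self hp.2, ?_⟩
  rw [show p = (i.1, p.2) from Prod.ext hp1 rfl, G.point_eq]
  exact ⟨h1.trans hp.2.1, hp.2.2.le.trans h3⟩

theorem noCut_atoms [ConnectedSpace X] [DecidableEq (G.E × ℕ)] (n : Finset G.E × ℕ) :
    NoCut (G.Adj n) (G.atoms n) := by
  intro T hT hne hne'
  by_contra hcon
  push Not at hcon
  have hne2 : (G.atoms n \ T).Nonempty :=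
    Finset.sdiff_nonempty.2 fun h => hne' (hT.antisymm h)
  have : ∀ i j, ∃ g : X → ℝ, Continuous g ∧ (i ∈ T → j ∈ G.atoms n \ T →
      (∀ x ∈ G.restSet n, g x ≠ 0) ∧ (∀ x ∈ G.arc n i, g x < 0) ∧ ∀ x ∈ G.arc n j, 0 < g x) := by
    intro i j
    by_cases h : i ∈ T ∧ j ∈ G.atoms n \ T
    · have := hcon i h.1 j h.2
      simp only [Adj, not_forall, not_not] at this
      obtain ⟨g, hg, hr, hg'⟩ := this
      exact ⟨g, hg, fun _ _ => ⟨hr, hg'⟩⟩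
    · exact ⟨0, continuous_zero, fun h1 h2 => absurd ⟨h1, h2⟩ h⟩
  choose g hg hg' using this
  let F : X → ℝ := fun x => T.inf' hne fun i => (G.atoms n \ T).sup' hne2 fun j => g i j x
  have hF : Continuous F := Continuous.finset_inf'_apply hne fun i _ =>
    Continuous.finset_sup'_apply hne2 fun j _ => hg i j
  have hneg : ∀ i ∈ T, ∀ x ∈ G.arc n i, F x < 0 := fun i hi x hx =>
    (Finset.inf'_lt_iff _).2 ⟨i, hi, (Finset.sup'_lt_iff _).2 fun j hj => (hg' i j hi hj).2.1 x hx⟩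
  have hpos : ∀ j ∈ G.atoms n \ T, ∀ x ∈ G.arc n j, 0 < F x := fun j hj x hx =>
    (Finset.lt_inf'_iff _).2 fun i hi => (Finset.lt_sup'_iff _).2 ⟨j, hj, (hg' i j hi hj).2.2 x hx⟩
  have hnz : ∀ x, F x ≠ 0 := by
    intro x
    rcases exists_mem_arc n x with ⟨i, hi, hx⟩ | hx
    · by_cases hiT : i ∈ T
      · exact (hneg i hiT x hx).ne
      · exact (hpos i (Finset.mem_sdiff.2 ⟨hi, hiT⟩) x hx).ne'
    · obtain ⟨i, hi, hFi⟩ := T.exists_mem_eq_inf' hne fun i =>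
        (G.atoms n \ T).sup' hne2 fun j => g i j x
      obtain ⟨j, hj, hFj⟩ := (G.atoms n \ T).exists_mem_eq_sup' hne2 fun j => g i j x
      simp only [F, hFi, hFj]
      exact (hg' i j hi hj).1 x hx
  obtain ⟨i, hi⟩ := hne
  obtain ⟨j, hj⟩ := hne2
  obtain ⟨x, hx⟩ := mem_range_of_exists_le_of_exists_ge hF
    ⟨_, (hneg i hi _ (node_mem_arc (hT hi))).le⟩
    ⟨_, (hpos j hj _ (node_mem_arc (Finset.mem_sdiff.1 hj).1)).le⟩
  exact hnz x hx

theorem volume_image_arc_le {f : X → ℝ} (hf : G.EdgewiseAC f) (hi : i ∈ G.atoms n) :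
    volume (f '' G.arc n i) ≤ ∫⁻ p in G.cell n i, ‖G.dv f p‖ₑ ∂G.edgeMeasure :=
  hf.volume_image_le _ (arc_bounds hi).1 (arc_bounds hi).2.1 (arc_bounds hi).2.2

theorem volume_image_arcs_le {f : X → ℝ} (hf : G.EdgewiseAC f) (hS : S ⊆ G.atoms n) :
    volume ((⋃ i ∈ S, f '' G.arc n i) ∪ f '' G.restSet n) ≤
      ∫⁻ p in G.cells n S ∪ G.rest n, ‖G.dv f p‖ₑ ∂G.edgeMeasure := by
  rw [lintegral_union measurableSet_rest (disjoint_cells_rest hS)]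
  refine (measure_union_le _ _).trans (add_le_add ?_ ?_)
  · rw [cells, lintegral_biUnion_finset (fun i _ j _ h => disjoint_cell h)
      (fun i _ => measurableSet_cell)]
    exact (measure_biUnion_finset_le _ _).trans
      (Finset.sum_le_sum fun i hi => volume_image_arc_le hf (hS hi))
  · rw [restSet]
    simp only [image_iUnion]
    exact hf.volume_image_edges_le _

theorem NoCut.ofReal_sub_le [DecidableEq (G.E × ℕ)] {f : X → ℝ} (hf : G.EdgewiseAC f)
    (hc : Continuous f) (hS : S ⊆ G.atoms n) (hcut : NoCut (G.Adj n) S) (hi : i ∈ S) (hj : j ∈ S) :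
    ENNReal.ofReal (f (G.node n j) - f (G.node n i)) ≤
      ∫⁻ p in G.cells n S ∪ G.rest n, ‖G.dv f p‖ₑ ∂G.edgeMeasure := by
  classical
  refine (ofReal_sub_le_volume fun c h1 h2 => ?_).trans (volume_image_arcs_le hf hS)
  by_contra hcon
  simp only [mem_union, mem_iUnion, mem_image, not_or, not_exists, not_and] at hcon
  have hsign : ∀ i ∈ S, (∀ x ∈ G.arc n i, f x - c < 0) ∨ ∀ x ∈ G.arc n i, 0 < f x - c := by
    intro i hi
    have hpre : IsPreconnected (f '' G.arc n i) :=
      (isPreconnected_arc (hS hi)).image _ hc.continuousOn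
    by_contra hcon2
    push Not at hcon2
    obtain ⟨⟨x, hx, hx'⟩, y, hy, hy'⟩ := hcon2
    obtain ⟨z, hz, hz'⟩ := hpre.Icc_subset ⟨y, hy, rfl⟩ ⟨x, hx, rfl⟩
      (show c ∈ Icc (f y) (f x) from ⟨by linarith, by linarith⟩)
    exact hcon.1 i hi z hz hz'
  obtain ⟨i', hi', j', hj', hadj⟩ := hcut (S.filter fun i => ∀ x ∈ G.arc n i, f x - c < 0)
    (Finset.filter_subset _ _)
    ⟨i, Finset.mem_filter.2 ⟨hi, (hsign i hi).resolve_right fun h => by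
      linarith [h _ (node_mem_arc (hS hi))]⟩⟩
    (fun h => by
      rw [← h] at hj
      linarith [(Finset.mem_filter.1 hj).2 _ (node_mem_arc (hS (Finset.mem_filter.1 hj).1))])
  rw [Finset.mem_sdiff, Finset.mem_filter, not_and] at hj'
  exact hadj (fun x => f x - c) (hc.sub continuous_const)
    (fun x hx h => hcon.2 x hx (sub_eq_zero.1 h))
    ⟨(Finset.mem_filter.1 hi').2, (hsign j' hj'.1).resolve_left (hj'.2 hj'.1)⟩

theorem measureReal_cell_le [IsFiniteMeasure G.edgeMeasure] (hsum : Summable G.len)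
    (n : Finset G.E × ℕ) (i : G.E × ℕ) :
    G.edgeMeasure.real (G.cell n i) ≤ (∑' e, G.len e) / (n.2 + 1) := by
  have h1 : G.edgeMeasure (G.cell n i) ≤ ENNReal.ofReal (G.step n i.1) := by
    rw [cell, G.edgeMeasure_prod _ measurableSet_Ico]
    refine (measure_mono inter_subset_left).trans_eq ?_
    rw [Real.volume_Ico]
    congr 1; ring
  refine (ENNReal.toReal_mono ENNReal.ofReal_ne_top h1).trans ?_
  rw [ENNReal.toReal_ofReal (G.step_pos n _).le, step]
  gcongr
  exact hsum.le_tsum _ fun e _ => (G.len_pos e).le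

theorem tendsto_tsum_div (G : MetricGraphOn X) :
    Tendsto (fun n : Finset G.E × ℕ => (∑' e, G.len e) / (n.2 + 1)) atTop (nhds 0) := by
  have h : Tendsto (fun n : ℕ => (∑' e, G.len e) / ((n : ℝ) + 1)) atTop (nhds 0) := by
    simpa [div_eq_mul_inv] using
      (tendsto_one_div_add_atTop_nhds_zero_nat (𝕜 := ℝ)).const_mul (∑' e, G.len e)
  rw [← prod_atTop_atTop_eq]
  exact h.comp tendsto_snd

theorem tendsto_measureReal_rest (G : MetricGraphOn X) (hsum : Summable G.len) :
    Tendsto (fun n : Finset G.E × ℕ => G.edgeMeasure.real (G.rest n)) atTop (nhds 0) := by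
  have h : Tendsto (fun s : Finset G.E => ∑' e : {e // e ∉ s}, G.len e) atTop (nhds 0) :=
    tendsto_tsum_compl_atTop_zero _
  have h2 : Tendsto (fun n : Finset G.E × ℕ => ∑' e : {e // e ∉ n.1}, G.len e) atTop (nhds 0) := by
    rw [← prod_atTop_atTop_eq]; exact h.comp tendsto_fst
  refine h2.congr fun n => ?_
  have h3 : G.edgeMeasure (G.rest n) = ENNReal.ofReal (∑' e : {e // e ∉ n.1}, G.len e) := by
    have : G.rest n = ⋃ e : {e // e ∉ n.1}, {(e : G.E)} ×ˢ univ := by ext ⟨e, t⟩; simp [rest]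
    rw [this, measure_iUnion, ENNReal.ofReal_tsum_of_nonneg (fun e => (G.len_pos _).le)
      (hsum.subtype _)]
    · refine tsum_congr fun e => ?_
      rw [G.edgeMeasure_prod _ MeasurableSet.univ]; simp
    · intro e e' h
      exact Set.disjoint_left.2 fun p hp hp' => h (Subtype.ext (hp.1.symm.trans hp'.1))
    · exact fun e => (MeasurableSet.singleton _).prod MeasurableSet.univ
  rw [Measure.real, h3, ENNReal.toReal_ofReal (tsum_nonneg fun e => (G.len_pos _).le)]

theorem meshError_nonneg (n : Finset G.E × ℕ) : 0 ≤ G.meshError n := by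
  unfold meshError; positivity

theorem tendsto_meshError (G : MetricGraphOn X) (hsum : Summable G.len) :
    Tendsto G.meshError atTop (nhds 0) := by
  have h := ((Real.continuous_sqrt.tendsto 0).comp G.tendsto_tsum_div).add
    ((Real.continuous_sqrt.tendsto 0).comp (G.tendsto_measureReal_rest hsum))
  rw [Real.sqrt_zero, add_zero] at h
  exact h

namespace sobolev

variable [IsFiniteMeasure G.edgeMeasure] {f : X → ℝ}

theorem setIntegral_rest_le (hf : f ∈ G.sobolev) (n : Finset G.E × ℕ) :
    ∫ p in G.rest n, |G.dv f p| ∂G.edgeMeasure ≤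
      G.meshError n * √(∫ p, G.dv f p ^ 2 ∂G.edgeMeasure) := by
  have h := Real.le_sqrt_of_sq_le (sq_setIntegral_abs_le (memLp_dv hf) (G.rest n))
  rw [Real.sqrt_mul measureReal_nonneg] at h
  refine h.trans (mul_le_mul_of_nonneg_right ?_ (Real.sqrt_nonneg _))
  exact le_add_of_nonneg_left (Real.sqrt_nonneg _)

theorem setIntegral_cell_le (hsum : Summable G.len) (hf : f ∈ G.sobolev)
    (n : Finset G.E × ℕ) (i : G.E × ℕ) :
    ∫ p in G.cell n i, |G.dv f p| ∂G.edgeMeasure ≤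
      G.meshError n * √(∫ p, G.dv f p ^ 2 ∂G.edgeMeasure) := by
  have h := Real.le_sqrt_of_sq_le (sq_setIntegral_abs_le (memLp_dv hf) (G.cell n i))
  rw [Real.sqrt_mul measureReal_nonneg] at h
  refine h.trans (mul_le_mul_of_nonneg_right ?_ (Real.sqrt_nonneg _))
  refine (Real.sqrt_le_sqrt (measureReal_cell_le hsum n i)).trans ?_
  exact le_add_of_nonneg_right (Real.sqrt_nonneg _)

theorem le_of_ofReal_le {A : Set (G.E × ℝ)} (hf : f ∈ G.sobolev) {r : ℝ}
    (h : ENNReal.ofReal r ≤ ∫⁻ p in A, ‖G.dv f p‖ₑ ∂G.edgeMeasure) :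
    r ≤ ∫ p in A, |G.dv f p| ∂G.edgeMeasure := by
  have h2 := ofReal_integral_norm_eq_lintegral_enorm (integrable_dv hf).integrableOn (μ :=
    G.edgeMeasure.restrict A)
  rw [← h2, ENNReal.ofReal_le_ofReal_iff (integral_nonneg fun _ => norm_nonneg _)] at h
  exact h

theorem abs_sub_node_le_of_mem_arc (hsum : Summable G.len) (hf : f ∈ G.sobolev)
    (hi : i ∈ G.atoms n) {x : X} (hx : x ∈ G.arc n i) :
    |f x - f (G.node n i)| ≤ G.meshError n * √(∫ p, G.dv f p ^ 2 ∂G.edgeMeasure) := by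
  have hpre : IsPreconnected (f '' G.arc n i) := (isPreconnected_arc hi).image _ hf.1.continuousOn
  have key : ∀ x ∈ G.arc n i, ∀ y ∈ G.arc n i, f y - f x ≤
      G.meshError n * √(∫ p, G.dv f p ^ 2 ∂G.edgeMeasure) := fun x hx y hy =>
    (le_of_ofReal_le hf ((ofReal_sub_le_volume fun c h1 h2 => hpre.Icc_subset ⟨x, hx, rfl⟩
      ⟨y, hy, rfl⟩ ⟨h1.le, h2.le⟩).trans (volume_image_arc_le (edgewiseAC hf) hi))).trans
      (setIntegral_cell_le hsum hf n i)
  exact abs_sub_le_iff.2 ⟨key _ (node_mem_arc hi) _ hx, key _ hx _ (node_mem_arc hi)⟩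

/-- A Sobolev function is controlled by its values at the nodes of a subdivision. -/
theorem abs_le_of_forall_node [ConnectedSpace X] (hsum : Summable G.len) (hf : f ∈ G.sobolev)
    (hne : (G.atoms n).Nonempty) {M : ℝ} (hM : ∀ i ∈ G.atoms n, |f (G.node n i)| ≤ M) (x : X) :
    |f x| ≤ M + 2 * (G.meshError n * √(∫ p, G.dv f p ^ 2 ∂G.edgeMeasure)) := by
  have key : ∀ f ∈ G.sobolev, (∀ i ∈ G.atoms n, |f (G.node n i)| ≤ M) →
      f x ≤ M + 2 * (G.meshError n * √(∫ p, G.dv f p ^ 2 ∂G.edgeMeasure)) := by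
    intro f hf hM
    set ε := G.meshError n * √(∫ p, G.dv f p ^ 2 ∂G.edgeMeasure) with hε
    have harc : ∀ i ∈ G.atoms n, ∀ y ∈ G.arc n i, f y ≤ M + ε := fun i hi y hy => by
      linarith [(abs_le.1 (abs_sub_node_le_of_mem_arc hsum hf hi hy)).2, (abs_le.1 (hM i hi)).2]
    obtain ⟨i₀, hi₀⟩ := hne
    have h := (edgewiseAC hf).volume_image_edges_le {e | e ∉ n.1}
    have h2 := (le_of_ofReal_le hf ((show ENNReal.ofReal (f x - (M + ε)) ≤ _ from ?_).trans
      h)).trans (setIntegral_rest_le hf n)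
    · linarith
    · rw [← Real.volume_Ioo]
      refine measure_mono fun c hc => ?_
      obtain ⟨z, rfl⟩ := mem_range_of_exists_le_of_exists_ge hf.1
        ⟨_, (harc i₀ hi₀ _ (node_mem_arc hi₀)).trans hc.1.le⟩ ⟨x, hc.2.le⟩
      rcases exists_mem_arc n z with ⟨i, hi, hz⟩ | hz
      · exact absurd (harc i hi z hz) (not_le.2 hc.1)
      · simp only [restSet, mem_iUnion] at hz ⊢
        obtain ⟨e, he, hz⟩ := hz
        exact ⟨e, he, z, hz, rfl⟩
  refine abs_le.2 ⟨?_, key f hf hM⟩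
  have h := key (-f) (neg_mem hf) (fun i hi => by simpa using hM i hi)
  have h2 : ∀ p, G.dv (-f) p = - G.dv f p := fun p => by
    have := G.dv_smul (-1) f p
    simpa using this
  simp only [h2, neg_sq, Pi.neg_apply] at h
  linarith

end sobolev

end MetricGraphOn

namespace NoCut

variable {α : Type*} [DecidableEq α] {adj : α → α → Prop} {S T : Finset α} {p q : α}

theorem singleton (p : α) : NoCut adj {p} := fun _ hT hne hne' =>
  absurd ((Finset.subset_singleton_iff.1 hT).resolve_left hne.ne_empty) hne'

theorem of_forall_notMem (hsymm : ∀ i j, adj i j → adj j i)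
    (h : ∀ T ⊆ S, T.Nonempty → p ∉ T → ∃ i ∈ T, ∃ j ∈ S \ T, adj i j) : NoCut adj S := by
  intro T hT hne hne'
  by_cases hpT : p ∈ T
  · obtain ⟨i, hi, j, hj, hij⟩ := h (S \ T) Finset.sdiff_subset
      (Finset.sdiff_nonempty.2 fun h => hne' (hT.antisymm h)) (by simp [hpT])
    rw [Finset.sdiff_sdiff_eq_self hT] at hj
    exact ⟨j, hj, i, hi, hsymm _ _ hij⟩
  · exact h T hT hne hpT

theorem union (hS : NoCut adj S) (hT : NoCut adj T) (hpS : p ∈ S) (hpT : p ∈ T) :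
    NoCut adj (S ∪ T) := by
  intro U hU hne hne'
  by_contra hcon
  push Not at hcon
  have key : ∀ R, NoCut adj R → R ⊆ S ∪ T → (U ∩ R).Nonempty → R ⊆ U := fun R hR hRST hUR => by
    by_contra h
    obtain ⟨i, hi, j, hj, hij⟩ := hR (U ∩ R) Finset.inter_subset_right hUR
      fun h2 => h (Finset.inter_eq_right.1 h2)
    simp only [Finset.mem_inter, Finset.mem_sdiff, not_and] at hi hj
    exact hcon i hi.1 j (Finset.mem_sdiff.2 ⟨hRST hj.1, fun h3 => hj.2 h3 hj.1⟩) hij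
  have key1 := key S hS Finset.subset_union_left
  have key2 := key T hT Finset.subset_union_right
  refine hne' (hU.antisymm ?_)
  obtain ⟨x, hx⟩ := hne
  rcases Finset.mem_union.1 (hU hx) with h | h
  · have h1 := key1 ⟨x, Finset.mem_inter.2 ⟨hx, h⟩⟩
    exact Finset.union_subset h1 (key2 ⟨p, Finset.mem_inter.2 ⟨h1 hpS, hpT⟩⟩)
  · have h1 := key2 ⟨x, Finset.mem_inter.2 ⟨hx, h⟩⟩
    exact Finset.union_subset (key1 ⟨p, Finset.mem_inter.2 ⟨h1 hpT, hpS⟩⟩) h1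

theorem insert (hsymm : ∀ i j, adj i j → adj j i) (hS : NoCut adj S) (hp : p ∈ S)
    (hpq : adj p q) : NoCut adj (insert q S) := by
  have h : NoCut adj {p, q} := by
    refine of_forall_notMem hsymm (p := p) fun T hT hne hpT => ?_
    have hT2 : T = {q} := by
      refine (Finset.subset_singleton_iff.1 fun x hx => ?_).resolve_left hne.ne_empty
      have := hT hx
      simp only [Finset.mem_insert, Finset.mem_singleton] at this ⊢
      exact this.resolve_left fun h => hpT (h ▸ hx)
    subst hT2
    exact ⟨q, by simp, p, by simpa using fun h => hpT (by simp [h]), hsymm _ _ hpq⟩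
  have h2 := union hS h hp (by simp)
  have h3 : S ∪ {p, q} = Insert.insert q S := by
    ext x; simp only [Finset.mem_union, Finset.mem_insert, Finset.mem_singleton]
    constructor
    · rintro (h | rfl | rfl) <;> simp_all
    · rintro (rfl | h) <;> simp_all
  rwa [h3] at h2

/-- A connected set of total weight at least `a` splits at a vertex `p` into a part containing a
given root and two parts of weight less than `a` (up to the weight of `p`), which together
have weight at least `a`. -/
theorem exists_branches (hsymm : ∀ i j, adj i j → adj j i) (w : α → ℝ) {a : ℝ} {C : Finset α}
    (hC : NoCut adj C) {o : α} (ho : o ∈ C) (hw : ∀ i ∈ C, w i < a)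
    (hCa : a ≤ ∑ i ∈ C, w i) :
    ∃ p, ∃ B₁ B₂ K : Finset α, NoCut adj B₁ ∧ NoCut adj B₂ ∧ NoCut adj K ∧ p ∈ B₁ ∧ p ∈ B₂ ∧
      p ∈ K ∧ o ∈ K ∧ B₁ ∪ B₂ ∪ K = C ∧ B₁ ∩ B₂ ⊆ {p} ∧ (B₁ ∪ B₂) ∩ K ⊆ {p} ∧
      ∑ i ∈ B₁ \ {p}, w i < a ∧ ∑ i ∈ B₂, w i < a ∧ a ≤ ∑ i ∈ B₁ ∪ B₂, w i := by
  classical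
  let P : ℕ → Prop := fun m => ∃ D K : Finset α, ∃ p, D.card = m ∧ p ∈ D ∧ p ∈ K ∧ o ∈ K ∧
    D ∪ K = C ∧ D ∩ K ⊆ {p} ∧ NoCut adj D ∧ NoCut adj K ∧ a ≤ ∑ i ∈ D, w i
  have hP : ∃ m, P m := ⟨C.card, C, {o}, o, rfl, ho, by simp, by simp,
    Finset.union_eq_left.2 (by simpa using ho), Finset.inter_subset_right, hC, singleton o, hCa⟩
  obtain ⟨D, K, p, hDm, hpD, hpK, hoK, hDK, h_int, hD, hK, hDa⟩ := Nat.find_spec hP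
  have hmin : ∀ D' K' : Finset α, ∀ p', D'.card < D.card → p' ∈ D' → p' ∈ K' → o ∈ K' →
      D' ∪ K' = C → D' ∩ K' ⊆ {p'} → NoCut adj D' → NoCut adj K' → ∑ i ∈ D', w i < a := by
    intro D' K' p' h h1 h2 h3 h4 h5 h6 h7
    by_contra hcon
    exact Nat.find_min hP (h.trans_eq hDm)
      ⟨D', K', p', rfl, h1, h2, h3, h4, h5, h6, h7, not_lt.1 hcon⟩
  have hDC : D ⊆ C := hDK ▸ Finset.subset_union_left
  have hne : (D \ {p}).Nonempty := by
    refine Finset.sdiff_nonempty.2 fun h => ?_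
    have : D = {p} := h.antisymm (by simpa using hpD)
    rw [this, Finset.sum_singleton] at hDa
    exact (hw p (hDC hpD)).not_ge hDa
  obtain ⟨x, hx⟩ := hne
  obtain ⟨B, hB, hBmax⟩ := Finset.exists_max_image
    ((D \ {p}).powerset.filter fun B => B.Nonempty ∧ NoCut adj B) Finset.card
    ⟨{x}, by simpa using ⟨Finset.mem_sdiff.1 hx |>.imp id (by simp), singleton x⟩⟩
  simp only [Finset.mem_filter, Finset.mem_powerset] at hB hBmax
  obtain ⟨hBD, hBne, hBc⟩ := hB
  have hBD' : B ⊆ D := hBD.trans Finset.sdiff_subset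
  have hpB : p ∉ B := fun h => by simpa using hBD h
  have hnadj : ∀ q ∈ D, q ≠ p → q ∉ B → ∀ i ∈ B, ¬ adj i q := by
    intro q hq hqp hqB i hi hiq
    have := hBmax (Insert.insert q B) ⟨Finset.insert_subset (by simp [hq, hqp]) hBD, by simp,
      hBc.insert hsymm hi hiq⟩
    rw [Finset.card_insert_of_notMem hqB] at this
    omega
  obtain ⟨i, hi, j, hj, hij⟩ := hD B hBD' hBne fun h => hpB (h ▸ hpD)
  obtain ⟨hjD, hjB⟩ := Finset.mem_sdiff.1 hj
  have hjp : j = p := by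
    by_contra h
    exact hnadj j hjD h hjB i hi hij
  subst hjp
  have hB1 : NoCut adj (Insert.insert j B) := hBc.insert hsymm hi hij
  have hB2 : NoCut adj (D \ B) := by
    refine of_forall_notMem (p := j) hsymm fun T hT hTne hpT => ?_
    obtain ⟨i', hi', j', hj', hij'⟩ := hD T (hT.trans Finset.sdiff_subset) hTne
      fun h => hpT (h ▸ hpD)
    refine ⟨i', hi', j', ?_, hij'⟩
    simp only [Finset.mem_sdiff] at hj' ⊢
    refine ⟨⟨hj'.1, fun h => ?_⟩, hj'.2⟩
    have h2 := Finset.mem_sdiff.1 (hT hi')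
    exact hnadj i' h2.1 (fun h => hpT (h ▸ hi')) h2.2 j' h (hsymm _ _ hij')
  have hmem : ∀ x, x ∈ D → x ∈ K → x = j := fun x h1 h2 => by
    simpa using h_int (Finset.mem_inter.2 ⟨h1, h2⟩)
  have hsum1 : ∑ i ∈ B, w i < a := by
    refine hmin B (Insert.insert i (K ∪ D \ B)) i ?_ hi (by simp) (by simp [hoK]) ?_ ?_ hBc ?_
    · exact Finset.card_lt_card ⟨hBD', fun h => hjB (h hjD)⟩
    · rw [← hDK]; clear * - hBD' hi; grind
    · intro x hx
      simp only [Finset.mem_inter, Finset.mem_insert, Finset.mem_union, Finset.mem_sdiff] at hx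
      obtain ⟨h1, h2 | h2 | h2⟩ := hx
      · simp [h2]
      · exact absurd (hmem x (hBD' h1) h2 ▸ h1) hpB
      · exact absurd h1 h2.2
    · exact (hK.union hB2 hpK hj).insert hsymm (p := j) (by simp [hpK]) (hsymm _ _ hij)
  have hsum2 : ∑ i ∈ D \ B, w i < a := by
    refine hmin (D \ B) (K ∪ Insert.insert j B) j ?_ hj (by simp) (by simp [hoK]) ?_ ?_ hB2 ?_
    · exact Finset.card_lt_card ⟨Finset.sdiff_subset, fun h =>
        (Finset.mem_sdiff.1 (h (hBD' hi))).2 hi⟩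
    · rw [← hDK]; clear * - hBD' hjD; grind
    · intro x hx
      simp only [Finset.mem_inter, Finset.mem_insert, Finset.mem_union, Finset.mem_sdiff] at hx
      obtain ⟨h1, h2 | h2 | h2⟩ := hx
      · simpa using hmem x h1.1 h2
      · simp [h2]
      · exact absurd h2 h1.2
    · exact hK.union hB1 hpK (by simp)
  have hD12 : Insert.insert j B ∪ D \ B = D := by
    clear * - hBD' hjD; grind
  refine ⟨j, Insert.insert j B, D \ B, K, hB1, hB2, hK, by simp, hj, hpK, hoK,
    by rw [hD12, hDK], ?_,
    by rwa [hD12], ?_, hsum2, by rwa [hD12]⟩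
  · intro x hx
    simp only [Finset.mem_inter, Finset.mem_insert, Finset.mem_sdiff] at hx
    simpa using hx.1.resolve_right hx.2.2
  · have : Insert.insert j B \ {j} = B := by
      ext x; simp only [Finset.mem_sdiff, Finset.mem_insert, Finset.mem_singleton]
      constructor
      · rintro ⟨h | h, h2⟩
        exacts [absurd h h2, h]
      · exact fun h => ⟨Or.inr h, fun h2 => hpB (h2 ▸ h)⟩
    rwa [this]

end NoCut

theorem LinearMap.eq_zero_of_forall_nonneg {H : Type*} [AddCommGroup H] [Module ℝ H]
    {b : H →ₗ[ℝ] H →ₗ[ℝ] ℝ} (hb : ∀ f g, b f g = b g f) {V : Submodule ℝ H}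
    (hV : ∀ f ∈ V, 0 ≤ b f f) {s g : H} (hs : s ∈ V) (hg : g ∈ V) (h0 : b s s ≤ 0) :
    b s g = 0 := by
  have key : ∀ t : ℝ, 0 ≤ 2 * t * b s g + b g g * t ^ 2 := fun t => by
    have h := hV (s + t • g) (V.add_mem hs (V.smul_mem t hg))
    simp only [map_add, map_smul, LinearMap.add_apply, LinearMap.smul_apply, smul_eq_mul] at h
    rw [hb g s] at h
    linarith
  by_contra h
  have hgg := hV g hg
  have h1 := key (-b s g / (b g g + 1))
  have h2 : 2 * (-b s g / (b g g + 1)) * b s g + b g g * (-b s g / (b g g + 1)) ^ 2 =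
      - (b s g ^ 2 * (b g g + 2)) / (b g g + 1) ^ 2 := by field_simp; ring
  rw [h2] at h1
  have h3 : 0 < b s g ^ 2 * (b g g + 2) / (b g g + 1) ^ 2 := by
    have := pow_pos (abs_pos.2 h) 2
    rw [sq_abs] at this
    positivity
  rw [neg_div] at h1
  linarith

theorem Submodule.finrank_le_finrank_inf_ker_add {H E : Type*} [AddCommGroup H] [Module ℝ H]
    [AddCommGroup E] [Module ℝ E] [FiniteDimensional ℝ E] (V : Submodule ℝ H)
    [FiniteDimensional ℝ V] (Φ : H →ₗ[ℝ] E) :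
    Module.finrank ℝ V ≤ Module.finrank ℝ ↥(V ⊓ LinearMap.ker Φ) + Module.finrank ℝ E := by
  have h1 := LinearMap.finrank_range_add_finrank_ker (Φ.domRestrict V)
  have h2 : (LinearMap.ker (Φ.domRestrict V)).map V.subtype = V ⊓ LinearMap.ker Φ := by
    ext x; simp [and_comm]
  have h3 := Submodule.finrank_map_subtype_eq V (LinearMap.ker (Φ.domRestrict V))
  rw [h2] at h3
  have h4 := Submodule.finrank_le (LinearMap.range (Φ.domRestrict V))
  omega

/-- A limit, along an ultrafilter, of finite weighted graphs which discretise a metric graph, with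
the quadratic forms induced on regions (families of vertex sets). The number `a` is the length
of an interval whose first mixed Dirichlet-Neumann eigenvalue is `ω ^ 2`. -/
structure UltraGraph (H ι α : Type*) [AddCommGroup H] [Module ℝ H] [DecidableEq α] where
  U : Ultrafilter ι
  adj : ι → α → α → Prop
  adj_symm : ∀ n i j, adj n i j → adj n j i
  vert : ι → Finset α
  wt : ι → α → ℝ
  wt_lt : ∀ ε > 0, ∀ᶠ n in U, ∀ i, wt n i < ε
  a : ℝ
  ω : ℝ
  a_pos : 0 < a
  ω_pos : 0 < ω
  N : (ι → Finset α) → H →ₗ[ℝ] H →ₗ[ℝ] ℝ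
  Q : (ι → Finset α) → H →ₗ[ℝ] H →ₗ[ℝ] ℝ
  N_symm : ∀ S f g, N S f g = N S g f
  Q_symm : ∀ S f g, Q S f g = Q S g f
  N_nonneg : ∀ S f, 0 ≤ N S f f
  Q_nonneg : ∀ S f, 0 ≤ Q S f f
  one : H
  Q_one : ∀ S f, Q S f one = 0
  ev : (ι → α) → H →ₗ[ℝ] ℝ
  ev_one : ∀ p, ev p one = 1
  tendsto_wt : ∀ S, (∀ᶠ n in U, S n ⊆ vert n) →
    Tendsto (fun n => ∑ i ∈ S n, wt n i) U (nhds (N S one one))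
  form_add : ∀ (S S₁ S₂ : ι → Finset α) (p : ι → α), (∀ᶠ n in U, S n ⊆ vert n) →
    (∀ᶠ n in U, S n = S₁ n ∪ S₂ n ∧ S₁ n ∩ S₂ n ⊆ {p n}) →
      N S = N S₁ + N S₂ ∧ Q S = Q S₁ + Q S₂
  pos : H → H
  pos_sub : ∀ f, pos f - pos (-f) = f
  N_pos : ∀ S f, N S (pos f) (pos (-f)) = 0
  Q_pos : ∀ S f, Q S (pos f) (pos (-f)) = 0
  N_pos_one : ∀ S f, 0 ≤ N S (pos f) one
  N_pos_eq_zero : ∀ S f, N S (pos f) one = 0 → N S (pos f) (pos f) = 0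
  supp : (ι → Finset α) → H → ℝ
  supp_nonneg : ∀ S f, 0 ≤ supp S f
  supp_add_le : ∀ S f, supp S f + supp S (-f) ≤ N S one one
  faber_krahn : ∀ S p f, (∀ᶠ n in U, S n ⊆ vert n ∧ NoCut (adj n) (S n) ∧ p n ∈ S n) →
    ev p f = 0 → supp S f ≤ a → ω ^ 2 * N S (pos f) (pos f) ≤ Q S (pos f) (pos f)
  faber_krahn_eq : ∀ S p f, (∀ᶠ n in U, S n ⊆ vert n ∧ NoCut (adj n) (S n) ∧ p n ∈ S n) →
    ev p f = 0 → supp S f < a → Q S (pos f) (pos f) ≤ ω ^ 2 * N S (pos f) (pos f) →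
      N S (pos f) (pos f) = 0

namespace UltraGraph

variable {H ι α : Type*} [AddCommGroup H] [Module ℝ H] [DecidableEq α] (G : UltraGraph H ι α)
  {S C B R : ι → Finset α} {p x : ι → α} {f g : H} {m : ℕ} {V : Submodule ℝ H}

def Conn (S : ι → Finset α) (p : ι → α) : Prop :=
  ∀ᶠ n in G.U, S n ⊆ G.vert n ∧ NoCut (G.adj n) (S n) ∧ p n ∈ S n

def form (S : ι → Finset α) : H →ₗ[ℝ] H →ₗ[ℝ] ℝ := G.Q S - G.ω ^ 2 • G.N S

theorem form_apply (S : ι → Finset α) (f g : H) :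
    G.form S f g = G.Q S f g - G.ω ^ 2 * G.N S f g := rfl

theorem form_symm (S : ι → Finset α) (f g : H) : G.form S f g = G.form S g f := by
  simp only [form_apply, G.N_symm S f, G.Q_symm S f]

variable {G}

theorem N_eq_zero (h : G.N S f f = 0) (g : H) : G.N S f g = 0 :=
  LinearMap.eq_zero_of_forall_nonneg (G.N_symm S) (V := ⊤) (fun f _ => G.N_nonneg S f) trivial
    trivial h.le

theorem form_eq_zero (h : G.N S f f = 0) (hq : G.form S f f ≤ 0) (g : H) : G.form S f g = 0 := by
  have h2 : G.Q S f g = 0 :=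
    LinearMap.eq_zero_of_forall_nonneg (G.Q_symm S) (V := ⊤) (fun f _ => G.Q_nonneg S f) trivial
      trivial (by simpa [form_apply, h] using hq)
  rw [form_apply, h2, N_eq_zero h]; simp

theorem pos_decomp {b : H →ₗ[ℝ] H →ₗ[ℝ] ℝ} (hb : ∀ f g, b f g = b g f)
    (h0 : b (G.pos f) (G.pos (-f)) = 0) :
    b f f = b (G.pos f) (G.pos f) + b (G.pos (-f)) (G.pos (-f)) := by
  conv_lhs => rw [← G.pos_sub f]
  simp only [map_sub, LinearMap.sub_apply]
  rw [hb (G.pos (-f)) (G.pos f), h0]; ring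

theorem form_pos (S : ι → Finset α) (f : H) : G.form S (G.pos f) (G.pos (-f)) = 0 := by
  simp [form_apply, G.N_pos, G.Q_pos]

theorem form_pos_nonneg (hS : G.Conn S p) (hm : G.N S G.one G.one ≤ G.a) (hf : G.ev p f = 0) :
    0 ≤ G.form S (G.pos f) (G.pos f) := by
  rw [form_apply]
  linarith [G.faber_krahn S p f hS hf (by linarith [G.supp_add_le S f, G.supp_nonneg S (-f)])]

theorem form_nonneg (hS : G.Conn S p) (hm : G.N S G.one G.one ≤ G.a) (hf : G.ev p f = 0) :
    0 ≤ G.form S f f := by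
  rw [pos_decomp (G.form_symm S) (form_pos S f)]
  exact add_nonneg (form_pos_nonneg hS hm hf) (form_pos_nonneg hS hm (by simp [hf]))

theorem form_pos_nonpos (hS : G.Conn S p) (hm : G.N S G.one G.one ≤ G.a) (hf : G.ev p f = 0)
    (hq : G.form S f f ≤ 0) : G.form S (G.pos f) (G.pos f) ≤ 0 := by
  rw [pos_decomp (G.form_symm S) (form_pos S f)] at hq
  linarith [form_pos_nonneg hS hm (f := -f) (by simp [hf])]

theorem ell_ne_zero_of_pos (hS : G.Conn S p) (hm : G.N S G.one G.one ≤ G.a) (hf : G.ev p f = 0)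
    (hq : G.form S f f ≤ 0) (hN : G.N S (G.pos f) (G.pos f) ≠ 0) :
    G.N S G.one G.one = G.a ∧ G.N S (G.pos (-f)) (G.pos (-f)) = 0 ∧ G.N S f G.one ≠ 0 := by
  have h1 : G.a ≤ G.supp S f := by
    by_contra h
    have := form_pos_nonpos hS hm hf hq
    exact hN (G.faber_krahn_eq S p f hS hf (not_le.1 h) (by rw [form_apply] at this; linarith))
  have h2 := G.supp_add_le S f
  have h3 := G.supp_nonneg S (-f)
  have h4 : G.N S (G.pos (-f)) (G.pos (-f)) = 0 := by
    have := form_pos_nonpos hS hm (f := -f) (by simp [hf]) (by simpa using hq)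
    exact G.faber_krahn_eq S p (-f) hS (by simp [hf]) (by linarith [G.a_pos])
      (by rw [form_apply] at this; linarith)
  refine ⟨by linarith, h4, fun h => hN (G.N_pos_eq_zero S f ?_)⟩
  conv_lhs at h => rw [← G.pos_sub f]
  rwa [map_sub, LinearMap.sub_apply, N_eq_zero h4, sub_zero] at h

theorem ell_ne_zero (hS : G.Conn S p) (hm : G.N S G.one G.one ≤ G.a) (hf : G.ev p f = 0)
    (hq : G.form S f f ≤ 0) (hN : G.N S f f ≠ 0) :
    G.N S G.one G.one = G.a ∧ G.N S f G.one ≠ 0 := by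
  by_cases h : G.N S (G.pos f) (G.pos f) = 0
  · have h2 : G.N S (G.pos (-f)) (G.pos (-f)) ≠ 0 := fun h2 => hN (by
      rw [pos_decomp (G.N_symm S) (G.N_pos S f), h, h2, add_zero])
    have := ell_ne_zero_of_pos hS hm (f := -f) (by simp [hf]) (by simpa using hq) h2
    exact ⟨this.1, by simpa using this.2.2⟩
  · have := ell_ne_zero_of_pos hS hm hf hq h
    exact ⟨this.1, this.2.2⟩

theorem N_eq_zero_of_ell (hS : G.Conn S p) (hm : G.N S G.one G.one ≤ G.a) (hf : G.ev p f = 0)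
    (hq : G.form S f f ≤ 0) (h : G.N S f G.one = 0) : G.N S f f = 0 := by
  by_contra hN
  exact (ell_ne_zero hS hm hf hq hN).2 h

theorem form_eq (hS : G.Conn S p) (hm : G.N S G.one G.one ≤ G.a) (hf : G.ev p f = 0)
    (hq : G.form S f f ≤ 0) (g : H) :
    G.form S f g = - G.ω ^ 2 * G.ev p g * G.N S f G.one := by
  have h := LinearMap.eq_zero_of_forall_nonneg (G.form_symm S) (V := LinearMap.ker (G.ev p))
    (fun f hf => form_nonneg hS hm hf) (s := f) (g := g - G.ev p g • G.one) hf
    (by simp [G.ev_one]) hq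
  rw [map_sub, map_smul, sub_eq_zero] at h
  rw [h, smul_eq_mul, form_apply, G.Q_one]; ring

/-- A decomposition of the region `C` into `m` arms of mass at most `a` attached at `p`. -/
structure IsArms (C : ι → Finset α) (p : ι → α) (B : Fin m → ι → Finset α)
    (P : Fin m → ι → α) : Prop where
  conn : ∀ i, G.Conn (B i) (P i)
  ev : ∀ i, G.ev (P i) = G.ev p
  mass : ∀ i, G.N (B i) G.one G.one ≤ G.a
  N : G.N C = ∑ i, G.N (B i)
  form : G.form C = ∑ i, G.form (B i)
  cover : ∀ᶠ n in G.U, ∀ x ∈ C n, ∃ i, x ∈ B i n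

namespace IsArms

variable {B : Fin m → ι → Finset α} {P : Fin m → ι → α}

theorem form_nonneg (h : G.IsArms C p B P) (hf : G.ev p f = 0) (i : Fin m) :
    0 ≤ G.form (B i) f f :=
  UltraGraph.form_nonneg (h.conn i) (h.mass i) (by rw [h.ev, hf])

theorem form_arm (h : G.IsArms C p B P) (hf : G.ev p f = 0) (hq : G.form C f f ≤ 0) (i : Fin m) :
    G.form (B i) f f ≤ 0 := by
  rw [h.form] at hq
  simp only [LinearMap.sum_apply] at hq
  exact (Finset.single_le_sum (f := fun i => G.form (B i) f f)
    (fun j _ => h.form_nonneg hf j) (Finset.mem_univ i)).trans hq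

theorem form_total_nonneg (h : G.IsArms C p B P) (hf : G.ev p f = 0) : 0 ≤ G.form C f f := by
  rw [h.form]
  simp only [LinearMap.sum_apply]
  exact Finset.sum_nonneg fun j _ => h.form_nonneg hf j

theorem form_eq (h : G.IsArms C p B P) (hf : G.ev p f = 0) (hq : G.form C f f ≤ 0) (g : H) :
    G.form C f g = - G.ω ^ 2 * G.ev p g * G.N C f G.one := by
  rw [h.form, h.N]
  simp only [LinearMap.sum_apply, Finset.mul_sum]
  refine Finset.sum_congr rfl fun i _ => ?_
  rw [UltraGraph.form_eq (h.conn i) (h.mass i) (by rw [h.ev, hf]) (h.form_arm hf hq i), h.ev]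

theorem N_eq_zero (h : G.IsArms C p B P) (hf : G.ev p f = 0) (hq : G.form C f f ≤ 0)
    (hl : ∀ i, G.N (B i) f G.one = 0) : G.N C f f = 0 := by
  rw [h.N]
  simp only [LinearMap.sum_apply]
  exact Finset.sum_eq_zero fun i _ => N_eq_zero_of_ell (h.conn i) (h.mass i) (by rw [h.ev, hf])
    (h.form_arm hf hq i) (hl i)

/-- The vector of integrals over the arms. -/
def ell (B : Fin m → ι → Finset α) (G : UltraGraph H ι α) : H →ₗ[ℝ] (Fin m → ℝ) :=
  LinearMap.pi fun i => (G.N (B i)).flip G.one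

theorem ell_apply (f : H) (i : Fin m) : ell B G f i = G.N (B i) f G.one := rfl

theorem injective (h : G.IsArms C p B P) (hV : ∀ f ∈ V, G.ev p f = 0 ∧ G.form C f f ≤ 0)
    (hdef : ∀ f ∈ V, G.N C f f = 0 → f = 0) : Function.Injective ((ell B G).domRestrict V) := by
  rw [← LinearMap.ker_eq_bot, LinearMap.ker_eq_bot']
  rintro ⟨f, hf⟩ h0
  refine Subtype.ext (hdef f hf (h.N_eq_zero (hV f hf).1 (hV f hf).2 fun i => ?_))
  exact congrFun h0 i

theorem finrank_le (h : G.IsArms C p B P) (hV : ∀ f ∈ V, G.ev p f = 0 ∧ G.form C f f ≤ 0)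
    (hdef : ∀ f ∈ V, G.N C f f = 0 → f = 0) : Module.finrank ℝ V ≤ m := by
  simpa using LinearMap.finrank_le_finrank_of_injective (h.injective hV hdef)

theorem surjective (h : G.IsArms C p B P) (hV : ∀ f ∈ V, G.ev p f = 0 ∧ G.form C f f ≤ 0)
    (hdef : ∀ f ∈ V, G.N C f f = 0 → f = 0) [FiniteDimensional ℝ V]
    (hm : m ≤ Module.finrank ℝ V) (v : Fin m → ℝ) : ∃ f ∈ V, ell B G f = v := by
  have h2 := (LinearMap.injective_iff_surjective_of_finrank_eq_finrank
    (by simpa using (h.finrank_le hV hdef).antisymm hm)).1 (h.injective hV hdef) v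
  obtain ⟨⟨f, hf⟩, h3⟩ := h2
  exact ⟨f, hf, h3⟩

theorem ev_eq (h : G.IsArms C p B P) (hV : ∀ f ∈ V, G.ev p f = 0 ∧ G.form C f f ≤ 0)
    (hdef : ∀ f ∈ V, G.N C f f = 0 → f = 0) [FiniteDimensional ℝ V]
    (hm : m ≤ Module.finrank ℝ V) (hx : ∀ᶠ n in G.U, x n ∈ C n) (hxV : ∀ f ∈ V, G.ev x f = 0) :
    G.ev x = G.ev p := by
  obtain ⟨i, hi⟩ : ∃ i, ∀ᶠ n in G.U, x n ∈ B i n := by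
    rw [← Ultrafilter.eventually_exists_iff]
    filter_upwards [hx, h.cover] with n h1 h2 using h2 _ h1
  obtain ⟨f, hf, hfi⟩ := h.surjective hV hdef hm 1
  have hfi : G.N (B i) f G.one = 1 := congrFun hfi i
  have hconn : G.Conn (B i) x := by
    filter_upwards [hi, h.conn i] with n h1 h2 using ⟨h2.1, h2.2.1, h1⟩
  have hq := h.form_arm (hV f hf).1 (hV f hf).2 i
  ext g
  have h1 := UltraGraph.form_eq hconn (h.mass i) (hxV f hf) hq g
  have h2 := UltraGraph.form_eq (h.conn i) (h.mass i) (by rw [h.ev, (hV f hf).1]) hq g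
  rw [h1, hfi, h.ev] at h2
  have := pow_pos G.ω_pos 2
  nlinarith

end IsArms

end UltraGraph

namespace UltraGraph

variable {H ι α : Type*} [AddCommGroup H] [Module ℝ H] [DecidableEq α] {G : UltraGraph H ι α}
  {S C B R : ι → Finset α} {p o : ι → α} {f g : H} {m : ℕ} {V W : Submodule ℝ H}

/-- A decomposition of the region `C` into two connected regions meeting at `p`. -/
structure IsSplit (G : UltraGraph H ι α) (C B R : ι → Finset α) (p : ι → α) : Prop where
  conn_left : G.Conn B p
  conn_right : G.Conn R p
  mass : G.N B G.one G.one ≤ G.a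
  N : G.N C = G.N B + G.N R
  form : G.form C = G.form B + G.form R
  cover : ∀ᶠ n in G.U, ∀ x ∈ C n, x ∈ B n ∨ x ∈ R n

theorem exists_branches (hC : G.Conn C o) (hw : ∀ᶠ n in G.U, G.a ≤ ∑ i ∈ C n, G.wt n i) :
    ∃ p B₁ B₂ K, G.IsSplit C B₁ (fun n => K n ∪ B₂ n) p ∧ G.IsSplit C B₂ (fun n => K n ∪ B₁ n) p ∧
      G.Conn K p ∧ G.Conn K o ∧ G.N C = G.N B₁ + G.N B₂ + G.N K ∧
      G.form C = G.form B₁ + G.form B₂ + G.form K ∧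
      G.a ≤ G.N B₁ G.one G.one + G.N B₂ G.one G.one := by
  have hn : ∀ n, ∃ p, ∃ B₁ B₂ K : Finset α,
      (C n ⊆ G.vert n ∧ NoCut (G.adj n) (C n) ∧ o n ∈ C n) → (∀ i, G.wt n i < G.a) →
      G.a ≤ ∑ i ∈ C n, G.wt n i →
      NoCut (G.adj n) B₁ ∧ NoCut (G.adj n) B₂ ∧ NoCut (G.adj n) K ∧ p ∈ B₁ ∧ p ∈ B₂ ∧
      p ∈ K ∧ o n ∈ K ∧ B₁ ∪ B₂ ∪ K = C n ∧ B₁ ∩ B₂ ⊆ {p} ∧ (B₁ ∪ B₂) ∩ K ⊆ {p} ∧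
      ∑ i ∈ B₁ \ {p}, G.wt n i < G.a ∧ ∑ i ∈ B₂, G.wt n i < G.a ∧
      G.a ≤ ∑ i ∈ B₁ ∪ B₂, G.wt n i := by
    intro n
    by_cases h : (C n ⊆ G.vert n ∧ NoCut (G.adj n) (C n) ∧ o n ∈ C n) ∧ (∀ i, G.wt n i < G.a) ∧
      G.a ≤ ∑ i ∈ C n, G.wt n i
    · obtain ⟨⟨h1, h2, h3⟩, h4, h5⟩ := h
      obtain ⟨p, B₁, B₂, K, h⟩ := h2.exists_branches (G.adj_symm n) (G.wt n) h3 (fun i _ => h4 i) h5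
      exact ⟨p, B₁, B₂, K, fun _ _ _ => h⟩
    · exact ⟨o n, ∅, ∅, ∅, fun h1 h2 h3 => absurd ⟨h1, h2, h3⟩ h⟩
  choose p B₁ B₂ K hn using hn
  have hev := hC.and ((G.wt_lt _ G.a_pos).and hw)
  replace hev := hev.mono fun n h => And.intro h.1.1 (hn n h.1 h.2.1 h.2.2)
  have sub : ∀ᶠ n in G.U, B₁ n ⊆ G.vert n ∧ B₂ n ⊆ G.vert n ∧ K n ⊆ G.vert n := by
    filter_upwards [hev] with n ⟨h0, _, _, _, _, _, _, _, h, _⟩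
    rw [← h] at h0
    exact ⟨fun x hx => h0 (by simp [hx]), fun x hx => h0 (by simp [hx]),
      fun x hx => h0 (by simp [hx])⟩
  have hCv : ∀ᶠ n in G.U, C n ⊆ G.vert n := hC.mono fun n h => h.1
  have hB12v : ∀ᶠ n in G.U, B₁ n ∪ B₂ n ⊆ G.vert n :=
    sub.mono fun n h => Finset.union_subset h.1 h.2.1
  obtain ⟨a1, b1⟩ := G.form_add C (fun n => B₁ n ∪ B₂ n) K p hCv
    (hev.mono fun n h => ⟨h.2.2.2.2.2.2.2.2.1.symm, h.2.2.2.2.2.2.2.2.2.2.1⟩)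
  obtain ⟨a2, b2⟩ := G.form_add (fun n => B₁ n ∪ B₂ n) B₁ B₂ p hB12v
    (hev.mono fun n h => ⟨rfl, h.2.2.2.2.2.2.2.2.2.1⟩)
  obtain ⟨a3, b3⟩ := G.form_add (fun n => K n ∪ B₂ n) K B₂ p
    (sub.mono fun n h => Finset.union_subset h.2.2 h.2.1)
    (hev.mono fun n h => ⟨rfl, fun x hx => h.2.2.2.2.2.2.2.2.2.2.1 (by
      simp only [Finset.mem_inter, Finset.mem_union] at hx ⊢; tauto)⟩)
  obtain ⟨a4, b4⟩ := G.form_add (fun n => K n ∪ B₁ n) K B₁ p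
    (sub.mono fun n h => Finset.union_subset h.2.2 h.1)
    (hev.mono fun n h => ⟨rfl, fun x hx => h.2.2.2.2.2.2.2.2.2.2.1 (by
      simp only [Finset.mem_inter, Finset.mem_union] at hx ⊢; tauto)⟩)
  have hN : G.N C = G.N B₁ + G.N B₂ + G.N K := by rw [a1, a2]
  have hF : G.form C = G.form B₁ + G.form B₂ + G.form K := by
    simp only [form, b1, b2, hN]; module
  have hm1 : G.N B₁ G.one G.one ≤ G.a := by
    refine le_of_forall_pos_le_add fun ε hε => ?_
    refine le_of_tendsto (G.tendsto_wt B₁ (sub.mono fun n h => h.1)) ?_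
    filter_upwards [hev, G.wt_lt ε hε] with n ⟨_, _, _, _, h, _, _, _, _, _, _, h2, _⟩ h3
    have := Finset.sum_sdiff (f := G.wt n) (Finset.singleton_subset_iff.2 h)
    rw [Finset.sum_singleton] at this
    linarith [h3 (p n)]
  have hm2 : G.N B₂ G.one G.one ≤ G.a :=
    le_of_tendsto (G.tendsto_wt B₂ (sub.mono fun n h => h.2.1))
      (hev.mono fun n h => h.2.2.2.2.2.2.2.2.2.2.2.2.1.le)
  have hm12 := ge_of_tendsto (G.tendsto_wt _ hB12v)
      (hev.mono fun n h => h.2.2.2.2.2.2.2.2.2.2.2.2.2)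
  rw [a2] at hm12
  refine ⟨p, B₁, B₂, K, ⟨?_, ?_, hm1, ?_, ?_, ?_⟩, ⟨?_, ?_, hm2, ?_, ?_, ?_⟩, ?_, ?_, hN, hF, hm12⟩
  · filter_upwards [hev, sub] with n h h2 using ⟨h2.1, h.2.1, h.2.2.2.2.1⟩
  · filter_upwards [hev, sub] with n ⟨_, h1, h2, h3, h4, h5, h6, _⟩ hs
    exact ⟨Finset.union_subset hs.2.2 hs.2.1, h3.union h2 h6 h5, by simp [h6]⟩
  · rw [hN, a3]; abel
  · rw [hF]; simp only [form, b3, a3]; module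
  · filter_upwards [hev] with n h x hx
    have h7 := h.2.2.2.2.2.2.2.2.1
    rw [← h7] at hx
    simp only [Finset.mem_union] at hx ⊢; tauto
  · filter_upwards [hev, sub] with n h h2 using ⟨h2.2.1, h.2.2.1, h.2.2.2.2.2.1⟩
  · filter_upwards [hev, sub] with n ⟨_, h1, h2, h3, h4, h5, h6, _⟩ hs
    exact ⟨Finset.union_subset hs.2.2 hs.1, h3.union h1 h6 h4, by simp [h6]⟩
  · rw [hN, a4]; abel
  · rw [hF]; simp only [form, b4, a4]; module
  · filter_upwards [hev] with n h x hx
    have h7 := h.2.2.2.2.2.2.2.2.1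
    rw [← h7] at hx
    simp only [Finset.mem_union] at hx ⊢; tauto
  · filter_upwards [hev, sub] with n ⟨_, h1, h2, h3, h4, h5, h6, _⟩ hs using ⟨hs.2.2, h3, h6⟩
  · filter_upwards [hev, sub] with n ⟨_, h1, h2, h3, h4, h5, h6, h7, _⟩ hs using ⟨hs.2.2, h3, h7⟩

theorem IsSplit.form_left_nonneg (h : G.IsSplit C B R p) (hf : G.ev p f = 0) :
    0 ≤ G.form B f f := UltraGraph.form_nonneg h.conn_left h.mass hf

theorem IsSplit.form_right_nonpos (h : G.IsSplit C B R p) (hf : G.ev p f = 0)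
    (hq : G.form C f f ≤ 0) : G.form R f f ≤ 0 := by
  have h1 := h.form_left_nonneg hf
  rw [h.form] at hq
  simp only [LinearMap.add_apply] at hq
  linarith

theorem form_nonneg_of_N_eq_zero (h : G.N S f f = 0) : 0 ≤ G.form S f f := by
  rw [form_apply, h]; linarith [G.Q_nonneg S f]

/-- At most one dimension is lost when the branch `B` is removed. -/
theorem IsSplit.exists_submodule (h : G.IsSplit C B R p) [FiniteDimensional ℝ V]
    (hV : ∀ f ∈ V, G.form C f f ≤ 0) (hdef : ∀ f ∈ V, G.N C f f = 0 → f = 0) :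
    ∃ V' ≤ V ⊓ LinearMap.ker (G.ev p), Module.finrank ℝ V ≤ Module.finrank ℝ V' + 1 ∧
      ∀ f ∈ V', G.form R f f ≤ 0 ∧ (G.N R f f = 0 → f = 0) := by
  set W := V ⊓ LinearMap.ker (G.ev p) with hW
  have hWdim : Module.finrank ℝ V ≤ Module.finrank ℝ W + 1 := by
    simpa using V.finrank_le_finrank_inf_ker_add (G.ev p)
  have hqR : ∀ f ∈ W, G.form R f f ≤ 0 := fun f hf => h.form_right_nonpos hf.2 (hV f hf.1)
  set N₀ := W ⊓ LinearMap.ker (G.N R) with hN₀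
  have hmem : ∀ f ∈ W, G.N R f f = 0 → f ∈ N₀ := fun f hf h0 =>
    ⟨hf, LinearMap.mem_ker.2 (LinearMap.ext fun g => N_eq_zero h0 g)⟩
  have hqB : ∀ f ∈ N₀, G.form B f f ≤ 0 := fun f hf => by
    have h1 := hV f hf.1.1
    have h2 : G.N R f f = 0 := by rw [LinearMap.mem_ker.1 hf.2]; rfl
    have h3 := form_nonneg_of_N_eq_zero h2
    rw [h.form] at h1
    simp only [LinearMap.add_apply] at h1
    linarith
  have hinj : ∀ f ∈ N₀, G.N B f G.one = 0 → f = 0 := fun f hf h0 => by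
    have h1 := N_eq_zero_of_ell h.conn_left h.mass hf.1.2 (hqB f hf) h0
    have h2 : G.N R f f = 0 := by rw [LinearMap.mem_ker.1 hf.2]; rfl
    exact hdef f hf.1.1 (by rw [h.N]; simp [h1, h2])
  have hdim : Module.finrank ℝ N₀ ≤ 1 := by
    have h1 : Function.Injective (((G.N B).flip G.one).domRestrict N₀) := by
      rw [← LinearMap.ker_eq_bot, LinearMap.ker_eq_bot']
      rintro ⟨f, hf⟩ h0
      exact Subtype.ext (hinj f hf h0)
    simpa using LinearMap.finrank_le_finrank_of_injective h1
  have hdim2 : Module.finrank ℝ V + Module.finrank ℝ N₀ ≤ Module.finrank ℝ W + 1 := by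
    by_cases hbot : N₀ = ⊥
    · rw [hbot, finrank_bot]; simpa using hWdim
    obtain ⟨s, hs, hs0⟩ := N₀.ne_bot_iff.1 hbot
    have hs2 : G.N R s s = 0 := by rw [LinearMap.mem_ker.1 hs.2]; rfl
    have hle : V ≤ W := fun g hg => ⟨hg, LinearMap.mem_ker.2 ?_⟩
    · have := Submodule.finrank_mono hle; omega
    have e1 : G.form C s g = 0 := by
      have h1 := LinearMap.eq_zero_of_forall_nonneg (b := - G.form C)
        (fun f g => by simp [G.form_symm C f g]) (V := V)
        (fun f hf => by simpa using hV f hf) (s := s) (g := g) hs.1.1 hg (by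
          have h3 := form_nonneg_of_N_eq_zero hs2
          have h4 := h.form_left_nonneg hs.1.2
          rw [h.form]; simp only [LinearMap.neg_apply, LinearMap.add_apply]; linarith)
      simpa using h1
    rw [h.form, LinearMap.add_apply, LinearMap.add_apply, form_eq_zero hs2 (hqR s hs.1) g, add_zero,
      form_eq h.conn_left h.mass hs.1.2 (hqB s hs)] at e1
    have h5 : G.N B s G.one ≠ 0 := fun h0 => hs0 (hinj s hs h0)
    have h6 := (pow_pos G.ω_pos 2).ne'
    simpa [h5, h6, G.ω_pos.ne'] using e1
  obtain ⟨Z, hZ⟩ := Submodule.exists_isCompl (N₀.comap W.subtype)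
  refine ⟨Z.map W.subtype, ?_, ?_, ?_⟩
  · rw [Submodule.map_le_iff_le_comap]; exact fun x _ => x.2
  · have h1 := Submodule.finrank_add_eq_of_isCompl hZ
    have h2 := Submodule.finrank_map_subtype_eq W (N₀.comap W.subtype)
    have hle0 : N₀ ≤ W := inf_le_left
    rw [Submodule.map_comap_subtype, inf_eq_right.2 hle0] at h2
    rw [Submodule.finrank_map_subtype_eq]
    omega
  · rintro _ ⟨⟨f, hf⟩, hfZ, rfl⟩
    refine ⟨hqR f hf, fun h0 => ?_⟩
    have := Submodule.disjoint_def.1 hZ.disjoint ⟨f, hf⟩ (hmem f hf h0) hfZ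
    simpa using this

theorem IsSplit.isArms (h : G.IsSplit C B R p) {A : Fin m → ι → Finset α} {P : Fin m → ι → α}
    (hR : G.IsArms R p A P) :
    G.IsArms C p (Fin.cons B A : Fin (m + 1) → ι → Finset α)
      (Fin.cons p P : Fin (m + 1) → ι → α) where
  conn := Fin.cases h.conn_left hR.conn
  ev := Fin.cases rfl hR.ev
  mass := Fin.cases h.mass hR.mass
  N := by rw [Fin.sum_univ_succ, h.N, hR.N]; simp
  form := by rw [Fin.sum_univ_succ, h.form, hR.form]; simp
  cover := by
    filter_upwards [h.cover, hR.cover] with n h1 h2 x hx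
    rcases h1 x hx with h3 | h3
    · exact ⟨0, h3⟩
    · obtain ⟨i, hi⟩ := h2 x h3
      exact ⟨i.succ, hi⟩

theorem IsArms.of_ev_eq {A : Fin m → ι → Finset α} {P : Fin m → ι → α} (h : G.IsArms C p A P)
    (ho : G.ev o = G.ev p) : G.IsArms C o A P :=
  { h with ev := fun i => (h.ev i).trans ho.symm }

theorem isArms_one (hC : G.Conn C p) (hm : G.N C G.one G.one ≤ G.a) :
    G.IsArms C p (fun _ : Fin 1 => C) fun _ => p where
  conn _ := hC
  ev _ := rfl
  mass _ := hm
  N := by simp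
  form := by simp
  cover := .of_forall fun _ _ hx => ⟨0, hx⟩

/-- The alternative in the induction step: either an arm attached at `p` can be split off, or all
functions in `V` vanishing at `p` live on a small region `K`. -/
theorem exists_step (hC : G.Conn C o) (hw : ∀ᶠ n in G.U, G.a ≤ ∑ i ∈ C n, G.wt n i)
    (hmass : G.N C G.one G.one ≤ (m + 1) * G.a) [FiniteDimensional ℝ V]
    (hV : ∀ f ∈ V, G.form C f f ≤ 0) (hdef : ∀ f ∈ V, G.N C f f = 0 → f = 0) :
    ∃ p R, G.Conn R p ∧ (∀ᶠ n in G.U, o n ∈ R n) ∧ G.N R G.one G.one ≤ m * G.a ∧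
      ∃ V' ≤ V ⊓ LinearMap.ker (G.ev p), Module.finrank ℝ V ≤ Module.finrank ℝ V' + 1 ∧
      (∀ f ∈ V', G.form R f f ≤ 0 ∧ (G.N R f f = 0 → f = 0)) ∧
      ((∃ B, G.IsSplit C B R p) ∨ V' = V ⊓ LinearMap.ker (G.ev p) ∧
        ∀ f ∈ V', 0 ≤ G.form R f f → ∀ g, G.form R f g = G.form C f g) := by
  obtain ⟨p, B₁, B₂, K, h1, h2, hK, hKo, hN, hF, hmass2⟩ := exists_branches hC hw
  have active : ∀ B R, G.IsSplit C B R p → (∀ᶠ n in G.U, o n ∈ R n) →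
      (∃ f ∈ V ⊓ LinearMap.ker (G.ev p), G.form B f f ≤ 0 ∧ G.N B f f ≠ 0) →
      ∃ p R, G.Conn R p ∧ (∀ᶠ n in G.U, o n ∈ R n) ∧ G.N R G.one G.one ≤ m * G.a ∧
      ∃ V' ≤ V ⊓ LinearMap.ker (G.ev p), Module.finrank ℝ V ≤ Module.finrank ℝ V' + 1 ∧
      (∀ f ∈ V', G.form R f f ≤ 0 ∧ (G.N R f f = 0 → f = 0)) ∧
      ((∃ B, G.IsSplit C B R p) ∨ V' = V ⊓ LinearMap.ker (G.ev p) ∧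
        ∀ f ∈ V', 0 ≤ G.form R f f → ∀ g, G.form R f g = G.form C f g) := by
    rintro B R hs ho ⟨f, hf, hq, hf0⟩
    obtain ⟨V', h1, h2, h3⟩ := hs.exists_submodule hV hdef
    refine ⟨p, R, hs.conn_right, ho, ?_, V', h1, h2, h3, .inl ⟨B, hs⟩⟩
    have h4 := (ell_ne_zero hs.conn_left hs.mass hf.2 hq hf0).1
    rw [hs.N] at hmass
    simp only [LinearMap.add_apply] at hmass
    linarith
  by_cases ha1 : ∃ f ∈ V ⊓ LinearMap.ker (G.ev p), G.form B₁ f f ≤ 0 ∧ G.N B₁ f f ≠ 0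
  · exact active B₁ _ h1 (hKo.mono fun n h => by simp [h.2.2]) ha1
  by_cases ha2 : ∃ f ∈ V ⊓ LinearMap.ker (G.ev p), G.form B₂ f f ≤ 0 ∧ G.N B₂ f f ≠ 0
  · exact active B₂ _ h2 (hKo.mono fun n h => by simp [h.2.2]) ha2
  push Not at ha1 ha2
  have hle : ∀ f ∈ V ⊓ LinearMap.ker (G.ev p),
      G.form B₁ f f + G.form B₂ f f + G.form K f f ≤ 0 ∧ 0 ≤ G.form B₁ f f ∧
        0 ≤ G.form B₂ f f := fun f hf => by
    have := hV f hf.1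
    rw [hF] at this
    exact ⟨this, h1.form_left_nonneg hf.2, h2.form_left_nonneg hf.2⟩
  have hdefK : ∀ f ∈ V ⊓ LinearMap.ker (G.ev p), 0 ≤ G.form K f f →
      G.N B₁ f f = 0 ∧ G.N B₂ f f = 0 ∧ G.form B₁ f f ≤ 0 ∧ G.form B₂ f f ≤ 0 := fun f hf h => by
    obtain ⟨h3, h4, h5⟩ := hle f hf
    have e1 : G.form B₁ f f ≤ 0 := by linarith
    have e2 : G.form B₂ f f ≤ 0 := by linarith
    exact ⟨ha1 f hf e1, ha2 f hf e2, e1, e2⟩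
  refine ⟨p, K, hK, hKo.mono fun n h => h.2.2, ?_, _, le_rfl, ?_,
    fun f hf => ⟨?_, fun h0 => ?_⟩, ?_⟩
  · rw [hN] at hmass
    simp only [LinearMap.add_apply] at hmass
    linarith
  · simpa using V.finrank_le_finrank_inf_ker_add (G.ev p)
  · linarith [hle f hf]
  · obtain ⟨e1, e2, _⟩ := hdefK f hf (form_nonneg_of_N_eq_zero h0)
    exact hdef f hf.1 (by rw [hN]; simp [e1, e2, h0])
  · refine .inr ⟨rfl, fun f hf h g => ?_⟩
    obtain ⟨e1, e2, e3, e4⟩ := hdefK f hf h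
    rw [hF]
    simp [form_eq_zero e1 e3 g, form_eq_zero e2 e4 g]

theorem form_eq_zero_of_nonpos (hV : ∀ f ∈ V, G.form C f f ≤ 0) (hf : f ∈ V) (hg : g ∈ V)
    (h0 : 0 ≤ G.form C f f) : G.form C f g = 0 := by
  have h1 := LinearMap.eq_zero_of_forall_nonneg (b := - G.form C)
    (fun f g => by simp [G.form_symm C f g]) (V := V)
    (fun f hf => by simpa using hV f hf) hf hg (by simpa using h0)
  simpa using h1

theorem exists_isArms (m : ℕ) : ∀ (C : ι → Finset α) (o : ι → α) (V : Submodule ℝ H),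
    FiniteDimensional ℝ V → G.Conn C o → G.N C G.one G.one ≤ (m + 1) * G.a →
    m + 1 ≤ Module.finrank ℝ V → (∀ f ∈ V, G.ev o f = 0 ∧ G.form C f f ≤ 0) →
    (∀ f ∈ V, G.N C f f = 0 → f = 0) →
    ∃ (B : Fin (m + 1) → ι → Finset α) (P : Fin (m + 1) → ι → α), G.IsArms C o B P := by
  induction m with
  | zero =>
    intro C o V _ hC hmass _ _ _
    exact ⟨_, _, isArms_one hC (by simpa using hmass)⟩
  | succ m ih =>
    intro C o V _ hC hmass hdim hV hdef
    by_cases hw : ∀ᶠ n in G.U, G.a ≤ ∑ i ∈ C n, G.wt n i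
    · obtain ⟨p, R, hR, hoR, hmR, V', hV', hd, hVR, h⟩ := exists_step (m := m + 1) hC hw
        (by exact_mod_cast hmass) (fun f hf => (hV f hf).2) hdef
      have : FiniteDimensional ℝ V' := Submodule.finiteDimensional_of_le (hV'.trans inf_le_left)
      have hV2 : ∀ f ∈ V', G.ev p f = 0 ∧ G.form R f f ≤ 0 := fun f hf =>
        ⟨(hV' hf).2, (hVR f hf).1⟩
      have hd2 : m + 1 ≤ Module.finrank ℝ V' := by omega
      obtain ⟨A, P, hA⟩ := ih R p V' this hR (by exact_mod_cast hmR) hd2 hV2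
        fun f hf => (hVR f hf).2
      have hev := hA.ev_eq hV2 (fun f hf => (hVR f hf).2) hd2 hoR fun f hf => (hV f (hV' hf).1).1
      rcases h with ⟨B, hB⟩ | ⟨h, -⟩
      · exact ⟨_, _, (hB.isArms hA).of_ev_eq hev⟩
      · have h1 := hA.finrank_le hV2 fun f hf => (hVR f hf).2
        have h2 : V ≤ V' := by
          rw [h]
          exact fun f hf => ⟨hf, LinearMap.mem_ker.2 (by rw [← hev]; exact (hV f hf).1)⟩
        have h3 := Submodule.finrank_mono h2
        omega
    · have hm : G.N C G.one G.one ≤ G.a :=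
        le_of_tendsto (G.tendsto_wt C (hC.mono fun n h => h.1))
          ((Ultrafilter.eventually_not.2 hw).mono fun n h => (not_le.1 h).le)
      have := (isArms_one hC hm).finrank_le hV hdef
      omega

theorem exists_isArms_of_lt (hC : G.Conn C o) (ha : G.a < G.N C G.one G.one)
    (hmass : G.N C G.one G.one ≤ (m + 2) * G.a) [FiniteDimensional ℝ V]
    (hdim : m + 2 ≤ Module.finrank ℝ V) (hV : ∀ f ∈ V, G.form C f f ≤ 0)
    (hdef : ∀ f ∈ V, G.N C f f = 0 → f = 0) :
    ∃ p, ∃ (B : Fin (m + 2) → ι → Finset α) (P : Fin (m + 2) → ι → α), G.IsArms C p B P := by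
  have hw : ∀ᶠ n in G.U, G.a ≤ ∑ i ∈ C n, G.wt n i :=
    ((G.tendsto_wt C (hC.mono fun n h => h.1)).eventually (lt_mem_nhds ha)).mono
      fun n h => le_of_lt h
  obtain ⟨p, R, hR, hoR, hmR, V', hV', hd, hVR, h⟩ := exists_step (m := m + 1) hC hw
    (by push_cast; linarith) hV hdef
  have : FiniteDimensional ℝ V' := Submodule.finiteDimensional_of_le (hV'.trans inf_le_left)
  have hV2 : ∀ f ∈ V', G.ev p f = 0 ∧ G.form R f f ≤ 0 := fun f hf =>
    ⟨(hV' hf).2, (hVR f hf).1⟩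
  have hd2 : m + 1 ≤ Module.finrank ℝ V' := by omega
  obtain ⟨A, P, hA⟩ := exists_isArms m R p V' this hR (by exact_mod_cast hmR) hd2 hV2
    fun f hf => (hVR f hf).2
  rcases h with ⟨B, hB⟩ | ⟨h, heq⟩
  · exact ⟨p, _, _, hB.isArms hA⟩
  exfalso
  obtain ⟨f, hf, hfl⟩ := hA.surjective hV2 (fun f hf => (hVR f hf).2) hd2 1
  have hNf : G.N R f G.one = m + 1 := by
    rw [hA.N]
    have : ∀ i, G.N (A i) f G.one = 1 := fun i => congrFun hfl i
    simp [this]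
  have hnn := hA.form_total_nonneg (hV2 f hf).1
  have h2 : V ≤ V' := by
    rw [h]
    refine fun g hg => ⟨hg, LinearMap.mem_ker.2 ?_⟩
    have e1 := hA.form_eq (hV2 f hf).1 (hV2 f hf).2 g
    have e2 := form_eq_zero_of_nonpos hV (hV' hf).1 hg (by rwa [← heq f hf hnn])
    rw [heq f hf hnn, e2, hNf] at e1
    have h6 := G.ω_pos.ne'
    have h7 : (m : ℝ) + 1 ≠ 0 := by positivity
    simpa [h6, h7] using e1.symm
  have h3 := Submodule.finrank_mono h2
  have h4 := hA.finrank_le hV2 fun f hf => (hVR f hf).2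
  omega

/-- Two arms carry a function of `V` with prescribed integrals over the arms. -/
theorem IsArms.exists_ell_eq {B : Fin m → ι → Finset α} {P : Fin m → ι → α}
    (h : G.IsArms C p B P) [FiniteDimensional ℝ V] (hdim : m ≤ Module.finrank ℝ V)
    (hV : ∀ f ∈ V, G.form C f f ≤ 0) (hdef : ∀ f ∈ V, G.N C f f = 0 → f = 0) {v : Fin m → ℝ}
    (hv : ∑ i, v i = 0) :
    ∃ f ∈ V, G.ev p f = 0 ∧ IsArms.ell B G f = v := by
  set W := V ⊓ LinearMap.ker (G.ev p)
  have hW : ∀ f ∈ W, G.ev p f = 0 ∧ G.form C f f ≤ 0 := fun f hf => ⟨hf.2, hV f hf.1⟩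
  have hdefW : ∀ f ∈ W, G.N C f f = 0 → f = 0 := fun f hf => hdef f hf.1
  by_cases hWV : m ≤ Module.finrank ℝ W
  · obtain ⟨f, hf, hfv⟩ := h.surjective hW hdefW hWV v
    exact ⟨f, hf.1, hf.2, hfv⟩
  obtain ⟨g, hg, hgp⟩ : ∃ g ∈ V, G.ev p g ≠ 0 := by
    by_contra! hcon
    exact hWV (hdim.trans (Submodule.finrank_mono fun g hg => ⟨hg, hcon g hg⟩))
  set s : (Fin m → ℝ) →ₗ[ℝ] ℝ := ∑ i, LinearMap.proj i with hs
  have hs2 : ∀ v, s v = ∑ i, v i := fun v => by simp [hs]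
  have hle : W.map (IsArms.ell B G) ≤ LinearMap.ker s := by
    rintro _ ⟨f, hf, rfl⟩
    have e1 := h.form_eq (hW f hf).1 (hW f hf).2 g
    rw [form_eq_zero_of_nonpos hV hf.1 hg (h.form_total_nonneg hf.2)] at e1
    have h6 := G.ω_pos.ne'
    have e2 : G.N C f G.one = 0 := by simpa [h6, hgp] using e1.symm
    rw [LinearMap.mem_ker, hs2]
    rw [h.N] at e2
    simpa [IsArms.ell_apply] using e2
  have hWdim : Module.finrank ℝ V ≤ Module.finrank ℝ W + 1 := by
    simpa using V.finrank_le_finrank_inf_ker_add (G.ev p)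
  have hmap : Module.finrank ℝ (W.map (IsArms.ell B G)) = Module.finrank ℝ W := by
    rw [← LinearMap.range_domRestrict]
    exact LinearMap.finrank_range_of_inj (h.injective hW hdefW)
  have hlt : Module.finrank ℝ (LinearMap.ker s) < m := by
    have hm0 : 0 < m := by
      by_contra h0
      omega
    have : LinearMap.ker s ≠ ⊤ := fun htop => by
      have h1 : (Pi.single ⟨0, hm0⟩ 1 : Fin m → ℝ) ∈ LinearMap.ker s := htop ▸ trivial
      rw [LinearMap.mem_ker, hs2] at h1
      simp at h1
    simpa using Submodule.finrank_lt this
  have heq := Submodule.eq_of_le_of_finrank_le hle (by omega)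
  obtain ⟨f, hf, hfv⟩ : v ∈ W.map (IsArms.ell B G) := by
    rw [heq, LinearMap.mem_ker, hs2, hv]
  exact ⟨f, hf.1, hf.2, hfv⟩

/-- Functions carried by distinct arms on which the first mixed eigenvalue is attained. -/
theorem exists_orthogonal (hC : G.Conn C o) (hmass : G.N C G.one G.one = (m + 2) * G.a)
    [FiniteDimensional ℝ V] (hdim : m + 2 ≤ Module.finrank ℝ V)
    (hV : ∀ f ∈ V, G.form C f f ≤ 0) (hdef : ∀ f ∈ V, G.N C f f = 0 → f = 0) :
    (∃ f ∈ V, f ≠ 0 ∧ 0 ≤ G.form C f f) ∧ ∃ f : Fin (m + 2) → H,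
      (∀ i, G.form C (G.pos (f i)) (G.pos (f i)) ≤ 0) ∧
      (∀ i, G.N C (G.pos (f i)) (G.pos (f i)) ≠ 0) ∧
      ∀ i j, i ≠ j → G.N C (G.pos (f i)) (G.pos (f j)) = 0 := by
  obtain ⟨p, B, P, h⟩ := exists_isArms_of_lt hC (m := m)
    (by rw [hmass]; nlinarith [G.a_pos, (Nat.cast_nonneg m : (0 : ℝ) ≤ m)]) hmass.le hdim hV hdef
  have : ∀ i : Fin (m + 2), ∃ j, i ≠ j := fun i => exists_ne i |>.imp fun _ h => h.symm
  choose σ hσ using this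
  have : ∀ i, ∃ f ∈ V, G.ev p f = 0 ∧
      IsArms.ell B G f = Pi.single i 1 - Pi.single (σ i) 1 := fun i =>
    h.exists_ell_eq hdim hV hdef (by simp)
  choose f hfV hfp hfl using this
  have hfl : ∀ i j, G.N (B j) (f i) G.one =
      (Pi.single i 1 - Pi.single (σ i) 1 : Fin (m + 2) → ℝ) j := fun i j => congrFun (hfl i) j
  have hpB : ∀ i j, G.ev (P j) (f i) = 0 := fun i j => by rw [h.ev, hfp]
  have hq : ∀ i j, G.form (B j) (f i) (f i) ≤ 0 := fun i j =>
    h.form_arm (hfp i) (hV _ (hfV i)) j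
  have hnull : ∀ i j, i ≠ j → G.N (B j) (G.pos (f i)) (G.pos (f i)) = 0 := by
    intro i j hij
    by_contra hcon
    have h2 := ell_ne_zero_of_pos (h.conn j) (h.mass j) (hpB i j) (hq i j) hcon
    by_cases hj : j = σ i
    · have h3 := G.N_pos_one (B j) (f i)
      have h4 := hfl i j
      conv_lhs at h4 => rw [← G.pos_sub (f i)]
      rw [map_sub, LinearMap.sub_apply, N_eq_zero h2.2.1] at h4
      simp [hj, hσ i] at h4
      rw [hj] at h3
      linarith
    · exact h2.2.2 (by rw [hfl]; simp [hj, hij.symm])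
  refine ⟨⟨f 0, hfV 0, fun h0 => ?_, h.form_total_nonneg (hfp 0)⟩, f, fun i => ?_, fun i h0 => ?_,
    fun i j hij => ?_⟩
  · have := hfl 0 0
    rw [h0] at this
    simp [hσ 0] at this
  · rw [h.form]
    simp only [LinearMap.sum_apply]
    exact Finset.sum_nonpos fun j _ => form_pos_nonpos (h.conn j) (h.mass j) (hpB i j) (hq i j)
  · have h1 : G.N (B i) (G.pos (f i)) (G.pos (f i)) = 0 := by
      rw [h.N] at h0
      simp only [LinearMap.sum_apply] at h0
      exact (Finset.sum_eq_zero_iff_of_nonneg fun j _ => G.N_nonneg _ _).1 h0 i (Finset.mem_univ i)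
    have h4 := hfl i i
    conv_lhs at h4 => rw [← G.pos_sub (f i)]
    rw [map_sub, LinearMap.sub_apply, N_eq_zero h1] at h4
    simp [hσ i] at h4
    linarith [G.N_pos_one (B i) (-f i)]
  · rw [h.N]
    simp only [LinearMap.sum_apply]
    refine Finset.sum_eq_zero fun l _ => ?_
    by_cases hl : i = l
    · rw [G.N_symm]
      exact N_eq_zero (hnull j l fun h => hij (hl.trans h.symm)) _
    · exact N_eq_zero (hnull i l hl) _

end UltraGraph

/-- The limit of a bounded family of real numbers along an ultrafilter. -/
noncomputable def Ultrafilter.rlim {ι : Type*} (U : Ultrafilter ι) (u : ι → ℝ) : ℝ :=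
  limUnder (U : Filter ι) u

namespace Ultrafilter

variable {ι : Type*} {U : Ultrafilter ι} {u : ι → ℝ}

theorem tendsto_rlim {B : ℝ} (h : ∀ n, |u n| ≤ B) : Tendsto u U (nhds (U.rlim u)) := by
  obtain ⟨a, -, ha⟩ := (isCompact_Icc (a := -B) (b := B)).ultrafilter_le_nhds (U.map u)
    (le_principal_iff.2 (mem_map.2 (univ_mem' fun n => abs_le.1 (h n))))
  exact tendsto_nhds_limUnder ⟨a, ha⟩

theorem rlim_eq {a : ℝ} (h : Tendsto u U (nhds a)) : U.rlim u = a := h.limUnder_eq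

end Ultrafilter

namespace MetricGraphOn

variable {X : Type} [MetricSpace X] (G : MetricGraphOn X)
  (U : Ultrafilter (Finset G.E × ℕ)) (S : Finset G.E × ℕ → Finset (G.E × ℕ))

/-- The integral over the region described by a family of sets of atoms. -/
noncomputable def regInt (F : G.E × ℝ → ℝ) : ℝ :=
  U.rlim fun n => ∫ p in G.cells n (S n), F p ∂G.edgeMeasure

variable {G U} {F F' : G.E × ℝ → ℝ}

theorem tendsto_regInt (hF : Integrable F G.edgeMeasure) :
    Tendsto (fun n => ∫ p in G.cells n (S n), F p ∂G.edgeMeasure) U (nhds (G.regInt U S F)) :=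
  Ultrafilter.tendsto_rlim (B := ∫ p, |F p| ∂G.edgeMeasure) fun _ =>
    abs_integral_le_integral_abs.trans
      (setIntegral_le_integral hF.abs (Eventually.of_forall fun _ => abs_nonneg _))

theorem regInt_add (hF : Integrable F G.edgeMeasure) (hF' : Integrable F' G.edgeMeasure) :
    G.regInt U S (fun p => F p + F' p) = G.regInt U S F + G.regInt U S F' := by
  refine Ultrafilter.rlim_eq (((tendsto_regInt S hF).add (tendsto_regInt S hF')).congr fun n => ?_)
  exact (integral_add hF.integrableOn hF'.integrableOn).symm

theorem regInt_const_mul (hF : Integrable F G.edgeMeasure) (c : ℝ) :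
    G.regInt U S (fun p => c * F p) = c * G.regInt U S F := by
  refine Ultrafilter.rlim_eq (((tendsto_regInt S hF).const_mul c).congr fun n => ?_)
  exact (integral_const_mul _ _).symm

theorem regInt_congr (h : ∀ᵐ p ∂G.edgeMeasure, F p = F' p) :
    G.regInt U S F = G.regInt U S F' := by
  unfold regInt
  congr 1
  ext n
  exact integral_congr_ae (ae_restrict_of_ae h)

theorem regInt_zero : G.regInt U S (fun _ => 0) = 0 :=
  Ultrafilter.rlim_eq (by simp)

theorem regInt_mono (hF : Integrable F G.edgeMeasure) (hF' : Integrable F' G.edgeMeasure)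
    (h : ∀ᵐ p ∂G.edgeMeasure, F p ≤ F' p) : G.regInt U S F ≤ G.regInt U S F' :=
  le_of_tendsto_of_tendsto' (tendsto_regInt S hF) (tendsto_regInt S hF') fun _ =>
    integral_mono_ae hF.integrableOn hF'.integrableOn (ae_restrict_of_ae h)

theorem regInt_nonneg (hF : Integrable F G.edgeMeasure) (h : ∀ᵐ p ∂G.edgeMeasure, 0 ≤ F p) :
    0 ≤ G.regInt U S F :=
  (regInt_zero S).ge.trans (regInt_mono S (integrable_zero _ _ _) hF h)

variable [IsFiniteMeasure G.edgeMeasure]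

theorem tendsto_setIntegral_zero (hF : Integrable F G.edgeMeasure)
    {A : Finset G.E × ℕ → Set (G.E × ℝ)}
    (hA : Tendsto (fun n => G.edgeMeasure.real (A n)) U (nhds 0)) :
    Tendsto (fun n => ∫ p in A n, F p ∂G.edgeMeasure) U (nhds 0) := by
  refine hF.tendsto_setIntegral_nhds_zero ?_
  have := (ENNReal.continuous_ofReal.tendsto 0).comp hA
  simpa [Function.comp_def] using this

variable {S} (hU : (U : Filter (Finset G.E × ℕ)) ≤ atTop) (hsum : Summable G.len)
include hU hsum

theorem tendsto_regInt_rest (hF : Integrable F G.edgeMeasure) :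
    Tendsto (fun n => ∫ p in G.cells n (S n) ∪ G.rest n, F p ∂G.edgeMeasure) U
      (nhds (G.regInt U S F)) := by
  have h1 : Tendsto (fun n => ∫ p in G.rest n \ G.cells n (S n), F p ∂G.edgeMeasure) U
      (nhds 0) := by
    refine tendsto_setIntegral_zero hF (squeeze_zero (fun _ => measureReal_nonneg)
      (fun n => measureReal_mono sdiff_subset) ((G.tendsto_measureReal_rest hsum).mono_left hU))
  have h2 := (tendsto_regInt S hF).add h1
  rw [add_zero] at h2
  refine h2.congr fun n => ?_
  rw [← setIntegral_union disjoint_sdiff_right (measurableSet_rest.diff measurableSet_cells)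
    hF.integrableOn hF.integrableOn, union_sdiff_self]

theorem tendsto_measureReal_cell (p : Finset G.E × ℕ → G.E × ℕ) :
    Tendsto (fun n => G.edgeMeasure.real (G.cell n (p n))) U (nhds 0) :=
  squeeze_zero (fun _ => measureReal_nonneg) (fun n => measureReal_cell_le hsum n (p n))
    (G.tendsto_tsum_div.mono_left hU)

theorem regInt_union [DecidableEq (G.E × ℕ)] {S₁ S₂ : Finset G.E × ℕ → Finset (G.E × ℕ)}
    {p : Finset G.E × ℕ → G.E × ℕ}
    (h : ∀ᶠ n in U, S n = S₁ n ∪ S₂ n ∧ S₁ n ∩ S₂ n ⊆ {p n})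
    (hF : Integrable F G.edgeMeasure) :
    G.regInt U S F = G.regInt U S₁ F + G.regInt U S₂ F := by
  have h0 : Tendsto (fun n => ∫ q in G.cells n (S₂ n ∩ S₁ n ∩ {p n}), F q ∂G.edgeMeasure) U
      (nhds 0) := by
    refine tendsto_setIntegral_zero hF (squeeze_zero (fun _ => measureReal_nonneg)
      (fun n => measureReal_mono ?_) (tendsto_measureReal_cell hU hsum p))
    have h2 : G.cells n (S₂ n ∩ S₁ n ∩ {p n} ∪ {p n}) = G.cell n (p n) := by
      rw [Finset.union_eq_right.2 Finset.inter_subset_right, cells_singleton]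
    rw [← h2, cells_union]
    exact subset_union_left
  have h1 := (((tendsto_regInt S₁ hF).add (tendsto_regInt S₂ hF)).sub h0)
  rw [sub_zero] at h1
  refine Ultrafilter.rlim_eq (h1.congr' ?_)
  filter_upwards [h] with n hn
  have e1 : S₂ n ∩ S₁ n ∩ {p n} = S₂ n ∩ S₁ n := by
    rw [Finset.inter_comm (S₂ n)]
    exact Finset.inter_eq_left.2 hn.2
  have e2 : G.cells n (S₂ n) = G.cells n (S₂ n \ S₁ n) ∪ G.cells n (S₂ n ∩ S₁ n) := by
    rw [← cells_union, Finset.sdiff_union_inter]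
  have e3 : G.cells n (S n) = G.cells n (S₁ n) ∪ G.cells n (S₂ n \ S₁ n) := by
    rw [← cells_union, Finset.union_sdiff_self_eq_union, hn.1]
  rw [e1, e2, e3, setIntegral_union (disjoint_cells Finset.disjoint_sdiff) measurableSet_cells
    hF.integrableOn hF.integrableOn, setIntegral_union
    (disjoint_cells (Finset.disjoint_sdiff_inter _ _)) measurableSet_cells
    hF.integrableOn hF.integrableOn]
  ring

theorem regInt_atoms (hF : Integrable F G.edgeMeasure) :
    G.regInt U G.atoms F = ∫ p, F p ∂G.edgeMeasure := by
  refine tendsto_nhds_unique (tendsto_regInt_rest hU hsum hF) (tendsto_const_nhds.congr fun n => ?_)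
  rw [← setIntegral_univ]
  exact setIntegral_congr_set (eventuallyEq_set.2 ((ae_mem_cells n).mono fun p hp => by
    simpa using hp))

end MetricGraphOn

/-- The primitive of `s ↦ √(1 - (s / M) ^ 2)`. -/
noncomputable def halfDisc (M s : ℝ) : ℝ := ∫ t in (0 : ℝ)..s, √(1 - (t / M) ^ 2)

theorem hasDerivAt_halfDisc (M s : ℝ) : HasDerivAt (halfDisc M) (√(1 - (s / M) ^ 2)) s := by
  have hc : Continuous fun t : ℝ => √(1 - (t / M) ^ 2) := by fun_prop
  exact intervalIntegral.integral_hasDerivAt_right (hc.intervalIntegrable _ _)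
    hc.stronglyMeasurable.stronglyMeasurableAtFilter hc.continuousAt

theorem sqrt_one_sub_sq_le (u : ℝ) : |√(1 - u ^ 2)| ≤ 1 := by
  rw [abs_of_nonneg (Real.sqrt_nonneg _), Real.sqrt_le_one]
  nlinarith [sq_nonneg u]

theorem halfDisc_zero (M : ℝ) : halfDisc M 0 = 0 := by simp [halfDisc]

theorem halfDisc_self {M : ℝ} (hM : M ≠ 0) : halfDisc M M = M * (Real.pi / 4) := by
  have h1 := intervalIntegral.integral_comp_div (fun u : ℝ => √(1 - u ^ 2)) hM (a := 0) (b := M)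
  have hc : Continuous fun t : ℝ => √(1 - t ^ 2) := by fun_prop
  have h2 := integral_sqrt_one_sub_sq
  have h3 : ∫ x in (-1 : ℝ)..0, √(1 - x ^ 2) = ∫ x in (0 : ℝ)..1, √(1 - x ^ 2) := by
    have := intervalIntegral.integral_comp_neg (fun u : ℝ => √(1 - u ^ 2)) (a := 0) (b := 1)
    simpa using this.symm
  rw [← intervalIntegral.integral_add_adjacent_intervals (hc.intervalIntegrable (-1) 0)
    (hc.intervalIntegrable 0 1), h3] at h2
  have h4 : ∫ x in (0 : ℝ)..1, √(1 - x ^ 2) = Real.pi / 4 := by linarith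
  rw [halfDisc, h1, zero_div, div_self hM, h4, smul_eq_mul]

/-- The pointwise inequality behind the one-dimensional Modica-Mortola type estimate. -/
theorem two_mul_sqrt_mul_le {M m ω s d : ℝ} (hM : 0 < M) (h0 : 0 ≤ s) (hm : s ≤ m) :
    2 * ω * M * (√(1 - (s / M) ^ 2) * |d|) ≤ d ^ 2 + ω ^ 2 * (M ^ 2 - s ^ 2 + |m ^ 2 - M ^ 2|) := by
  set y := √(1 - (s / M) ^ 2) with hy
  have h1 : (M * y) ^ 2 ≤ M ^ 2 - s ^ 2 + |m ^ 2 - M ^ 2| := by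
    rw [mul_pow]
    rcases le_total (s / M) 1 with h | h
    · rw [hy, Real.sq_sqrt (by nlinarith [div_nonneg h0 hM.le])]
      have : M ^ 2 * (1 - (s / M) ^ 2) = M ^ 2 - s ^ 2 := by field_simp
      rw [this]
      linarith [abs_nonneg (m ^ 2 - M ^ 2)]
    · rw [hy, Real.sqrt_eq_zero_of_nonpos (by nlinarith)]
      nlinarith [le_abs_self (m ^ 2 - M ^ 2)]
  have h2 := sq_nonneg (ω * (M * y) - |d|)
  have h3 := mul_le_mul_of_nonneg_left h1 (sq_nonneg ω)
  rw [sub_sq, sq_abs] at h2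
  nlinarith

namespace MetricGraphOn

variable {X : Type} [MetricSpace X] (G : MetricGraphOn X)

/-- The indicator function of the set where `f` is positive. -/
noncomputable def posInd (f : X → ℝ) (p : G.E × ℝ) : ℝ :=
  {q | 0 < f (G.point q)}.indicator 1 p

variable {G} {h : X → ℝ}

theorem posInd_nonneg (f : X → ℝ) (p : G.E × ℝ) : 0 ≤ G.posInd f p :=
  indicator_nonneg (fun _ _ => zero_le_one) p

theorem posInd_le_one (f : X → ℝ) (p : G.E × ℝ) : G.posInd f p ≤ 1 :=
  indicator_le_self' (fun _ _ => zero_le_one) p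

theorem measurableSet_pos (hc : Continuous h) : MeasurableSet {q : G.E × ℝ | 0 < h (G.point q)} :=
  measurableSet_lt measurable_const (G.measurable_comp_point hc)

variable [IsFiniteMeasure G.edgeMeasure]

theorem integrable_posInd (hc : Continuous h) : Integrable (G.posInd h) G.edgeMeasure :=
  (integrable_const (1 : ℝ)).indicator (measurableSet_pos hc)

namespace sobolev

omit [IsFiniteMeasure G.edgeMeasure] in
theorem dv_eq_zero_ae (hs : h ∈ G.sobolev) (h0 : ∀ x, 0 ≤ h x) :
    ∀ᵐ p ∂G.edgeMeasure, h (G.point p) = 0 → G.dv h p = 0 := by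
  have h1 := (posPart_mem hs).2
  have h2 : (fun x => max (h x) 0) = h := funext fun x => max_eq_left (h0 x)
  rw [h2] at h1
  filter_upwards [h1] with p hp hz
  rw [hp, if_neg (by simp [hz])]

omit [IsFiniteMeasure G.edgeMeasure] in
theorem mul_sqrt_le_ae (hs : h ∈ G.sobolev) (h0 : ∀ x, 0 ≤ h x) {M : ℝ}
    (hM : 0 < M) (ω : ℝ) : ∀ᵐ p ∂G.edgeMeasure, ∀ m, h (G.point p) ≤ m →
      2 * ω * M * |G.dv (halfDisc M ∘ h) p| ≤ G.dv h p * G.dv h p + ω ^ 2 * (M ^ 2 * G.posInd h p -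
        h (G.point p) * h (G.point p) + |m ^ 2 - M ^ 2| * G.posInd h p) := by
  filter_upwards [dv_eq_zero_ae hs h0,
    (comp_mem hs (hasDerivAt_halfDisc M) fun _ => sqrt_one_sub_sq_le _).2] with p hp hd m hm
  rw [hd, abs_mul, abs_of_nonneg (Real.sqrt_nonneg _)]
  rcases (h0 (G.point p)).eq_or_lt with hz | hz
  · rw [hp hz.symm, ← hz]
    simp [posInd, ← hz]
  · have := two_mul_sqrt_mul_le (d := G.dv h p) (ω := ω) hM (h0 (G.point p)) hm
    simp only [posInd, indicator_of_mem (show p ∈ {q | 0 < h (G.point q)} from hz), Pi.one_apply,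
      mul_one]
    linarith

variable [ConnectedSpace X] {U : Ultrafilter (Finset G.E × ℕ)}
  {S : Finset G.E × ℕ → Finset (G.E × ℕ)} {q : Finset G.E × ℕ → G.E × ℕ}

theorem tendsto_rlim_node (hs : h ∈ G.sobolev) (q : Finset G.E × ℕ → G.E × ℕ) :
    Tendsto (fun n => h (G.node n (q n))) U (nhds (U.rlim fun n => h (G.node n (q n)))) := by
  obtain ⟨B, hB⟩ := exists_bound hs
  exact Ultrafilter.tendsto_rlim fun n => hB _

omit [ConnectedSpace X] in
theorem le_on_cells (hsum : Summable G.len) (hs : h ∈ G.sobolev) {n : Finset G.E × ℕ}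
    {T : Finset (G.E × ℕ)} (hT : T ⊆ G.atoms n) {M : ℝ} (hM : ∀ i ∈ T, h (G.node n i) ≤ M)
    {p : G.E × ℝ} (hp : p ∈ G.cells n T) :
    h (G.point p) ≤ M + G.meshError n * √(∫ p, G.dv h p ^ 2 ∂G.edgeMeasure) := by
  simp only [cells, mem_iUnion] at hp
  obtain ⟨i, hi, hp⟩ := hp
  linarith [(abs_le.1 (abs_sub_node_le_of_mem_arc hsum hs (hT hi) (point_mem_arc (hT hi) hp))).2,
    hM i hi]

/-- A quantitative Faber-Krahn inequality on connected regions. -/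
theorem exists_faberKrahn [DecidableEq (G.E × ℕ)] (hU : (U : Filter (Finset G.E × ℕ)) ≤ atTop)
    (hsum : Summable G.len) (hs : h ∈ G.sobolev) (h0 : ∀ x, 0 ≤ h x)
    (hS : ∀ᶠ n in U, S n ⊆ G.atoms n ∧ NoCut (G.Adj n) (S n) ∧ q n ∈ S n)
    (hq : U.rlim (fun n => h (G.node n (q n))) = 0) {ω : ℝ} (hω : 0 < ω) :
    ∃ M : ℝ, G.regInt U S (fun p => h (G.point p) * h (G.point p)) ≤
        M ^ 2 * G.regInt U S (G.posInd h) ∧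
      ω * M ^ 2 * (Real.pi / 2) ≤ G.regInt U S (fun p => G.dv h p * G.dv h p) + ω ^ 2 *
        (M ^ 2 * G.regInt U S (G.posInd h) -
          G.regInt U S (fun p => h (G.point p) * h (G.point p))) := by
  classical
  have hx : ∀ n, ∃ i, (S n).Nonempty → i ∈ S n ∧ ∀ j ∈ S n, h (G.node n j) ≤ h (G.node n i) := by
    intro n
    by_cases hn : (S n).Nonempty
    · obtain ⟨i, hi, h2⟩ := (S n).exists_max_image (fun i => h (G.node n i)) hn
      exact ⟨i, fun _ => ⟨hi, h2⟩⟩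
    · exact ⟨q n, fun h => (hn h).elim⟩
  choose x hx using hx
  set M := U.rlim fun n => h (G.node n (x n)) with hMdef
  have hM := tendsto_rlim_node (U := U) hs x
  rw [← hMdef] at hM
  have hM0 : 0 ≤ M := ge_of_tendsto' hM fun n => h0 _
  set m : Finset G.E × ℕ → ℝ := fun n =>
    h (G.node n (x n)) + G.meshError n * √(∫ p, G.dv h p ^ 2 ∂G.edgeMeasure) with hm
  have hmM : Tendsto m U (nhds M) := by
    simpa using hM.add (((G.tendsto_meshError hsum).mono_left hU).mul_const _)
  have hle : ∀ᶠ n in U, ∀ p ∈ G.cells n (S n), h (G.point p) ≤ m n := by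
    filter_upwards [hS] with n hn p hp
    exact le_on_cells hsum hs hn.1 (fun j hj => (hx n ⟨_, hn.2.2⟩).2 j hj) hp
  have i1 := integrable_val_mul hs hs
  have i2 := integrable_dv_mul hs hs
  have i3 := integrable_posInd (G := G) hs.1
  have t1 := tendsto_regInt (U := U) S i1
  have t2 := tendsto_regInt (U := U) S i2
  have t3 := tendsto_regInt (U := U) S i3
  have hN : G.regInt U S (fun p => h (G.point p) * h (G.point p)) ≤
      M ^ 2 * G.regInt U S (G.posInd h) := by
    refine le_of_tendsto_of_tendsto t1 ((hmM.pow 2).mul t3) ?_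
    filter_upwards [hle] with n hn
    rw [← integral_const_mul]
    refine setIntegral_mono_on i1.integrableOn (i3.const_mul _).integrableOn measurableSet_cells
      fun p hp => ?_
    rcases (h0 (G.point p)).eq_or_lt with hz | hz
    · rw [← hz]
      simp only [mul_zero]
      exact mul_nonneg (sq_nonneg _) (posInd_nonneg _ _)
    · simp only [posInd, indicator_of_mem (show p ∈ {q | 0 < h (G.point q)} from hz), Pi.one_apply,
        mul_one]
      nlinarith [hn p hp]
  refine ⟨M, hN, ?_⟩
  rcases hM0.eq_or_lt with hMz | hMpos
  · rw [← hMz] at hN ⊢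
    have := regInt_nonneg (U := U) S i2 (Eventually.of_forall fun p => mul_self_nonneg _)
    nlinarith [mul_le_mul_of_nonneg_left hN (sq_nonneg ω)]
  obtain ⟨hY, -⟩ := comp_mem hs (hasDerivAt_halfDisc M) fun _ => sqrt_one_sub_sq_le _
  have i4 := (integrable_dv hY).abs
  have hlink : M * (Real.pi / 4) ≤ G.regInt U S (fun p => |G.dv (halfDisc M ∘ h) p|) := by
    have hcY := fun s => (hasDerivAt_halfDisc M s).continuousAt
    have t5 := tendsto_rlim_node (U := U) hs q
    rw [hq] at t5
    have t6 := ((hcY M).tendsto.comp hM).sub ((hcY 0).tendsto.comp t5)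
    rw [halfDisc_self hMpos.ne', halfDisc_zero, sub_zero] at t6
    refine le_of_tendsto_of_tendsto t6 (tendsto_regInt_rest hU hsum i4) ?_
    filter_upwards [hS] with n hn
    exact le_of_ofReal_le hY (NoCut.ofReal_sub_le (edgewiseAC hY) (continuous hY) hn.1 hn.2.1
      hn.2.2 (hx n ⟨_, hn.2.2⟩).1)
  have hmain : 2 * ω * M * G.regInt U S (fun p => |G.dv (halfDisc M ∘ h) p|) ≤
      G.regInt U S (fun p => G.dv h p * G.dv h p) + ω ^ 2 *
        (M ^ 2 * G.regInt U S (G.posInd h) -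
          G.regInt U S (fun p => h (G.point p) * h (G.point p)) +
          |M ^ 2 - M ^ 2| * G.regInt U S (G.posInd h)) := by
    refine le_of_tendsto_of_tendsto ((tendsto_regInt (U := U) S i4).const_mul _)
      (t2.add (((((t3.const_mul (M ^ 2)).sub t1)).add
        ((((hmM.pow 2).sub_const (M ^ 2)).abs).mul t3)).const_mul (ω ^ 2))) ?_
    filter_upwards [hle] with n hn
    have j1 : Integrable (fun p => M ^ 2 * G.posInd h p - h (G.point p) * h (G.point p))
      G.edgeMeasure := (i3.const_mul _).sub i1
    have j2 : Integrable (fun p => |m n ^ 2 - M ^ 2| * G.posInd h p) G.edgeMeasure :=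
      i3.const_mul _
    have j3 : Integrable (fun p => ω ^ 2 * (M ^ 2 * G.posInd h p - h (G.point p) * h (G.point p) +
      |m n ^ 2 - M ^ 2| * G.posInd h p)) G.edgeMeasure := (j1.add j2).const_mul _
    rw [← integral_const_mul, ← integral_const_mul, ← integral_const_mul,
      ← integral_sub (i3.const_mul _).integrableOn i1.integrableOn,
      ← integral_add j1.integrableOn j2.integrableOn,
      ← integral_const_mul, ← integral_add i2.integrableOn j3.integrableOn]
    refine setIntegral_mono_on_ae (i4.const_mul _).integrableOn (i2.add j3).integrableOn
      measurableSet_cells ?_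
    filter_upwards [mul_sqrt_le_ae hs h0 hMpos ω] with p hp hpc
    exact hp (m n) (hn p hpc)
  rw [sub_self, abs_zero, zero_mul, add_zero] at hmain
  have := mul_le_mul_of_nonneg_left hlink (show 0 ≤ 2 * ω * M by positivity)
  nlinarith

end sobolev

end MetricGraphOn

namespace MetricGraphOn

variable {X : Type} [MetricSpace X] (G : MetricGraphOn X)
  (U : Ultrafilter (Finset G.E × ℕ)) [IsFiniteMeasure G.edgeMeasure] [ConnectedSpace X]

/-- The `L²` inner product over a region. -/
noncomputable def regMass (S : Finset G.E × ℕ → Finset (G.E × ℕ)) :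
    G.sobolev →ₗ[ℝ] G.sobolev →ₗ[ℝ] ℝ :=
  LinearMap.mk₂ ℝ (fun f g => G.regInt U S fun p => f.1 (G.point p) * g.1 (G.point p))
    (fun f f' g => by
      rw [← regInt_add S (sobolev.integrable_val_mul f.2 g.2) (sobolev.integrable_val_mul f'.2 g.2)]
      simp [add_mul])
    (fun c f g => by
      rw [smul_eq_mul, ← regInt_const_mul S (sobolev.integrable_val_mul f.2 g.2)]
      simp [mul_assoc])
    (fun f g g' => by
      rw [← regInt_add S (sobolev.integrable_val_mul f.2 g.2) (sobolev.integrable_val_mul f.2 g'.2)]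
      simp [mul_add])
    (fun c f g => by
      rw [smul_eq_mul, ← regInt_const_mul S (sobolev.integrable_val_mul f.2 g.2)]
      simp [mul_left_comm])

omit [IsFiniteMeasure G.edgeMeasure] [ConnectedSpace X] in
/-- The Dirichlet form over a region. -/
noncomputable def regEnergy (S : Finset G.E × ℕ → Finset (G.E × ℕ)) :
    G.sobolev →ₗ[ℝ] G.sobolev →ₗ[ℝ] ℝ :=
  LinearMap.mk₂ ℝ (fun f g => G.regInt U S fun p => G.dv f.1 p * G.dv g.1 p)
    (fun f f' g => by
      rw [← regInt_add S (sobolev.integrable_dv_mul f.2 g.2) (sobolev.integrable_dv_mul f'.2 g.2)]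
      refine regInt_congr S ?_
      filter_upwards [dv_add_ae (sobolev.edgewiseAC f.2) (sobolev.edgewiseAC f'.2)] with p hp
      rw [Submodule.coe_add, hp, add_mul])
    (fun c f g => by
      rw [smul_eq_mul, ← regInt_const_mul S (sobolev.integrable_dv_mul f.2 g.2)]
      simp [dv_smul, mul_assoc])
    (fun f g g' => by
      rw [← regInt_add S (sobolev.integrable_dv_mul f.2 g.2) (sobolev.integrable_dv_mul f.2 g'.2)]
      refine regInt_congr S ?_
      filter_upwards [dv_add_ae (sobolev.edgewiseAC g.2) (sobolev.edgewiseAC g'.2)] with p hp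
      rw [Submodule.coe_add, hp, mul_add])
    (fun c f g => by
      rw [smul_eq_mul, ← regInt_const_mul S (sobolev.integrable_dv_mul f.2 g.2)]
      simp [dv_smul, mul_left_comm])

/-- The value at the limit of a family of nodes. -/
noncomputable def nodeVal (q : Finset G.E × ℕ → G.E × ℕ) : G.sobolev →ₗ[ℝ] ℝ where
  toFun f := U.rlim fun n => f.1 (G.node n (q n))
  map_add' f g := Ultrafilter.rlim_eq
    ((sobolev.tendsto_rlim_node f.2 q).add (sobolev.tendsto_rlim_node g.2 q))
  map_smul' c f := Ultrafilter.rlim_eq ((sobolev.tendsto_rlim_node f.2 q).const_mul c)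

/-- The positive part of a Sobolev function. -/
noncomputable def posPart (f : G.sobolev) : G.sobolev :=
  ⟨fun x => max (f.1 x) 0, (sobolev.posPart_mem f.2).1⟩

variable {G}

omit [IsFiniteMeasure G.edgeMeasure] [ConnectedSpace X] in
theorem posInd_posPart (f : G.sobolev) : G.posInd (G.posPart f).1 = G.posInd f.1 := by
  unfold posInd posPart
  ext q
  simp

omit [IsFiniteMeasure G.edgeMeasure] [ConnectedSpace X] in
theorem posInd_add_le (f : X → ℝ) (p : G.E × ℝ) : G.posInd f p + G.posInd (-f) p ≤ 1 := by
  by_cases h : 0 < f (G.point p)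
  · have : G.posInd (-f) p = 0 := indicator_of_notMem (by simp [h.le]) _
    rw [this, add_zero]
    exact posInd_le_one f p
  · have : G.posInd f p = 0 := indicator_of_notMem (show p ∉ {q | 0 < f (G.point q)} from h) _
    rw [this, zero_add]
    exact posInd_le_one _ p

omit [IsFiniteMeasure G.edgeMeasure] [ConnectedSpace X] in
theorem max_mul_max_neg (u : ℝ) : max u 0 * max (-u) 0 = 0 := by
  rcases le_total u 0 with h | h <;> simp [h]

theorem nodeVal_posPart {q : Finset G.E × ℕ → G.E × ℕ} {f : G.sobolev}
    (h : G.nodeVal U q f = 0) : G.nodeVal U q (G.posPart f) = 0 := by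
  have h1 := sobolev.tendsto_rlim_node (U := U) f.2 q
  rw [show U.rlim (fun n => f.1 (G.node n (q n))) = 0 from h] at h1
  refine Ultrafilter.rlim_eq ?_
  simpa [posPart] using h1.max (tendsto_const_nhds (x := (0 : ℝ)))

/-- The ultralimit of the subdivisions of a metric graph of finite total length. -/
noncomputable def ultraGraph [DecidableEq (G.E × ℕ)] (hU : (U : Filter (Finset G.E × ℕ)) ≤ atTop)
    (hsum : Summable G.len) (a : ℝ) (ha : 0 < a) :
    UltraGraph G.sobolev (Finset G.E × ℕ) (G.E × ℕ) where
  U := U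
  adj := G.Adj
  adj_symm _ _ _ h := h.symm
  vert := G.atoms
  wt n i := G.edgeMeasure.real (G.cell n i)
  wt_lt ε hε := by
    filter_upwards [(G.tendsto_tsum_div.mono_left hU).eventually (gt_mem_nhds hε)] with n hn i
    exact (measureReal_cell_le hsum n i).trans_lt hn
  a := a
  ω := Real.pi / (2 * a)
  a_pos := ha
  ω_pos := by positivity
  N := G.regMass U
  Q := G.regEnergy U
  N_symm S f g := by simp [regMass, mul_comm]
  Q_symm S f g := by simp [regEnergy, mul_comm]
  N_nonneg S f := regInt_nonneg S (sobolev.integrable_val_mul f.2 f.2)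
    (Eventually.of_forall fun _ => mul_self_nonneg _)
  Q_nonneg S f := regInt_nonneg S (sobolev.integrable_dv_mul f.2 f.2)
    (Eventually.of_forall fun _ => mul_self_nonneg _)
  one := ⟨fun _ => 1, sobolev.const_mem 1⟩
  Q_one S f := by simp [regEnergy, dv_const, regInt_zero]
  ev := G.nodeVal U
  ev_one q := Ultrafilter.rlim_eq tendsto_const_nhds
  tendsto_wt S hS := by
    have h := tendsto_regInt (U := U) S (integrable_const (1 : ℝ) (μ := G.edgeMeasure))
    simp only [regMass, LinearMap.mk₂_apply, mul_one]
    refine h.congr' ?_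
    filter_upwards with n
    rw [setIntegral_const, smul_eq_mul, mul_one, cells, measureReal_biUnion_finset
      (fun i _ j _ hij => disjoint_cell hij) fun i _ => measurableSet_cell]
  form_add S S₁ S₂ p _ h :=
    ⟨by ext f g; exact regInt_union hU hsum h (sobolev.integrable_val_mul f.2 g.2),
      by ext f g; exact regInt_union hU hsum h (sobolev.integrable_dv_mul f.2 g.2)⟩
  pos := G.posPart
  pos_sub f := by
    ext x
    rcases le_total (f.1 x) 0 with h | h <;> simp [posPart, h]
  N_pos S f := by simp [regMass, posPart, max_mul_max_neg, regInt_zero]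
  Q_pos S f := by
    refine (regInt_congr S ?_).trans (regInt_zero S)
    filter_upwards [(sobolev.posPart_mem f.2).2, (sobolev.posPart_mem (-f).2).2] with p h1 h2
    simp only [posPart]
    rw [h1, h2]
    split_ifs with h3 h4
    · simp only [Submodule.coe_neg, Pi.neg_apply] at h4
      linarith
    all_goals simp
  N_pos_one S f := by
    refine regInt_nonneg S (sobolev.integrable_val_mul (G.posPart f).2 (sobolev.const_mem 1))
      (Eventually.of_forall fun p => ?_)
    simp [posPart]
  N_pos_eq_zero S f h := by
    obtain ⟨B, hB⟩ := sobolev.exists_bound f.2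
    have hi := sobolev.integrable_val_mul (G.posPart f).2 (sobolev.const_mem 1)
    have hi2 := sobolev.integrable_val_mul (G.posPart f).2 (G.posPart f).2
    refine le_antisymm ((regInt_mono S hi2 (hi.const_mul B)
      (Eventually.of_forall fun p => ?_)).trans ((regInt_const_mul S hi B).trans ?_).le)
      (regInt_nonneg S hi2 (Eventually.of_forall fun _ => mul_self_nonneg _))
    · have h1 : max (f.1 (G.point p)) 0 ≤ B :=
        max_le ((abs_le.1 (hB _)).2) ((abs_nonneg _).trans (hB (G.point p)))
      have h2 : 0 ≤ max (f.1 (G.point p)) 0 := le_max_right _ _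
      simp only [posPart, mul_one]
      exact mul_le_mul_of_nonneg_right h1 h2
    · rw [show G.regInt U S _ = 0 from h, mul_zero]
  supp S f := G.regInt U S (G.posInd f.1)
  supp_nonneg S f := regInt_nonneg S (integrable_posInd f.2.1)
    (Eventually.of_forall fun _ => posInd_nonneg _ _)
  supp_add_le S f := by
    rw [← regInt_add S (integrable_posInd f.2.1) (integrable_posInd (-f).2.1)]
    simp only [regMass, LinearMap.mk₂_apply, mul_one]
    exact regInt_mono S ((integrable_posInd f.2.1).add (integrable_posInd (-f).2.1))
      (integrable_const _) (Eventually.of_forall fun p => posInd_add_le f.1 p)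
  faber_krahn S p f hS hp hs := by
    obtain ⟨M, -, h2⟩ := sobolev.exists_faberKrahn (U := U) hU hsum (G.posPart f).2
      (fun x => le_max_right _ _) hS
      (nodeVal_posPart U hp) (ω := Real.pi / (2 * a)) (by positivity)
    rw [posInd_posPart] at h2
    have h3 : Real.pi / (2 * a) * (Real.pi / 2) = (Real.pi / (2 * a)) ^ 2 * a := by
      field_simp
    have h4 := mul_le_mul_of_nonneg_left hs
      (show 0 ≤ (Real.pi / (2 * a)) ^ 2 * M ^ 2 by positivity)
    simp only [regMass, regEnergy, LinearMap.mk₂_apply]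
    nlinarith
  faber_krahn_eq S p f hS hp hs hle := by
    obtain ⟨M, h1, h2⟩ := sobolev.exists_faberKrahn (U := U) hU hsum (G.posPart f).2
      (fun x => le_max_right _ _) hS
      (nodeVal_posPart U hp) (ω := Real.pi / (2 * a)) (by positivity)
    rw [posInd_posPart] at h1 h2
    have h3 : Real.pi / (2 * a) * (Real.pi / 2) = (Real.pi / (2 * a)) ^ 2 * a := by
      field_simp
    simp only [regMass, regEnergy, LinearMap.mk₂_apply] at hle ⊢
    have h5 : 0 < (Real.pi / (2 * a)) ^ 2 := by positivity
    have h6 : M ^ 2 = 0 := by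
      by_contra hM
      have h7 : 0 < M ^ 2 := lt_of_le_of_ne (sq_nonneg M) (Ne.symm hM)
      have h4 := mul_lt_mul_of_pos_left hs (mul_pos h5 h7)
      nlinarith
    rw [h6, zero_mul] at h1
    exact le_antisymm h1 (regInt_nonneg S (sobolev.integrable_val_mul (G.posPart f).2
      (G.posPart f).2) (Eventually.of_forall fun _ => mul_self_nonneg _))

end MetricGraphOn

namespace MetricGraphOn

variable {X : Type} [MetricSpace X] {G : MetricGraphOn X}

/-- Continuous functions which agree almost everywhere are equal. -/
theorem eq_of_ae_eq {f g : X → ℝ} (hf : Continuous f) (hg : Continuous g)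
    (h : ∀ᵐ p ∂G.edgeMeasure, f (G.point p) = g (G.point p)) : f = g := by
  ext x
  obtain ⟨e, t, ht, rfl⟩ := G.exists_point x
  have h1 := G.ae_edgeMeasure_iff.1 h e
  rw [Measure.restrict_congr_set Ioo_ae_eq_Icc] at h1
  exact Measure.eqOn_Icc_of_ae_eq volume (G.len_pos e).ne h1
    (hf.comp (G.continuous_point e)).continuousOn (hg.comp (G.continuous_point e)).continuousOn ht

theorem eventually_atoms_nonempty [Nonempty X] :
    ∀ᶠ n : Finset G.E × ℕ in atTop, (G.atoms n).Nonempty := by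
  obtain ⟨e, -⟩ := G.exists_point (Classical.arbitrary X)
  filter_upwards [eventually_ge_atTop (({e}, 0) : Finset G.E × ℕ)] with n hn
  refine ⟨(e, 0), ?_⟩
  simp only [atoms, Finset.mem_product, Finset.mem_range]
  exact ⟨hn.1 (Finset.mem_singleton_self e), by omega⟩

variable [IsFiniteMeasure G.edgeMeasure] [ConnectedSpace X]

theorem eq_zero_of_integral_sq_eq_zero {f : X → ℝ} (hf : f ∈ G.sobolev)
    (h : ∫ p, f (G.point p) * f (G.point p) ∂G.edgeMeasure = 0) : f = 0 := by
  refine eq_of_ae_eq (G := G) hf.1 continuous_zero ?_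
  have := (integral_eq_zero_iff_of_nonneg (fun p => mul_self_nonneg _)
    (sobolev.integrable_val_mul hf hf)).1 h
  filter_upwards [this] with p hp
  simpa using hp

/-- If the Rayleigh quotient is at most the first eigenvalue of a mixed problem on an interval of
length `L / k` on a space of dimension `k`, then equality holds and there are functions with
disjoint supports attaining this value. -/
theorem exists_disjoint_of_submodule (hsum : Summable G.len) {L ω : ℝ} (hL : L = ∑' e, G.len e)
    (hL0 : 0 < L) {m : ℕ} (hω : ω = Real.pi * (m + 2) / (2 * L)) {V : Submodule ℝ G.sobolev}
    [FiniteDimensional ℝ V] (hdim : m + 2 ≤ Module.finrank ℝ V)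
    (hV : ∀ f ∈ V, ∫ p, G.dv f.1 p * G.dv f.1 p ∂G.edgeMeasure ≤
      ω ^ 2 * ∫ p, f.1 (G.point p) * f.1 (G.point p) ∂G.edgeMeasure) :
    (∃ f ∈ V, f ≠ 0 ∧ ω ^ 2 * ∫ p, f.1 (G.point p) * f.1 (G.point p) ∂G.edgeMeasure ≤
      ∫ p, G.dv f.1 p * G.dv f.1 p ∂G.edgeMeasure) ∧
    ∃ f : Fin (m + 2) → X → ℝ, (∀ i, f i ∈ G.sobolev ∧ (∀ x, 0 ≤ f i x) ∧ (∃ x, 0 < f i x) ∧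
      ∫ p, G.dv (f i) p * G.dv (f i) p ∂G.edgeMeasure ≤
        ω ^ 2 * ∫ p, f i (G.point p) * f i (G.point p) ∂G.edgeMeasure) ∧
      ∀ i j, i ≠ j → ∀ x, f i x = 0 ∨ f j x = 0 := by
  classical
  set U : Ultrafilter (Finset G.E × ℕ) := Ultrafilter.of atTop
  have hU : (U : Filter (Finset G.E × ℕ)) ≤ atTop := Ultrafilter.of_le _
  have ha : 0 < L / (m + 2) := by positivity
  set Γ := ultraGraph U hU hsum (L / (m + 2)) ha with hΓ
  have hN : ∀ f g, Γ.N G.atoms f g = ∫ p, f.1 (G.point p) * g.1 (G.point p) ∂G.edgeMeasure :=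
    fun f g => regInt_atoms hU hsum (sobolev.integrable_val_mul f.2 g.2)
  have hQ : ∀ f g, Γ.Q G.atoms f g = ∫ p, G.dv f.1 p * G.dv g.1 p ∂G.edgeMeasure :=
    fun f g => regInt_atoms hU hsum (sobolev.integrable_dv_mul f.2 g.2)
  have hω2 : Γ.ω = ω := by
    rw [hω]
    change Real.pi / (2 * (L / (m + 2))) = _
    field_simp
  have hform : ∀ f, Γ.form G.atoms f f = (∫ p, G.dv f.1 p * G.dv f.1 p ∂G.edgeMeasure) -
      ω ^ 2 * ∫ p, f.1 (G.point p) * f.1 (G.point p) ∂G.edgeMeasure := fun f => by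
    rw [UltraGraph.form_apply, hN, hQ, hω2]
  have ho : ∀ n, ∃ i, (G.atoms n).Nonempty → i ∈ G.atoms n := fun n => by
    by_cases hn : (G.atoms n).Nonempty
    · exact ⟨hn.choose, fun _ => hn.choose_spec⟩
    · obtain ⟨e, -⟩ := G.exists_point (Classical.arbitrary X)
      exact ⟨(e, 0), fun h => (hn h).elim⟩
  choose o ho using ho
  have hC : Γ.Conn G.atoms o := by
    filter_upwards [hU (eventually_atoms_nonempty (G := G))] with n hn
    exact ⟨subset_rfl, noCut_atoms n, ho n hn⟩
  have hmass : Γ.N G.atoms Γ.one Γ.one = (m + 2) * Γ.a := by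
    rw [hN]
    change ∫ p, (1 : ℝ) * 1 ∂G.edgeMeasure = (m + 2) * (L / (m + 2))
    rw [mul_one, integral_const, smul_eq_mul, mul_one, edgeMeasure_real_univ G hsum, ← hL]
    field_simp
  obtain ⟨⟨f, hf, hf0, hf2⟩, h, h1, h2, h3⟩ := UltraGraph.exists_orthogonal hC hmass hdim
    (fun f hf => by rw [hform]; linarith [hV f hf])
    fun f hf h => Subtype.ext (eq_zero_of_integral_sq_eq_zero f.2 (by rw [← hN]; exact h))
  rw [hform] at hf2
  refine ⟨⟨f, hf, hf0, by linarith⟩, fun i => (G.posPart (h i)).1, fun i =>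
    ⟨(G.posPart (h i)).2, fun x => le_max_right _ _, ?_, ?_⟩, fun i j hij x => ?_⟩
  · by_contra! hcon
    have hz : (G.posPart (h i)).1 = 0 := funext fun x => le_antisymm (hcon x) (le_max_right _ _)
    refine h2 i ?_
    rw [hN]
    change ∫ p, (G.posPart (h i)).1 (G.point p) * (G.posPart (h i)).1 (G.point p) ∂_ = 0
    simp [hz]
  · have := h1 i
    rw [hform] at this
    exact sub_nonpos.1 this
  · have := h3 i j hij
    rw [hN] at this
    have h4 := (integral_eq_zero_iff_of_nonneg (fun p => mul_nonneg (le_max_right _ _)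
      (le_max_right _ _)) (sobolev.integrable_val_mul (G.posPart (h i)).2 (G.posPart (h j)).2)).1
      this
    have h5 := congrFun (eq_of_ae_eq (G := G) ((G.posPart (h i)).2.1.mul (G.posPart (h j)).2.1)
      continuous_zero h4) x
    exact mul_eq_zero.1 h5

end MetricGraphOn

namespace MetricGraphOn

variable {X : Type} [MetricSpace X] {G : MetricGraphOn X}

theorem setIntegral_edgeMeasure {e : G.E} {t : ℝ} (ht : t ≤ G.len e) {F : G.E × ℝ → ℝ}
    (hF : Integrable F G.edgeMeasure) :
    ∫ p in {e} ×ˢ Ioo 0 t, F p ∂G.edgeMeasure = ∫ s in Ioo 0 t, F (e, s) := by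
  have hm : MeasurableSet ({e} ×ˢ Ioo 0 t : Set (G.E × ℝ)) :=
    (measurableSet_singleton e).prod measurableSet_Ioo
  rw [← integral_indicator hm]
  refine (hasSum_integral_edgeMeasure G (hF.indicator hm)).unique ?_
  convert hasSum_single e ?_ using 1
  · have : (fun s => ({e} ×ˢ Ioo 0 t : Set (G.E × ℝ)).indicator F (e, s)) =
        (Ioo 0 t).indicator fun s => F (e, s) := by
      ext s
      simp [indicator]
    rw [this, setIntegral_indicator measurableSet_Ioo, inter_eq_right.2 (Ioo_subset_Ioo_right ht)]
  · intro e' he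
    simp [indicator, he]

theorem EdgewiseAC.setIntegral_dv {f : X → ℝ} (hf : G.EdgewiseAC f)
    (hi : Integrable (G.dv f) G.edgeMeasure) {e : G.E} {t : ℝ} (ht : t ∈ Icc 0 (G.len e)) :
    ∫ p in {e} ×ˢ Ioo 0 t, G.dv f p ∂G.edgeMeasure = f (G.edgeMap e t) - f (G.edgeMap e 0) := by
  have h1 : AbsolutelyContinuousOnInterval (f ∘ G.edgeMap e) 0 t := (hf e).mono (by
    rw [uIcc_of_le ht.1, uIcc_of_le (G.len_pos e).le]; exact Icc_subset_Icc_right ht.2)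
  have h2 := h1.integral_deriv_eq_sub
  rw [intervalIntegral.integral_of_le ht.1, integral_Ioc_eq_integral_Ioo] at h2
  rw [setIntegral_edgeMeasure ht.2 hi]
  exact h2

namespace sobolev

variable [IsFiniteMeasure G.edgeMeasure]

theorem of_setIntegral {f : X → ℝ} (hf : Continuous f) {g : G.E × ℝ → ℝ}
    (hg : MemLp g 2 G.edgeMeasure) (h : ∀ e, ∀ t ∈ Icc 0 (G.len e),
      ∫ p in {e} ×ˢ Ioo 0 t, g p ∂G.edgeMeasure = f (G.edgeMap e t) - f (G.edgeMap e 0)) :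
    f ∈ G.sobolev ∧ ∀ᵐ p ∂G.edgeMeasure, G.dv f p = g p := by
  have hg1 := hg.integrable one_le_two
  have h_int : ∀ e, IntervalIntegrable (fun s => g (e, s)) volume 0 (G.len e) := fun e => by
    rw [intervalIntegrable_iff_integrableOn_Ioo_of_le (G.len_pos e).le]
    exact integrableOn_edge G hg1 e
  have h' : ∀ e, ∀ t ∈ Icc 0 (G.len e),
      f (G.edgeMap e t) = f (G.edgeMap e 0) + ∫ s in (0 : ℝ)..t, g (e, s) := fun e t ht => by
    rw [intervalIntegral.integral_of_le ht.1, integral_Ioc_eq_integral_Ioo,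
      ← setIntegral_edgeMeasure ht.2 hg1, h e t ht]
    ring
  have hdv : ∀ᵐ p ∂G.edgeMeasure, G.dv f p = g p := by
    rw [ae_edgeMeasure_iff]
    intro e
    rw [ae_restrict_iff' measurableSet_Ioo]
    filter_upwards [(h_int e).ae_hasDerivAt_integral] with t ht htI
    have hle := (G.len_pos e).le
    have h1 := (ht (by rw [uIcc_of_le hle]; exact Ioo_subset_Icc_self htI) 0
      left_mem_uIcc).const_add
      (f (G.edgeMap e 0))
    refine (h1.congr_of_eventuallyEq ?_).deriv
    filter_upwards [Ioo_mem_nhds htI.1 htI.2] with s hs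
    exact h' e s (Ioo_subset_Icc_self hs)
  refine ⟨⟨hf, fun e => ?_, ?_⟩, hdv⟩
  · refine ((h_int e).absolutelyContinuousOnInterval_intervalIntegral
      (left_mem_uIcc : (0 : ℝ) ∈ uIcc 0 (G.len e))).of_dist_le (K := 1) fun s hs t ht => ?_
    rw [uIcc_of_le (G.len_pos e).le] at hs ht
    simp only [Function.comp_apply, h' e s hs, h' e t ht, one_mul, dist_add_left, le_refl]
  · refine hg.integrable_sq.congr ?_
    filter_upwards [hdv] with p hp
    rw [hp]

/-- The Sobolev space is closed under pointwise limits with bounded energy. -/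
theorem of_tendsto {ι : Type*} (W : Ultrafilter ι) {f : ι → X → ℝ} (hf : ∀ n, f n ∈ G.sobolev)
    {g : X → ℝ} (hg : Continuous g) (hfg : ∀ x, Tendsto (fun n => f n x) W (nhds (g x)))
    {c : ι → ℝ} {B C : ℝ} (hc : ∀ n, ∫ p, G.dv (f n) p * G.dv (f n) p ∂G.edgeMeasure ≤ c n)
    (hB : ∀ n, c n ≤ B) (hC : Tendsto c W (nhds C)) :
    g ∈ G.sobolev ∧ ∫ p, G.dv g p * G.dv g p ∂G.edgeMeasure ≤ C := by
  set D : ι → Lp ℝ 2 G.edgeMeasure := fun n => (memLp_dv (hf n)).toLp _ with hD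
  have hDcoe : ∀ n, ∀ᵐ p ∂G.edgeMeasure, D n p = G.dv (f n) p := fun n => MemLp.coeFn_toLp _
  have hnorm : ∀ n, ‖D n‖ ^ 2 = ∫ p, G.dv (f n) p * G.dv (f n) p ∂G.edgeMeasure := fun n => by
    rw [← real_inner_self_eq_norm_sq, L2.inner_def]
    refine integral_congr_ae ?_
    filter_upwards [hDcoe n] with p hp
    simp [hp, sq]
  have hDc : ∀ n, ‖D n‖ ≤ √(c n) := fun n => Real.le_sqrt_of_sq_le ((hnorm n).trans_le (hc n))
  have hDB : ∀ n, ‖D n‖ ≤ √B := fun n => (hDc n).trans (Real.sqrt_le_sqrt (hB n))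
  have ht : ∀ h : Lp ℝ 2 G.edgeMeasure, Tendsto (fun n => inner ℝ (D n) h) W
      (nhds (W.rlim fun n => inner ℝ (D n) h)) := fun h =>
    Ultrafilter.tendsto_rlim fun n => (abs_real_inner_le_norm _ _).trans
      (mul_le_mul_of_nonneg_right (hDB n) (norm_nonneg h))
  let ℓ : Lp ℝ 2 G.edgeMeasure →L[ℝ] ℝ := LinearMap.mkContinuous
    { toFun := fun h => W.rlim fun n => inner ℝ (D n) h
      map_add' := fun h h' => Ultrafilter.rlim_eq (by
        simpa only [inner_add_right] using (ht h).add (ht h'))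
      map_smul' := fun r h => Ultrafilter.rlim_eq (by
        simpa only [inner_smul_right, RingHom.id_apply, smul_eq_mul] using
          (ht h).const_mul r) } (√B) fun h =>
      le_of_tendsto' (ht h).norm fun n => (abs_real_inner_le_norm _ _).trans
        (mul_le_mul_of_nonneg_right (hDB n) (norm_nonneg h))
  set d := (InnerProductSpace.toDual ℝ (Lp ℝ 2 G.edgeMeasure)).symm ℓ with hd
  have hdt : ∀ h, Tendsto (fun n => inner ℝ (D n) h) W (nhds (inner ℝ d h)) := fun h => by
    rw [hd, InnerProductSpace.toDual_symm_apply]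
    exact ht h
  have hdC : ‖d‖ ≤ √C := by
    have h1 : ‖d‖ ^ 2 ≤ √C * ‖d‖ := by
      rw [← real_inner_self_eq_norm_sq]
      exact le_of_tendsto_of_tendsto' (hdt d)
        (((Real.continuous_sqrt.tendsto C).comp hC).mul_const _) fun n =>
        (real_inner_le_norm _ _).trans (mul_le_mul_of_nonneg_right (hDc n) (norm_nonneg d))
    rcases (norm_nonneg d).eq_or_lt with h0 | h0
    · rw [← h0]; exact Real.sqrt_nonneg _
    · nlinarith
  have hC0 : 0 ≤ C := ge_of_tendsto' hC fun n => (sq_nonneg ‖D n‖).trans ((hnorm n).trans_le (hc n))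
  have key : ∀ e, ∀ t ∈ Icc 0 (G.len e),
      ∫ p in {e} ×ˢ Ioo 0 t, d p ∂G.edgeMeasure = g (G.edgeMap e t) - g (G.edgeMap e 0) := by
    intro e t ht
    have hm : MeasurableSet ({e} ×ˢ Ioo 0 t : Set (G.E × ℝ)) :=
      (measurableSet_singleton e).prod measurableSet_Ioo
    have h1 := hdt (indicatorConstLp 2 hm (measure_ne_top _ _) 1)
    rw [real_inner_comm, L2.inner_indicatorConstLp_one] at h1
    refine tendsto_nhds_unique h1 (((hfg _).sub (hfg _)).congr fun n => ?_)
    rw [real_inner_comm, L2.inner_indicatorConstLp_one,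
      ← (edgewiseAC (hf n)).setIntegral_dv (integrable_dv (hf n)) ht]
    refine setIntegral_congr_ae hm ?_
    filter_upwards [hDcoe n] with p hp _
    rw [hp]
  obtain ⟨h1, h2⟩ := of_setIntegral hg (Lp.memLp d) key
  refine ⟨h1, ?_⟩
  have h3 : ∫ p, G.dv g p * G.dv g p ∂G.edgeMeasure = ‖d‖ ^ 2 := by
    rw [← real_inner_self_eq_norm_sq, L2.inner_def]
    refine integral_congr_ae ?_
    filter_upwards [h2] with p hp
    simp [hp, sq]
  rw [h3, ← Real.sq_sqrt hC0]
  exact pow_le_pow_left₀ (norm_nonneg d) hdC 2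

end sobolev

end MetricGraphOn

section RealForms

variable {W : Type*} [AddCommGroup W] [Module ℝ W]

theorem Submodule.exists_linearIndependent_of_finrank_eq {V : Submodule ℝ W}
    [FiniteDimensional ℝ V] {k : ℕ} (hd : Module.finrank ℝ V = k) :
    ∃ ψ : Fin k → W, (∀ i, ψ i ∈ V) ∧ LinearIndependent ℝ ψ := by
  let b := Module.finBasisOfFinrankEq ℝ V hd
  exact ⟨fun i => (b i).1, fun i => (b i).2, b.linearIndependent.map' V.subtype V.ker_subtype⟩

namespace LinearMap.BilinForm

variable {B : LinearMap.BilinForm ℝ W}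

theorem exists_orthonormal_family (hB : ∀ f g, B f g = B g f) (hB0 : ∀ f, f ≠ 0 → 0 < B f f)
    {V : Submodule ℝ W} [FiniteDimensional ℝ V] {k : ℕ} (hd : Module.finrank ℝ V = k) :
    ∃ φ : Fin k → W, (∀ i, φ i ∈ V) ∧ ∀ i j, B (φ i) (φ j) = if i = j then 1 else 0 := by
  subst hd
  have hsymm : LinearMap.IsSymm (B.restrict V) := ⟨fun f g => hB f.1 g.1⟩
  obtain ⟨v, hv⟩ := LinearMap.BilinForm.exists_orthogonal_basis (B := B.restrict V) hsymm
  have hp : ∀ i, 0 < B (v i).1 (v i).1 := fun i =>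
    hB0 _ fun h => v.ne_zero i (Subtype.ext h)
  refine ⟨fun i => (√(B (v i).1 (v i).1))⁻¹ • (v i).1, fun i =>
    V.smul_mem _ (v i).2, fun i j => ?_⟩
  simp only [map_smul, LinearMap.smul_apply, smul_eq_mul]
  split_ifs with h
  · subst h
    rw [← mul_assoc, ← mul_inv, Real.mul_self_sqrt (hp i).le, inv_mul_cancel₀ (hp i).ne']
  · have : B (v i).1 (v j).1 = 0 := hv h
    rw [this, mul_zero, mul_zero]

variable {k : ℕ} {φ : Fin k → W}

theorem sum_smul_self_of_orthonormal (hφ : ∀ i j, B (φ i) (φ j) = if i = j then 1 else 0)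
    (c : Fin k → ℝ) : B (∑ i, c i • φ i) (∑ i, c i • φ i) = ∑ i, c i ^ 2 := by
  simp [hφ, sq]

theorem linearIndependent_of_orthonormal
    (hφ : ∀ i j, B (φ i) (φ j) = if i = j then 1 else 0) : LinearIndependent ℝ φ := by
  refine Fintype.linearIndependent_iff.2 fun c hc i => ?_
  have h := sum_smul_self_of_orthonormal hφ c
  rw [hc, map_zero, eq_comm, Finset.sum_eq_zero_iff_of_nonneg fun i _ => sq_nonneg _] at h
  simpa using h i (Finset.mem_univ i)

theorem sum_smul_self_le (Q : LinearMap.BilinForm ℝ W) (φ : Fin k → W) (c : Fin k → ℝ) :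
    Q (∑ i, c i • φ i) (∑ i, c i • φ i) ≤ (∑ i, ∑ j, |Q (φ i) (φ j)|) * ∑ i, c i ^ 2 := by
  have hc : ∀ i, |c i| ≤ √(∑ i, c i ^ 2) := fun i => Real.abs_le_sqrt
    (Finset.single_le_sum (f := fun i => c i ^ 2) (fun _ _ => sq_nonneg _) (Finset.mem_univ i))
  have h0 : 0 ≤ ∑ i, c i ^ 2 := Finset.sum_nonneg fun i _ => sq_nonneg _
  have hcc : ∀ i j, |c i * c j| ≤ ∑ i, c i ^ 2 := fun i j => by
    rw [abs_mul, ← Real.mul_self_sqrt h0]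
    exact mul_le_mul (hc i) (hc j) (abs_nonneg _) (Real.sqrt_nonneg _)
  have h1 : Q (∑ i, c i • φ i) (∑ i, c i • φ i) = ∑ i, ∑ j, c i * c j * Q (φ i) (φ j) := by
    simp only [map_sum, map_smul, LinearMap.sum_apply, LinearMap.smul_apply, smul_eq_mul,
      Finset.mul_sum]
    rw [Finset.sum_comm]
    exact Finset.sum_congr rfl fun i _ => Finset.sum_congr rfl fun j _ => by ring
  rw [h1, Finset.sum_mul]
  refine Finset.sum_le_sum fun i _ => ?_
  rw [Finset.sum_mul]
  refine Finset.sum_le_sum fun j _ => (le_abs_self _).trans ?_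
  rw [abs_mul, mul_comm]
  exact mul_le_mul_of_nonneg_left (hcc i j) (abs_nonneg _)

end LinearMap.BilinForm

theorem Submodule.span_range_eq_of_finrank_eq {V : Submodule ℝ W} [FiniteDimensional ℝ V] {k : ℕ}
    {φ : Fin k → W} (hφ : LinearIndependent ℝ φ) (hV : ∀ i, φ i ∈ V)
    (hd : Module.finrank ℝ V = k) : Submodule.span ℝ (range φ) = V := by
  refine Submodule.eq_of_le_of_finrank_eq ?_ ?_
  · rw [Submodule.span_le]; rintro _ ⟨i, rfl⟩; exact hV i
  · rw [finrank_span_eq_card hφ, hd, Fintype.card_fin]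

end RealForms

namespace MetricGraphOn

variable {X : Type} [MetricSpace X] (G : MetricGraphOn X)
  [IsFiniteMeasure G.edgeMeasure] [ConnectedSpace X]

/-- The `L²` inner product on the Sobolev space. -/
noncomputable def massForm : LinearMap.BilinForm ℝ G.sobolev :=
  LinearMap.mk₂ ℝ (fun f g => ∫ p, f.1 (G.point p) * g.1 (G.point p) ∂G.edgeMeasure)
    (fun f f' g => by
      rw [← integral_add (sobolev.integrable_val_mul f.2 g.2) (sobolev.integrable_val_mul f'.2 g.2)]
      simp [add_mul])
    (fun c f g => by
      rw [smul_eq_mul, ← integral_const_mul]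
      simp [mul_assoc])
    (fun f g g' => by
      rw [← integral_add (sobolev.integrable_val_mul f.2 g.2) (sobolev.integrable_val_mul f.2 g'.2)]
      simp [mul_add])
    (fun c f g => by
      rw [smul_eq_mul, ← integral_const_mul]
      simp [mul_left_comm])

/-- The Dirichlet form on the Sobolev space. -/
noncomputable def energyForm : LinearMap.BilinForm ℝ G.sobolev :=
  LinearMap.mk₂ ℝ (fun f g => ∫ p, G.dv f.1 p * G.dv g.1 p ∂G.edgeMeasure)
    (fun f f' g => by
      rw [← integral_add (sobolev.integrable_dv_mul f.2 g.2) (sobolev.integrable_dv_mul f'.2 g.2)]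
      refine integral_congr_ae ?_
      filter_upwards [dv_add_ae (sobolev.edgewiseAC f.2) (sobolev.edgewiseAC f'.2)] with p hp
      rw [Submodule.coe_add, hp, add_mul])
    (fun c f g => by
      rw [smul_eq_mul, ← integral_const_mul]
      simp [dv_smul, mul_assoc])
    (fun f g g' => by
      rw [← integral_add (sobolev.integrable_dv_mul f.2 g.2) (sobolev.integrable_dv_mul f.2 g'.2)]
      refine integral_congr_ae ?_
      filter_upwards [dv_add_ae (sobolev.edgewiseAC g.2) (sobolev.edgewiseAC g'.2)] with p hp
      rw [Submodule.coe_add, hp, mul_add])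
    (fun c f g => by
      rw [smul_eq_mul, ← integral_const_mul]
      simp [dv_smul, mul_left_comm])

variable {G}

theorem massForm_apply (f g : G.sobolev) :
    G.massForm f g = ∫ p, f.1 (G.point p) * g.1 (G.point p) ∂G.edgeMeasure := rfl

omit [IsFiniteMeasure G.edgeMeasure] [ConnectedSpace X] in
theorem energyForm_apply (f g : G.sobolev) :
    G.energyForm f g = ∫ p, G.dv f.1 p * G.dv g.1 p ∂G.edgeMeasure := rfl

theorem massForm_comm (f g : G.sobolev) : G.massForm f g = G.massForm g f := by
  simp_rw [massForm_apply, mul_comm]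

omit [IsFiniteMeasure G.edgeMeasure] [ConnectedSpace X] in
theorem energyForm_comm (f g : G.sobolev) : G.energyForm f g = G.energyForm g f := by
  simp_rw [energyForm_apply, mul_comm]

omit [IsFiniteMeasure G.edgeMeasure] [ConnectedSpace X] in
theorem energyForm_self_nonneg (f : G.sobolev) : 0 ≤ G.energyForm f f :=
  integral_nonneg fun _ => mul_self_nonneg _

theorem massForm_self_pos {f : G.sobolev} (hf : f ≠ 0) : 0 < G.massForm f f :=
  (integral_nonneg fun _ => mul_self_nonneg _).lt_of_ne' fun h =>
    hf (Subtype.ext (eq_zero_of_integral_sq_eq_zero f.2 h))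

/-- The quotients bounding the energy on some `k`-dimensional space of Sobolev functions. -/
def rayleighBounds (G : MetricGraphOn X) [IsFiniteMeasure G.edgeMeasure] (k : ℕ) : Set ℝ :=
  {μ | ∃ V : Submodule ℝ G.sobolev, FiniteDimensional ℝ V ∧ Module.finrank ℝ V = k ∧
    ∀ f ∈ V, G.energyForm f f ≤ μ * G.massForm f f}

theorem neumannEigen_eq (k : ℕ) : G.neumannEigen k = sInf (G.rayleighBounds k) := by
  have hQ : ∀ (φ : Fin k → G.sobolev) (c : Fin k → ℝ),
      G.derivNormSqOn univ (∑ i, c i • (φ i).1) = G.energyForm (∑ i, c i • φ i) (∑ i, c i • φ i) ∧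
      G.l2normSqOn univ (∑ i, c i • (φ i).1) = G.massForm (∑ i, c i • φ i) (∑ i, c i • φ i) := by
    intro φ c
    have h : (∑ i, c i • (φ i).1) = (∑ i, c i • φ i : G.sobolev).1 := by
      simp
    rw [h, derivNormSqOn_univ (∑ i, c i • φ i : G.sobolev).2,
      l2normSqOn_univ (∑ i, c i • φ i : G.sobolev).2, energyForm_apply, massForm_apply]
    simp only [sq, and_self]
  have hLI : ∀ φ : Fin k → G.sobolev,
      LinearIndependent ℝ (fun i => (G.subgraphSet univ).restrict (φ i).1) ↔
        LinearIndependent ℝ φ := by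
    intro φ
    let T : G.sobolev →ₗ[ℝ] (G.subgraphSet univ → ℝ) :=
      { toFun := fun f => (G.subgraphSet univ).restrict f.1
        map_add' := fun f g => rfl
        map_smul' := fun c f => rfl }
    have hT : LinearMap.ker T = ⊥ := by
      refine LinearMap.ker_eq_bot'.2 fun f hf => Subtype.ext (funext fun x => ?_)
      exact congrFun hf ⟨x, subgraphSet_univ (G := G) ▸ mem_univ x⟩
    exact T.linearIndependent_iff hT (v := φ)
  unfold neumannEigen eigenOn
  congr 1
  ext μ
  constructor
  · rintro ⟨φ, hφ, hli, hc⟩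
    let ψ : Fin k → G.sobolev := fun i => ⟨φ i, memH1_iff.1 (hφ i)⟩
    have hψ : LinearIndependent ℝ ψ := (hLI ψ).1 hli
    refine ⟨Submodule.span ℝ (range ψ), FiniteDimensional.span_of_finite ℝ (finite_range ψ), ?_,
      fun f hf => ?_⟩
    · rw [finrank_span_eq_card hψ, Fintype.card_fin]
    · obtain ⟨c, rfl⟩ := (Submodule.mem_span_range_iff_exists_fun ℝ).1 hf
      have := hc c
      rwa [(hQ ψ c).1, (hQ ψ c).2] at this
  · rintro ⟨V, _, hd, hV⟩
    obtain ⟨ψ, hψ, hψ'⟩ := Submodule.exists_linearIndependent_of_finrank_eq hd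
    refine ⟨fun i => (ψ i).1, fun i => memH1_iff.2 (ψ i).2, (hLI ψ).2 hψ', fun c => ?_⟩
    rw [(hQ ψ c).1, (hQ ψ c).2]
    exact hV _ (V.sum_mem fun i _ => V.smul_mem _ (hψ i))

theorem rayleighBounds_nonneg {k : ℕ} (hk : 0 < k) {μ : ℝ} (hμ : μ ∈ G.rayleighBounds k) :
    0 ≤ μ := by
  obtain ⟨V, _, hd, hV⟩ := hμ
  obtain ⟨φ, hφ, hφ'⟩ := LinearMap.BilinForm.exists_orthonormal_family massForm_comm
    (fun _ => massForm_self_pos) hd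
  have := (energyForm_self_nonneg _).trans (hV _ (hφ ⟨0, hk⟩))
  simpa [hφ'] using this

theorem rayleighBounds_nonempty {k : ℕ} {ψ : Fin k → G.sobolev} (hψ : LinearIndependent ℝ ψ) :
    (G.rayleighBounds k).Nonempty := by
  have hfin : FiniteDimensional ℝ (Submodule.span ℝ (range ψ)) :=
    FiniteDimensional.span_of_finite ℝ (finite_range ψ)
  have hd : Module.finrank ℝ (Submodule.span ℝ (range ψ)) = k := by
    rw [finrank_span_eq_card hψ, Fintype.card_fin]
  obtain ⟨φ, hφ, hφ'⟩ := LinearMap.BilinForm.exists_orthonormal_family massForm_comm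
    (fun _ => massForm_self_pos) hd
  have hspan := Submodule.span_range_eq_of_finrank_eq
    (LinearMap.BilinForm.linearIndependent_of_orthonormal hφ') hφ hd
  refine ⟨∑ i, ∑ j, |G.energyForm (φ i) (φ j)|, _, hfin, hd, fun f hf => ?_⟩
  rw [← hspan] at hf
  obtain ⟨c, rfl⟩ := (Submodule.mem_span_range_iff_exists_fun ℝ).1 hf
  rw [LinearMap.BilinForm.sum_smul_self_of_orthonormal hφ']
  exact LinearMap.BilinForm.sum_smul_self_le _ _ _

end MetricGraphOn

namespace MetricGraphOn

variable {X : Type} [MetricSpace X] {G : MetricGraphOn X}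
  [IsFiniteMeasure G.edgeMeasure] [ConnectedSpace X]

theorem edgeMeasure_real_univ_pos : 0 < G.edgeMeasure.real univ := by
  obtain ⟨x₀⟩ : Nonempty X := inferInstance
  obtain ⟨e, -⟩ := G.exists_point x₀
  refine ENNReal.toReal_pos (fun h => ?_) (measure_ne_top _ _)
  have h1 := measure_mono_null (subset_univ ({e} ×ˢ univ)) h
  rw [G.edgeMeasure_prod e MeasurableSet.univ, univ_inter, Real.volume_Ioo, sub_zero,
    ENNReal.ofReal_eq_zero] at h1
  exact (G.len_pos e).not_ge h1

namespace sobolev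

/-- The sup bound for Sobolev functions. -/
theorem abs_mul_le {f : X → ℝ} (hf : f ∈ G.sobolev) {N Q : ℝ}
    (hN : ∫ p, f (G.point p) * f (G.point p) ∂G.edgeMeasure ≤ N)
    (hQ : ∫ p, G.dv f p * G.dv f p ∂G.edgeMeasure ≤ Q) (x : X) :
    |f x| ≤ √(G.edgeMeasure.real univ * N) / G.edgeMeasure.real univ +
      √(G.edgeMeasure.real univ * Q) := by
  set ℓ := G.edgeMeasure.real univ
  have hℓ : 0 < ℓ := edgeMeasure_real_univ_pos
  have h1 : ∫ p, |f (G.point p)| ∂G.edgeMeasure ≤ √(ℓ * N) := by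
    refine Real.le_sqrt_of_sq_le ?_
    have := sq_setIntegral_abs_le (memLp_val hf) univ
    rw [setIntegral_univ] at this
    refine this.trans (mul_le_mul_of_nonneg_left ?_ hℓ.le)
    simpa only [sq] using hN
  have h2 : ∫ p, |G.dv f p| ∂G.edgeMeasure ≤ √(ℓ * Q) := by
    refine Real.le_sqrt_of_sq_le ?_
    have := sq_setIntegral_abs_le (memLp_dv hf) univ
    rw [setIntegral_univ] at this
    refine this.trans (mul_le_mul_of_nonneg_left ?_ hℓ.le)
    simpa only [sq] using hQ
  have h3 : ∫ _p, (|f x| - √(ℓ * Q)) ∂G.edgeMeasure ≤ ∫ p, |f (G.point p)| ∂G.edgeMeasure := by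
    refine integral_mono (integrable_const _) (integrable_val hf).abs fun p => ?_
    have := (abs_sub_abs_le_abs_sub (f x) (f (G.point p))).trans (abs_sub_le hf x (G.point p))
    show |f x| - √(ℓ * Q) ≤ |f (G.point p)|
    linarith
  rw [integral_const, smul_eq_mul] at h3
  rw [← sub_le_iff_le_add, le_div_iff₀ hℓ, mul_comm]
  exact h3.trans h1

/-- Families bounded in the Sobolev norm converge uniformly along ultrafilters. -/
theorem exists_uniform_limit (hsum : Summable G.len) {ι : Type*} (W : Ultrafilter ι)
    {f : ι → X → ℝ} (hf : ∀ n, f n ∈ G.sobolev) {B Q : ℝ} (hB : ∀ n x, |f n x| ≤ B)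
    (hQ : ∀ n, ∫ p, G.dv (f n) p * G.dv (f n) p ∂G.edgeMeasure ≤ Q) :
    ∃ g : X → ℝ, Continuous g ∧ TendstoUniformly f g W := by
  classical
  set g : X → ℝ := fun x => W.rlim fun n => f n x
  have hg : ∀ x, Tendsto (fun n => f n x) W (nhds (g x)) := fun x =>
    Ultrafilter.tendsto_rlim fun n => hB n x
  have hu : TendstoUniformly f g W := by
    refine Metric.tendstoUniformly_iff.2 fun ε hε => ?_
    have hQd : ∀ n n', ∫ p, G.dv (f n - f n') p ^ 2 ∂G.edgeMeasure ≤ 4 * Q := by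
      intro n n'
      set a : G.sobolev := ⟨f n, hf n⟩
      set b : G.sobolev := ⟨f n', hf n'⟩
      have h0 := energyForm_self_nonneg (a + b)
      have ha : G.energyForm a a ≤ Q := hQ n
      have hb : G.energyForm b b ≤ Q := hQ n'
      have hab : ∫ p, G.dv (f n - f n') p ^ 2 ∂G.edgeMeasure = G.energyForm (a - b) (a - b) := by
        simp only [sq]; rfl
      rw [hab]
      simp only [map_add, map_sub, LinearMap.add_apply, LinearMap.sub_apply] at h0 ⊢
      linarith
    have hlim : Tendsto (fun N => 2 * (G.meshError N * √(4 * Q))) atTop (nhds 0) := by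
      simpa using ((tendsto_meshError G hsum).mul_const (√(4 * Q))).const_mul 2
    obtain ⟨N, hN, hne⟩ := ((hlim.eventually_lt_const (show 0 < ε / 4 by positivity)).and
      eventually_atoms_nonempty).exists
    have hev : ∀ᶠ n in (W : Filter ι), ∀ i ∈ G.atoms N,
        |f n (G.node N i) - g (G.node N i)| < ε / 8 :=
      (Filter.eventually_all_finset _).2 fun i _ =>
        Metric.tendsto_nhds.1 (hg _) (ε / 8) (by positivity)
    filter_upwards [hev] with n hn x
    rw [dist_comm]
    have h1 : ∀ᶠ n' in (W : Filter ι), |f n x - f n' x| ≤ ε / 2 := by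
      filter_upwards [hev] with n' hn'
      have := abs_le_of_forall_node hsum ((G.sobolev).sub_mem (hf n) (hf n')) hne (M := ε / 4)
        (fun i hi => by
          have e1 := abs_sub_lt_iff.1 (hn i hi)
          have e2 := abs_sub_lt_iff.1 (hn' i hi)
          rw [Pi.sub_apply, abs_le]
          constructor <;> linarith [e1.1, e1.2, e2.1, e2.2]) x
      have h3 : G.meshError N * √(∫ p, G.dv (f n - f n') p ^ 2 ∂G.edgeMeasure) ≤
          G.meshError N * √(4 * Q) :=
        mul_le_mul_of_nonneg_left (Real.sqrt_le_sqrt (hQd n n')) (meshError_nonneg N)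
      rw [Pi.sub_apply] at this
      linarith
    have h2 : |f n x - g x| ≤ ε / 2 := le_of_tendsto ((hg x).const_sub _).abs h1
    exact h2.trans_lt (by linarith)
  exact ⟨g, hu.continuous (Frequently.of_forall fun n => (hf n).1), hu⟩

theorem tendsto_integral_mul {ι : Type*} {W : Filter ι} {f f' : ι → X → ℝ} {g g' : X → ℝ} {B : ℝ}
    (hf : ∀ n, Continuous (f n)) (hf' : ∀ n, Continuous (f' n)) (hg : Continuous g)
    (hg' : Continuous g') (hB : ∀ n x, |f n x| ≤ B) (hBg' : ∀ x, |g' x| ≤ B)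
    (hBf' : ∀ n x, |f' n x| ≤ B) (hBg : ∀ x, |g x| ≤ B)
    (hu : TendstoUniformly f g W) (hu' : TendstoUniformly f' g' W) :
    Tendsto (fun n => ∫ p, f n (G.point p) * f' n (G.point p) ∂G.edgeMeasure) W
      (nhds (∫ p, g (G.point p) * g' (G.point p) ∂G.edgeMeasure)) := by
  have h_int : ∀ {u v : X → ℝ}, Continuous u → Continuous v → (∀ x, |u x| ≤ B) → (∀ x, |v x| ≤ B) →
      Integrable (fun p => u (G.point p) * v (G.point p)) G.edgeMeasure := by
    intro u v hu hv hBu hBv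
    refine Integrable.of_bound ((G.measurable_comp_point hu).mul
      (G.measurable_comp_point hv)).aestronglyMeasurable (B * B) (Eventually.of_forall fun p => ?_)
    rw [norm_mul]
    exact mul_le_mul (hBu _) (hBv _) (norm_nonneg _) ((abs_nonneg _).trans (hBu (G.point p)))
  refine Metric.tendsto_nhds.2 fun ε hε => ?_
  have hB0 : 0 ≤ B := by
    obtain ⟨x₀⟩ : Nonempty X := inferInstance
    exact (abs_nonneg _).trans (hBg x₀)
  set ℓ := G.edgeMeasure.real univ
  have hℓ : 0 ≤ ℓ := measureReal_nonneg
  set δ := ε / (2 * B * ℓ + 1) with hδ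
  have hδ0 : 0 < δ := by positivity
  filter_upwards [Metric.tendstoUniformly_iff.1 hu δ hδ0, Metric.tendstoUniformly_iff.1 hu' δ hδ0]
    with n h1 h2
  rw [Real.dist_eq, ← integral_sub (h_int (hf n) (hf' n) (hB n) (hBf' n)) (h_int hg hg' hBg hBg')]
  have h3 := norm_integral_le_of_norm_le_const (μ := G.edgeMeasure) (C := 2 * B * δ)
    (f := fun p => f n (G.point p) * f' n (G.point p) - g (G.point p) * g' (G.point p))
    (Eventually.of_forall fun p => by
      have e1 := h1 (G.point p)
      have e2 := h2 (G.point p)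
      rw [Real.dist_eq, abs_sub_comm] at e1 e2
      have : f n (G.point p) * f' n (G.point p) - g (G.point p) * g' (G.point p) =
        f n (G.point p) * (f' n (G.point p) - g' (G.point p)) +
        (f n (G.point p) - g (G.point p)) * g' (G.point p) := by ring
      rw [this]
      refine (norm_add_le _ _).trans ?_
      rw [norm_mul, norm_mul]
      have a1 := mul_le_mul (hB n (G.point p)) e2.le (abs_nonneg _) hB0
      have a2 := mul_le_mul e1.le (hBg' (G.point p)) (abs_nonneg _) hδ0.le
      simp only [Real.norm_eq_abs]
      linarith)
  refine h3.trans_lt ?_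
  have h4 : δ * (2 * B * ℓ + 1) = ε := div_mul_cancel₀ _ (by positivity)
  change 2 * B * δ * ℓ < ε
  nlinarith

end sobolev

end MetricGraphOn

namespace MetricGraphOn

variable {X : Type} [MetricSpace X] {G : MetricGraphOn X}
  [IsFiniteMeasure G.edgeMeasure] [ConnectedSpace X]

/-- The Sobolev space of a metric graph is infinite dimensional. -/
theorem exists_linearIndependent_sobolev (k : ℕ) :
    ∃ ψ : Fin k → G.sobolev, LinearIndependent ℝ ψ := by
  obtain ⟨x₀⟩ : Nonempty X := inferInstance
  set w : X → ℝ := fun x => dist x₀ x with hw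
  have hwc : Continuous w := continuous_const.dist continuous_id
  have hlip : ∀ e, ∀ s ∈ Icc 0 (G.len e), ∀ t ∈ Icc 0 (G.len e),
      |w (G.edgeMap e s) - w (G.edgeMap e t)| ≤ |s - t| := fun e s hs t ht => by
    refine le_trans ?_ (G.dist_le e s hs t ht)
    rw [hw]
    simp only [dist_comm x₀]
    exact abs_dist_sub_le _ _ _
  have hws : w ∈ G.sobolev :=
    (sobolev.of_lipschitz (K := 1) hwc fun e s hs t ht => by simpa using hlip e s hs t ht).1
  obtain ⟨B, hB⟩ := sobolev.exists_bound hws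
  have hpow : ∀ i : ℕ, (fun x => w x ^ i) ∈ G.sobolev := fun i =>
    (sobolev.of_lipschitz (K := i * B ^ (i - 1)) (hwc.pow i) fun e s hs t ht => by
      refine (abs_pow_sub_pow_le _ _ i).trans ?_
      have h1 := hlip e s hs t ht
      have h2 : max |w (G.edgeMap e s)| |w (G.edgeMap e t)| ^ (i - 1) ≤ B ^ (i - 1) :=
        pow_le_pow_left₀ (le_max_of_le_left (abs_nonneg _)) (max_le (hB _) (hB _)) _
      calc _ ≤ |s - t| * i * B ^ (i - 1) := by gcongr
        _ = _ := by ring).1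
  have hinf : (range w).Infinite := by
    obtain ⟨e, -⟩ := G.exists_point x₀
    have hne : ∃ y, y ≠ x₀ := by
      by_contra! h
      have h1 := G.edgeMap_injOn e (left_mem_Ico.2 (G.len_pos e))
        (show G.len e / 2 ∈ Ico 0 (G.len e) from
          ⟨by linarith [G.len_pos e], by linarith [G.len_pos e]⟩)
        ((h _).trans (h _).symm)
      linarith [G.len_pos e]
    obtain ⟨y, hy⟩ := hne
    have h0 : 0 < w y := dist_pos.2 hy.symm
    refine (Icc_infinite h0).mono ?_
    have := intermediate_value_univ x₀ y hwc
    rwa [show w x₀ = 0 from dist_self x₀] at this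
  refine ⟨fun i => ⟨_, hpow i⟩, Fintype.linearIndependent_iff.2 fun c hc => ?_⟩
  set P : Polynomial ℝ := ∑ i : Fin k, Polynomial.monomial (i : ℕ) (c i) with hP
  have hP0 : P = 0 := by
    refine Polynomial.eq_zero_of_infinite_isRoot P (hinf.mono ?_)
    rintro _ ⟨x, rfl⟩
    have := congrFun (congrArg Subtype.val hc) x
    simp only [Submodule.coe_sum, Finset.sum_apply, Submodule.coe_smul, Pi.smul_apply,
      smul_eq_mul] at this
    show P.eval (w x) = 0
    rw [hP, Polynomial.eval_finsetSum]
    simp only [Polynomial.eval_monomial]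
    exact this
  intro i
  have := congrArg (fun Q => Q.coeff (i : ℕ)) hP0
  simpa [hP, Polynomial.finsetSum_coeff, Polynomial.coeff_monomial, Fin.val_inj] using this

theorem rayleighBounds_bddBelow {k : ℕ} (hk : 0 < k) : BddBelow (G.rayleighBounds k) :=
  ⟨0, fun _ => rayleighBounds_nonneg hk⟩

/-- The infimum defining the eigenvalues is attained. -/
theorem neumannEigen_mem_rayleighBounds (hsum : Summable G.len) {k : ℕ} (hk : 0 < k) :
    G.neumannEigen k ∈ G.rayleighBounds k := by
  obtain ⟨_, hψ⟩ := exists_linearIndependent_sobolev (G := G) k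
  have hne := rayleighBounds_nonempty hψ
  rw [neumannEigen_eq]
  set m := sInf (G.rayleighBounds k) with hm
  have hm0 : 0 ≤ m := le_csInf hne fun _ => rayleighBounds_nonneg hk
  have hex : ∀ n : ℕ, ∃ φ : Fin k → G.sobolev,
      (∀ i j, G.massForm (φ i) (φ j) = if i = j then 1 else 0) ∧
      ∀ c : Fin k → ℝ, G.energyForm (∑ i, c i • φ i) (∑ i, c i • φ i) ≤
        (m + 1 / ((n : ℝ) + 1)) * ∑ i, c i ^ 2 := by
    intro n
    obtain ⟨μ, ⟨V, _, hd, hV⟩, hμ⟩ := exists_lt_of_csInf_lt hne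
      (show m < m + 1 / ((n : ℝ) + 1) from lt_add_of_pos_right _ (by positivity))
    obtain ⟨φ, hφV, hφ⟩ := LinearMap.BilinForm.exists_orthonormal_family massForm_comm
      (fun _ => massForm_self_pos) hd
    refine ⟨φ, hφ, fun c => ?_⟩
    refine (hV _ (V.sum_mem fun i _ => V.smul_mem _ (hφV i))).trans ?_
    rw [LinearMap.BilinForm.sum_smul_self_of_orthonormal hφ]
    exact mul_le_mul_of_nonneg_right hμ.le (Finset.sum_nonneg fun i _ => sq_nonneg _)
  choose φ hφ hφQ using hex
  have hle1 : ∀ n : ℕ, 1 / ((n : ℝ) + 1) ≤ 1 := fun n =>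
    div_le_one_of_le₀ (by linarith [n.cast_nonneg (α := ℝ)]) (by positivity)
  have hQ1 : ∀ n i, G.energyForm (φ n i) (φ n i) ≤ m + 1 := by
    intro n i
    have h := hφQ n (Pi.single i 1)
    simp only [Pi.single_apply, ite_smul, one_smul, zero_smul, Finset.sum_ite_eq',
      Finset.mem_univ, if_true, ite_pow, one_pow, ne_eq, OfNat.ofNat_ne_zero, not_false_eq_true,
      zero_pow, mul_one] at h
    linarith [hle1 n]
  set ℓ := G.edgeMeasure.real univ
  set B := √(ℓ * 1) / ℓ + √(ℓ * (m + 1))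
  have hB : ∀ n i x, |(φ n i).1 x| ≤ B := fun n i x =>
    sobolev.abs_mul_le (φ n i).2 ((hφ n i i).trans (if_pos rfl)).le (hQ1 n i) x
  set W : Ultrafilter ℕ := Ultrafilter.of atTop
  choose ψ hψc hψu using fun i => sobolev.exists_uniform_limit hsum W (fun n => (φ n i).2)
    (fun n x => hB n i x) (fun n => hQ1 n i)
  have hψB : ∀ i x, |ψ i x| ≤ B := fun i x =>
    le_of_tendsto' ((hψu i).tendsto_at x).abs fun n => hB n i x
  have hψM : ∀ i j, ∫ p, ψ i (G.point p) * ψ j (G.point p) ∂G.edgeMeasure =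
      if i = j then 1 else 0 := fun i j =>
    tendsto_nhds_unique (sobolev.tendsto_integral_mul (fun n => (φ n i).2.1)
      (fun n => (φ n j).2.1) (hψc i) (hψc j) (fun n x => hB n i x) (hψB j)
      (fun n x => hB n j x) (hψB i) (hψu i) (hψu j))
      (tendsto_const_nhds.congr fun n => (hφ n i j).symm)
  have hcomb : ∀ c : Fin k → ℝ, (∑ i, c i • ψ i) ∈ G.sobolev ∧
      ∫ p, G.dv (∑ i, c i • ψ i) p * G.dv (∑ i, c i • ψ i) p ∂G.edgeMeasure ≤
        m * ∑ i, c i ^ 2 := by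
    intro c
    have hc0 : 0 ≤ ∑ i, c i ^ 2 := Finset.sum_nonneg fun i _ => sq_nonneg _
    refine sobolev.of_tendsto W (fun n => (∑ i, c i • φ n i : G.sobolev).2)
      (c := fun n : ℕ => (m + 1 / ((n : ℝ) + 1)) * ∑ i, c i ^ 2)
      (B := (m + 1) * ∑ i, c i ^ 2) ?_ (fun x => ?_) (fun n => hφQ n c)
      (fun n => mul_le_mul_of_nonneg_right (by linarith [hle1 n]) hc0) ?_
    · have : (∑ i, c i • ψ i) = fun x => ∑ i, c i * ψ i x := by ext x; simp
      rw [this]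
      exact continuous_finsetSum _ fun i _ => continuous_const.mul (hψc i)
    · simp only [Submodule.coe_sum, Submodule.coe_smul, Finset.sum_apply, Pi.smul_apply,
        smul_eq_mul]
      exact tendsto_finsetSum _ fun i _ => ((hψu i).tendsto_at x).const_mul (c i)
    · have := ((tendsto_one_div_add_atTop_nhds_zero_nat (𝕜 := ℝ)).const_add m).mul_const
        (∑ i, c i ^ 2)
      rw [add_zero] at this
      exact this.mono_left (Ultrafilter.of_le _)
  have hψs : ∀ i, ψ i ∈ G.sobolev := fun i => by
    have := (hcomb (Pi.single i 1)).1
    simpa [Pi.single_apply, ite_smul] using this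
  let Ψ : Fin k → G.sobolev := fun i => ⟨ψ i, hψs i⟩
  have hΨ : ∀ i j, G.massForm (Ψ i) (Ψ j) = if i = j then 1 else 0 := hψM
  have hfin : FiniteDimensional ℝ (Submodule.span ℝ (range Ψ)) :=
    FiniteDimensional.span_of_finite ℝ (finite_range Ψ)
  refine ⟨_, hfin, ?_, fun f hf => ?_⟩
  · rw [finrank_span_eq_card (LinearMap.BilinForm.linearIndependent_of_orthonormal hΨ),
      Fintype.card_fin]
  · obtain ⟨c, rfl⟩ := (Submodule.mem_span_range_iff_exists_fun ℝ).1 hf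
    rw [LinearMap.BilinForm.sum_smul_self_of_orthonormal hΨ]
    have := (hcomb c).2
    have hval : (∑ i, c i • Ψ i : G.sobolev).1 = ∑ i, c i • ψ i := by simp [Ψ]
    rw [energyForm_apply, hval]
    exact this

/-- The lower bound for the eigenvalues, and the disjoint family obtained when it is attained. -/
theorem le_neumannEigen (hsum : Summable G.len) {L ω : ℝ} (hL : L = ∑' e, G.len e)
    (hL0 : 0 < L) {m : ℕ} (hω : ω = Real.pi * (m + 2) / (2 * L)) :
    ω ^ 2 ≤ G.neumannEigen (m + 2) ∧ (G.neumannEigen (m + 2) = ω ^ 2 →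
      ∃ f : Fin (m + 2) → X → ℝ,
        (∀ i, f i ∈ G.sobolev ∧ (∀ x, 0 ≤ f i x) ∧ (∃ x, 0 < f i x) ∧
          ∫ p, G.dv (f i) p * G.dv (f i) p ∂G.edgeMeasure ≤
            ω ^ 2 * ∫ p, f i (G.point p) * f i (G.point p) ∂G.edgeMeasure) ∧
        ∀ i j, i ≠ j → ∀ x, f i x = 0 ∨ f j x = 0) := by
  obtain ⟨V, _, hd, hV⟩ := neumannEigen_mem_rayleighBounds hsum (G := G) (Nat.succ_pos (m + 1))
  refine ⟨?_, fun h => ?_⟩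
  · by_contra! hlt
    obtain ⟨f, hfV, hf0, hf⟩ := (exists_disjoint_of_submodule hsum hL hL0 hω hd.ge fun f hf =>
      (hV f hf).trans (mul_le_mul_of_nonneg_right hlt.le
        (integral_nonneg fun _ => mul_self_nonneg _))).1
    have h1 := hV f hfV
    have h2 := massForm_self_pos hf0
    rw [energyForm_apply] at h1
    rw [massForm_apply] at h1 h2
    nlinarith
  · exact (exists_disjoint_of_submodule hsum hL hL0 hω hd.ge fun f hf => by
      rw [← h]; exact hV f hf).2

end MetricGraphOn

theorem LipschitzOnWith.volume_image_le {φ : ℝ → ℝ} {T : Set ℝ} (h : LipschitzOnWith 1 φ T) :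
    volume (φ '' T) ≤ volume T := by
  have := h.hausdorffMeasure_image_le (d := 1) zero_le_one
  simpa [hausdorffMeasure_real] using this

namespace MetricGraphOn

variable {X : Type} [MetricSpace X] (G : MetricGraphOn X)

/-- The function is `1`-Lipschitz along every edge. -/
def EdgeLip (f : X → ℝ) : Prop :=
  ∀ e, ∀ s ∈ Icc 0 (G.len e), ∀ t ∈ Icc 0 (G.len e),
    |f (G.edgeMap e s) - f (G.edgeMap e t)| ≤ |s - t|

variable {G}

theorem EdgeLip.abs_sub_le_dist {u : X → ℝ} (hu : Continuous u) (hl : G.EdgeLip u) (x y : X) :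
    |u x - u y| ≤ dist x y :=
  abs_sub_le_iff.2 ⟨G.dist_ge u hu hl x y, dist_comm x y ▸ G.dist_ge u hu hl y x⟩

theorem edgeLip_of_abs_sub_le_dist {u : X → ℝ} (hu : ∀ x y, |u x - u y| ≤ dist x y) :
    G.EdgeLip u := fun e s hs t ht => (hu _ _).trans (G.dist_le e s hs t ht)

theorem EdgeLip.volume_inter_image_le {r : X → ℝ} (hr : Continuous r) (hl : G.EdgeLip r)
    {A : Set ℝ} (hA : MeasurableSet A) (e : G.E) {J : Set ℝ} (hJ : MeasurableSet J)
    (hJe : J ⊆ Icc 0 (G.len e)) :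
    volume (A ∩ (fun t => r (G.edgeMap e t)) '' J) ≤
      G.edgeMeasure ({p | r (G.point p) ∈ A} ∩ {e} ×ˢ J) := by
  have hT : MeasurableSet ((fun t => r (G.point (e, t))) ⁻¹' A ∩ J) :=
    ((hr.comp (G.continuous_point e)).measurable hA).inter hJ
  have h1 : A ∩ (fun t => r (G.edgeMap e t)) '' J ⊆
      (fun t => r (G.edgeMap e t)) '' ((fun t => r (G.point (e, t))) ⁻¹' A ∩ J) := by
    rintro _ ⟨ha, t, ht, rfl⟩
    refine ⟨t, ⟨?_, ht⟩, rfl⟩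
    rw [mem_preimage, G.point_eq (hJe ht)]
    exact ha
  have h2 : LipschitzOnWith 1 (fun t => r (G.edgeMap e t))
      ((fun t => r (G.point (e, t))) ⁻¹' A ∩ J) :=
    LipschitzOnWith.of_dist_le_mul fun s hs t ht => by
      simpa [Real.dist_eq] using hl e s (hJe hs.2) t (hJe ht.2)
  refine (measure_mono h1).trans (h2.volume_image_le.trans ?_)
  have h3 : {e} ×ˢ ((fun t => r (G.point (e, t))) ⁻¹' A ∩ J) ⊆
      {p | r (G.point p) ∈ A} ∩ {e} ×ˢ J := by
    rintro ⟨e', t⟩ ⟨he, ht⟩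
    obtain rfl : e' = e := he
    exact ⟨ht.1, rfl, ht.2⟩
  refine le_trans ?_ (measure_mono h3)
  rw [G.edgeMeasure_prod e hT]
  have h4 : volume (((fun t => r (G.point (e, t))) ⁻¹' A ∩ J) \
      ((fun t => r (G.point (e, t))) ⁻¹' A ∩ J ∩ Ioo 0 (G.len e))) = 0 := ?_
  · exact measure_mono_ae (ae_le_set.2 h4)
  refine measure_mono_null (t := {0, G.len e}) (fun t ht => ?_) ((toFinite _).measure_zero _)
  by_contra hn
  simp only [mem_insert_iff, mem_singleton_iff, not_or] at hn
  have := hJe ht.1.2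
  exact ht.2 ⟨ht.1, this.1.lt_of_ne' hn.1, this.2.lt_of_ne hn.2⟩

theorem EdgeLip.volume_le_of_subset_range {r : X → ℝ} (hr : Continuous r) (hl : G.EdgeLip r)
    {A : Set ℝ} (hA : MeasurableSet A) (hAr : A ⊆ range r) :
    volume A ≤ G.edgeMeasure {p | r (G.point p) ∈ A} := by
  have hB : MeasurableSet {p | r (G.point p) ∈ A} := G.measurable_comp_point hr hA
  have h1 : A ⊆ ⋃ e, A ∩ (fun t => r (G.edgeMap e t)) '' Icc 0 (G.len e) := by
    intro s hs
    obtain ⟨x, rfl⟩ := hAr hs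
    obtain ⟨e, t, ht, rfl⟩ := G.cover x
    exact mem_iUnion.2 ⟨e, hs, t, ht, rfl⟩
  refine (measure_mono h1).trans ((measure_iUnion_le _).trans ?_)
  have h2 : ∑' e, G.edgeMeasure ({p | r (G.point p) ∈ A} ∩ {e} ×ˢ univ) =
      G.edgeMeasure {p | r (G.point p) ∈ A} := by
    rw [← measure_iUnion]
    · rw [← inter_iUnion]
      congr 1
      refine inter_eq_left.2 fun p _ => mem_iUnion.2 ⟨p.1, rfl, trivial⟩
    · intro e e' h
      exact Set.disjoint_left.2 fun p hp hp' => h (hp.2.1.symm.trans hp'.2.1)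
    · exact fun e => hB.inter ((MeasurableSet.singleton e).prod MeasurableSet.univ)
  rw [← h2]
  refine ENNReal.tsum_le_tsum fun e => ?_
  refine (hl.volume_inter_image_le hr hA e measurableSet_Icc subset_rfl).trans (measure_mono ?_)
  exact inter_subset_inter_right _ (prod_mono_right (subset_univ _))

variable (G) in
/-- Distance functions along `k` disjoint arms of length `a`. -/
structure IsArms (k : ℕ) (a : ℝ) (r : Fin k → X → ℝ) : Prop where
  continuous : ∀ i, Continuous (r i)
  edgeLip : ∀ i, G.EdgeLip (r i)
  nonneg : ∀ i x, 0 ≤ r i x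
  le : ∀ i x, r i x ≤ a
  eq_zero : ∀ i j, i ≠ j → ∀ x, r i x = 0 ∨ r j x = 0
  subset_range : ∀ i, Ioo 0 a ⊆ range (r i)
  measure_univ : G.edgeMeasure univ = ENNReal.ofReal (k * a)

namespace IsArms

variable {k : ℕ} {a : ℝ} {r : Fin k → X → ℝ} (H : G.IsArms k a r)

include H

theorem measurableSet (i : Fin k) {A : Set ℝ} (hA : MeasurableSet A) :
    MeasurableSet {p | r i (G.point p) ∈ A} := G.measurable_comp_point (H.continuous i) hA

theorem isFiniteMeasure : IsFiniteMeasure G.edgeMeasure :=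
  ⟨by rw [H.measure_univ]; exact ENNReal.ofReal_lt_top⟩

theorem measureReal_Ioo (ha : 0 ≤ a) :
    (∀ i, G.edgeMeasure.real {p | r i (G.point p) ∈ Ioo 0 a} = a) ∧
      ∀ᵐ p ∂G.edgeMeasure, ∃ i, r i (G.point p) ∈ Ioo 0 a := by
  have := H.isFiniteMeasure
  have h1 : ∀ i, a ≤ G.edgeMeasure.real {p | r i (G.point p) ∈ Ioo 0 a} := fun i => by
    have := (H.edgeLip i).volume_le_of_subset_range (H.continuous i) measurableSet_Ioo
      (H.subset_range i)
    rw [Real.volume_Ioo, sub_zero] at this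
    exact (ENNReal.ofReal_le_iff_le_toReal (measure_ne_top _ _)).1 this
  have hu : G.edgeMeasure.real univ = k * a := by
    rw [Measure.real, H.measure_univ, ENNReal.toReal_ofReal (by positivity)]
  have hdis : Pairwise (Function.onFun Disjoint fun i => {p | r i (G.point p) ∈ Ioo 0 a}) := by
    intro i j hij
    refine Set.disjoint_left.2 fun p hp hp' => ?_
    rcases H.eq_zero i j hij (G.point p) with h | h
    · exact hp.1.ne' h
    · exact hp'.1.ne' h
  have h2 : G.edgeMeasure.real (⋃ i, {p | r i (G.point p) ∈ Ioo 0 a}) =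
      ∑ i, G.edgeMeasure.real {p | r i (G.point p) ∈ Ioo 0 a} :=
    measureReal_iUnion_fintype hdis fun i => H.measurableSet i measurableSet_Ioo
  have h3 : G.edgeMeasure.real (⋃ i, {p | r i (G.point p) ∈ Ioo 0 a}) ≤ k * a :=
    hu ▸ measureReal_mono (subset_univ _)
  have hk : ∑ _i : Fin k, a = k * a := by simp
  have h4 : ∑ _i : Fin k, a = ∑ i, G.edgeMeasure.real {p | r i (G.point p) ∈ Ioo 0 a} :=
    le_antisymm (Finset.sum_le_sum fun i _ => h1 i) (by rw [← h2, hk]; exact h3)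
  refine ⟨fun i => ((Finset.sum_eq_sum_iff_of_le fun i _ => h1 i).1 h4 i
    (Finset.mem_univ i)).symm, ?_⟩
  have hm : MeasurableSet (⋃ i, {p | r i (G.point p) ∈ Ioo 0 a}) :=
    MeasurableSet.iUnion fun i => H.measurableSet i measurableSet_Ioo
  have h5 : G.edgeMeasure.real (⋃ i, {p | r i (G.point p) ∈ Ioo 0 a})ᶜ = 0 := by
    rw [measureReal_compl hm, hu, h2, ← h4, hk, sub_self]
  rw [measureReal_eq_zero_iff] at h5
  filter_upwards [compl_mem_ae_iff.2 h5] with p hp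
  simpa using hp

/-- The arm coordinates push the length measure forward to Lebesgue measure. -/
theorem measure_eq (ha : 0 ≤ a) (i : Fin k) {A : Set ℝ} (hA : MeasurableSet A)
    (hAa : A ⊆ Ioo 0 a) : G.edgeMeasure {p | r i (G.point p) ∈ A} = volume A := by
  have := H.isFiniteMeasure
  have hfin : ∀ S ⊆ Ioo 0 a, volume S ≠ ∞ := fun S hS =>
    measure_ne_top_of_subset hS (by simp)
  have h1 : ∀ S ⊆ Ioo 0 a, MeasurableSet S →
      volume.real S ≤ G.edgeMeasure.real {p | r i (G.point p) ∈ S} := fun S hS hSm =>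
    ENNReal.toReal_mono (measure_ne_top _ _) ((H.edgeLip i).volume_le_of_subset_range
      (H.continuous i) hSm (hS.trans (H.subset_range i)))
  have h2 := h1 A hAa hA
  have h3 := h1 (Ioo 0 a \ A) sdiff_subset (measurableSet_Ioo.diff hA)
  have h4 : volume.real (Ioo 0 a \ A) = a - volume.real A := by
    rw [measureReal_sdiff hAa hA (hfin _ subset_rfl), Real.volume_real_Ioo_of_le ha, sub_zero]
  have h5 : G.edgeMeasure.real {p | r i (G.point p) ∈ Ioo 0 a \ A} =
      a - G.edgeMeasure.real {p | r i (G.point p) ∈ A} := by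
    have h : {p | r i (G.point p) ∈ A} ⊆ {p | r i (G.point p) ∈ Ioo 0 a} := fun p hp => hAa hp
    have := measureReal_sdiff (μ := G.edgeMeasure) h (H.measurableSet i hA)
    rwa [(H.measureReal_Ioo ha).1 i] at this
  have h6 : G.edgeMeasure.real {p | r i (G.point p) ∈ A} = volume.real A := by linarith
  exact (measureReal_eq_measureReal_iff (measure_ne_top _ _) (hfin A hAa)).1 h6

theorem measure_pos_le (ha : 0 ≤ a) (i : Fin k) {A : Set ℝ} (hA : MeasurableSet A) :
    G.edgeMeasure {p | 0 < r i (G.point p) ∧ r i (G.point p) ∈ A} ≤ volume A := by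
  refine le_trans (measure_mono_ae (t := {p | r i (G.point p) ∈ A ∩ Ioo 0 a}) ?_)
    ((H.measure_eq ha i (hA.inter measurableSet_Ioo) inter_subset_right).trans_le
      (measure_mono inter_subset_left))
  filter_upwards [(H.measureReal_Ioo ha).2] with p ⟨j, hj⟩ hp
  refine ⟨hp.2, ?_⟩
  rcases eq_or_ne i j with rfl | hij
  · exact hj
  · rcases H.eq_zero i j hij (G.point p) with h | h
    · exact absurd h hp.1.ne'
    · exact absurd h hj.1.ne'

end IsArms

end MetricGraphOn

namespace MetricGraphOn

variable {X : Type} [MetricSpace X] {G : MetricGraphOn X}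

theorem EdgeLip.abs_sub_le_measureReal {u : X → ℝ} [IsFiniteMeasure G.edgeMeasure]
    [ConnectedSpace X] (hu : Continuous u) (hl : G.EdgeLip u) {S : Set (G.E × ℝ)}
    (hS : MeasurableSet S)
    (h : ∀ᵐ p ∂G.edgeMeasure, p ∉ S → G.dv u p = 0) (x y : X) :
    |u x - u y| ≤ G.edgeMeasure.real S := by
  obtain ⟨hm, hd⟩ := sobolev.of_lipschitz (G := G) (K := 1) hu
    (fun e s hs t ht => by simpa using hl e s hs t ht)
  refine (sobolev.abs_sub_le hm x y).trans ?_
  rw [← integral_indicator_one hS]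
  refine integral_mono_ae (sobolev.integrable_dv hm).abs
    ((integrable_const 1).indicator hS) ?_
  filter_upwards [hd, h] with p h1 h2
  by_cases hp : p ∈ S
  · simpa [hp] using h1
  · simp [hp, h2 hp]

/-- Replacing `u` by a constant beyond a one-point level set of `r`. -/
theorem EdgeLip.exists_clamp {u r : X → ℝ} (hu : Continuous u) (hl : G.EdgeLip u)
    (hr : Continuous r) {c : ℝ} {z : X} (hz : ∀ x, r x = c → x = z)
    (hc : ∀ᵐ p ∂G.edgeMeasure, r (G.point p) ≠ c) {S : Set (G.E × ℝ)}
    (h : ∀ᵐ p ∂G.edgeMeasure, p ∉ S → G.dv u p = 0) :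
    ∃ v : X → ℝ, Continuous v ∧ G.EdgeLip v ∧
      (∀ᵐ p ∂G.edgeMeasure, p ∉ S ∩ {p | r (G.point p) ≤ c} → G.dv v p = 0) ∧
      ∀ x, r x ≤ c → v x = u x := by
  refine ⟨fun x => if r x ≤ c then u x else u z, ?_, ?_, ?_, fun x hx => if_pos hx⟩
  · exact Continuous.if_le hu continuous_const hr continuous_const fun x hx => by rw [hz x hx]
  · have key : ∀ e, ∀ s ∈ Icc 0 (G.len e), ∀ t ∈ Icc 0 (G.len e), r (G.edgeMap e s) ≤ c →
        ¬ r (G.edgeMap e t) ≤ c → |u (G.edgeMap e s) - u z| ≤ |s - t| := by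
      intro e s hs t ht h1 h2
      have hst : uIcc s t ⊆ Icc 0 (G.len e) := ordConnected_Icc.uIcc_subset hs ht
      obtain ⟨τ, hτ, hτc⟩ := intermediate_value_uIcc
        ((hr.comp_continuousOn (G.edgeMap_cont e)).mono hst)
        (mem_uIcc_of_le h1 (not_le.1 h2).le)
      rw [← hz _ hτc]
      refine (hl e s hs τ (hst hτ)).trans ?_
      rw [abs_sub_comm, abs_sub_comm s t]
      exact abs_sub_left_of_mem_uIcc hτ
    intro e s hs t ht
    by_cases h1 : r (G.edgeMap e s) ≤ c <;> by_cases h2 : r (G.edgeMap e t) ≤ c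
    · simpa [h1, h2] using hl e s hs t ht
    · simpa [h1, h2] using key e s hs t ht h1 h2
    · simpa [h1, h2, abs_sub_comm] using key e t ht s hs h2 h1
    · simp [h1, h2]
  · filter_upwards [hc, h, G.ae_mem_Ioo] with p hp1 hp2 hp3 hp4
    have hpt : G.point p = G.edgeMap p.1 p.2 := G.point_eq (Ioo_subset_Icc_self hp3)
    have hcont : ContinuousAt (fun t => r (G.edgeMap p.1 t)) p.2 :=
      (hr.comp_continuousOn (G.edgeMap_cont p.1)).continuousAt (Icc_mem_nhds hp3.1 hp3.2)
    rw [hpt] at hp1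
    rcases lt_or_gt_of_ne hp1 with hlt | hlt
    · have : p ∉ S := fun hS => hp4 ⟨hS, by rw [mem_ofPred_eq, hpt]; exact hlt.le⟩
      rw [← hp2 this]
      refine Filter.EventuallyEq.deriv_eq ?_
      filter_upwards [hcont.eventually_lt_const hlt] with t ht
      simp [ht.le]
    · have : deriv (fun _ : ℝ => u z) p.2 = 0 := deriv_const _ _
      rw [← this]
      refine Filter.EventuallyEq.deriv_eq ?_
      filter_upwards [hcont.eventually_const_lt hlt] with t ht
      simp [not_le.2 ht]

theorem EdgeLip.sub_of_eq_zero {f g : X → ℝ} (hf : Continuous f) (hg : Continuous g)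
    (hlf : G.EdgeLip f) (hlg : G.EdgeLip g) (hf0 : ∀ x, 0 ≤ f x) (hg0 : ∀ x, 0 ≤ g x)
    (h : ∀ x, f x = 0 ∨ g x = 0) : G.EdgeLip (fun x => f x - g x) := by
  have key : ∀ f g : X → ℝ, Continuous f → Continuous g → G.EdgeLip f → G.EdgeLip g →
      (∀ x, 0 ≤ f x) → (∀ x, 0 ≤ g x) → (∀ x, f x = 0 ∨ g x = 0) → ∀ e, ∀ s ∈ Icc 0 (G.len e),
      ∀ t ∈ Icc 0 (G.len e), f (G.edgeMap e s) = 0 → g (G.edgeMap e t) = 0 →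
      f (G.edgeMap e t) + g (G.edgeMap e s) ≤ |s - t| := by
    intro f g hf hg hlf hlg hf0 hg0 h e s hs t ht h1 h2
    have hst : uIcc s t ⊆ Icc 0 (G.len e) := ordConnected_Icc.uIcc_subset hs ht
    obtain ⟨τ, hτ, hτc⟩ := intermediate_value_uIcc (a := s) (b := t)
      (f := fun τ => f (G.edgeMap e τ) - g (G.edgeMap e τ))
      (((hf.sub hg).comp_continuousOn (G.edgeMap_cont e)).mono hst)
      (mem_uIcc_of_le (by simpa [h1] using hg0 _) (by simpa [h2] using hf0 _) : (0 : ℝ) ∈ _)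
    have hz : f (G.edgeMap e τ) = 0 ∧ g (G.edgeMap e τ) = 0 := by
      simp only [sub_eq_zero] at hτc
      rcases h (G.edgeMap e τ) with h | h
      · exact ⟨h, by rw [← hτc, h]⟩
      · exact ⟨by rw [hτc, h], h⟩
    have h3 := hlf e t ht τ (hst hτ)
    have h4 := hlg e s hs τ (hst hτ)
    rw [hz.1, sub_zero, abs_of_nonneg (hf0 _)] at h3
    rw [hz.2, sub_zero, abs_of_nonneg (hg0 _)] at h4
    have h5 : |t - τ| + |s - τ| = |s - t| := by
      rcases mem_uIcc.1 hτ with ⟨a1, a2⟩ | ⟨a1, a2⟩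
      · rw [abs_of_nonneg (by linarith), abs_of_nonpos (by linarith), abs_of_nonpos (by linarith)]
        ring
      · rw [abs_of_nonpos (by linarith), abs_of_nonneg (by linarith), abs_of_nonneg (by linarith)]
        ring
    linarith
  intro e s hs t ht
  have lf := hlf e s hs t ht
  have lg := hlg e s hs t ht
  have hfs := hf0 (G.edgeMap e s)
  have hft := hf0 (G.edgeMap e t)
  have hgs := hg0 (G.edgeMap e s)
  have hgt := hg0 (G.edgeMap e t)
  rcases h (G.edgeMap e s) with h1 | h1 <;> rcases h (G.edgeMap e t) with h2 | h2
  · rw [abs_sub_comm] at lg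
    simpa [h1, h2, neg_add_eq_sub] using lg
  · have := key f g hf hg hlf hlg hf0 hg0 h e s hs t ht h1 h2
    rw [abs_sub_le_iff]
    constructor <;> linarith [abs_nonneg (s - t)]
  · have := key g f hg hf hlg hlf hg0 hf0 (fun x => (h x).symm) e s hs t ht h1 h2
    rw [abs_sub_le_iff]
    constructor <;> linarith [abs_nonneg (s - t)]
  · simpa [h1, h2] using lf

namespace IsArms

variable {k : ℕ} {a : ℝ} {r : Fin k → X → ℝ} (H : G.IsArms k a r)

include H

theorem volume_inter_image_eq_zero (ha : 0 ≤ a) (i : Fin k) {e e' : G.E} {J J' : Set ℝ}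
    (hJ : J.OrdConnected) (hJ' : J'.OrdConnected) (hJe : J ⊆ Icc 0 (G.len e))
    (hJe' : J' ⊆ Icc 0 (G.len e')) (hd : Disjoint ({e} ×ˢ J) ({e'} ×ˢ J')) :
    volume (Ioo 0 a ∩ ((fun t => r i (G.edgeMap e t)) '' J ∩
      (fun t => r i (G.edgeMap e' t)) '' J')) = 0 := by
  have hm : ∀ {e : G.E} {J : Set ℝ}, J.OrdConnected → J ⊆ Icc 0 (G.len e) →
      MeasurableSet ((fun t => r i (G.edgeMap e t)) '' J) := fun {e J} hJ hJe =>
    ((hJ.isPreconnected.image _ ((H.continuous i).comp_continuousOn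
      ((G.edgeMap_cont e).mono hJe))).ordConnected).measurableSet
  have hA := (measurableSet_Ioo (a := (0 : ℝ)) (b := a)).inter ((hm hJ hJe).inter (hm hJ' hJe'))
  set A := Ioo 0 a ∩ ((fun t => r i (G.edgeMap e t)) '' J ∩
      (fun t => r i (G.edgeMap e' t)) '' J') with hAdef
  have h1 := (H.edgeLip i).volume_inter_image_le (H.continuous i) hA e hJ.measurableSet hJe
  have h2 := (H.edgeLip i).volume_inter_image_le (H.continuous i) hA e' hJ'.measurableSet hJe'
  rw [inter_eq_left.2 (fun s hs => hs.2.1)] at h1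
  rw [inter_eq_left.2 (fun s hs => hs.2.2)] at h2
  have h3 : G.edgeMeasure ({p | r i (G.point p) ∈ A} ∩ {e} ×ˢ J) +
      G.edgeMeasure ({p | r i (G.point p) ∈ A} ∩ {e'} ×ˢ J') ≤ volume A := by
    rw [← H.measure_eq ha i hA inter_subset_left, ← measure_union
      (hd.mono inter_subset_right inter_subset_right)
      ((H.measurableSet i hA).inter ((MeasurableSet.singleton _).prod hJ'.measurableSet))]
    exact measure_mono (union_subset inter_subset_left inter_subset_left)
  have hfin : volume A ≠ ∞ := measure_ne_top_of_subset inter_subset_left (by simp)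
  have h4 : volume A + volume A ≤ volume A + 0 := by
    rw [add_zero]
    exact (add_le_add h1 h2).trans h3
  exact nonpos_iff_eq_zero.1 (ENNReal.le_of_add_le_add_left hfin h4)

theorem ae_unique (ha : 0 ≤ a) (i : Fin k) :
    ∀ᵐ s, s ∈ Ioo 0 a → ∀ x y, r i x = s → r i y = s → x = y := by
  have := G.countableE
  have := G.countableV
  have h1 : ∀ᵐ s, ∀ e e', e ≠ e' → s ∉ Ioo 0 a ∩
      ((fun t => r i (G.edgeMap e t)) '' Icc 0 (G.len e) ∩
      (fun t => r i (G.edgeMap e' t)) '' Icc 0 (G.len e')) := by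
    refine ae_all_iff.2 fun e => ae_all_iff.2 fun e' => ae_all_iff.2 fun hne => ?_
    refine measure_eq_zero_iff_ae_notMem.1 (H.volume_inter_image_eq_zero ha i ordConnected_Icc
      ordConnected_Icc subset_rfl subset_rfl ?_)
    exact Set.disjoint_left.2 fun p hp hp' => hne (hp.1.symm.trans hp'.1)
  have h2 : ∀ᵐ s, ∀ (e : G.E) (q : ℚ), s ∉ Ioo 0 a ∩
      ((fun t => r i (G.edgeMap e t)) '' (Icc 0 (G.len e) ∩ Iio (q : ℝ)) ∩
      (fun t => r i (G.edgeMap e t)) '' (Icc 0 (G.len e) ∩ Ioi (q : ℝ))) := by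
    refine ae_all_iff.2 fun e => ae_all_iff.2 fun q => ?_
    refine measure_eq_zero_iff_ae_notMem.1 (H.volume_inter_image_eq_zero ha i
      (ordConnected_Icc.inter ordConnected_Iio)
      (ordConnected_Icc.inter ordConnected_Ioi) inter_subset_left inter_subset_left ?_)
    exact Set.disjoint_left.2 fun p hp hp' => lt_asymm (mem_Iio.1 hp.2.2) (mem_Ioi.1 hp'.2.2)
  filter_upwards [h1, h2] with s h1 h2 hs x y hx hy
  obtain ⟨e, t, ht, rfl⟩ := G.cover x
  obtain ⟨e', t', ht', rfl⟩ := G.cover y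
  obtain rfl : e = e' := by
    by_contra hne
    exact h1 e e' hne ⟨hs, ⟨t, ht, hx⟩, ⟨t', ht', hy⟩⟩
  have key : ∀ t ∈ Icc 0 (G.len e), ∀ t' ∈ Icc 0 (G.len e), r i (G.edgeMap e t) = s →
      r i (G.edgeMap e t') = s → ¬ t < t' := by
    intro t ht t' ht' hx hy hlt
    obtain ⟨q, hq1, hq2⟩ := exists_rat_btwn hlt
    exact h2 e q ⟨hs, ⟨t, ⟨ht, hq1⟩, hx⟩, ⟨t', ⟨ht', hq2⟩, hy⟩⟩
  rw [le_antisymm (not_lt.1 (key t' ht' t ht hy hx)) (not_lt.1 (key t ht t' ht' hx hy))]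

theorem exists_unique_level (i : Fin k) {b c : ℝ} (hbc : b < c)
    (hb : 0 ≤ b) (hc : c ≤ a) : ∃ s ∈ Ioo b c, ∃ z, (∀ x, r i x = s → x = z) ∧
      ∀ᵐ p ∂G.edgeMeasure, r i (G.point p) ≠ s := by
  have ha : 0 ≤ a := hb.trans (hbc.le.trans hc)
  obtain ⟨s, hs, hsb⟩ := (Measure.dense_of_ae (H.ae_unique ha i)).exists_between hbc
  have hsa : s ∈ Ioo 0 a := ⟨hb.trans_lt hsb.1, hsb.2.trans_le hc⟩
  obtain ⟨z, hz⟩ := H.subset_range i hsa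
  refine ⟨s, hsb, z, fun x hx => hs hsa x z hx hz, ?_⟩
  have := H.measure_eq ha i (measurableSet_singleton s) (singleton_subset_iff.2 hsa)
  rw [Real.volume_singleton] at this
  exact measure_eq_zero_iff_ae_notMem.1 this

theorem exists_clamp_le (i : Fin k) {ρ ε : ℝ} (hρ : 0 ≤ ρ) (hρa : ρ ≤ a) (hε : 0 < ε)
    {u : X → ℝ} (hu : Continuous u) (hl : G.EdgeLip u) {S : Set (G.E × ℝ)}
    (h : ∀ᵐ p ∂G.edgeMeasure, p ∉ S → G.dv u p = 0) :
    ∃ v : X → ℝ, Continuous v ∧ G.EdgeLip v ∧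
      (∀ᵐ p ∂G.edgeMeasure, p ∉ S ∩ {p | r i (G.point p) ≤ ρ + ε} → G.dv v p = 0) ∧
      ∀ x, r i x ≤ ρ → v x = u x := by
  rcases hρa.eq_or_lt with rfl | hlt
  · refine ⟨u, hu, hl, ?_, fun _ _ => rfl⟩
    filter_upwards [h] with p hp hp'
    exact hp fun hS => hp' ⟨hS, (H.le i _).trans (by linarith)⟩
  · obtain ⟨s, hs, z, hz, hz'⟩ := H.exists_unique_level i
      (lt_min (lt_add_of_pos_right ρ hε) hlt) hρ (min_le_right _ _)
    obtain ⟨v, hv, hvl, hv0, hvu⟩ := hl.exists_clamp hu (H.continuous i) hz hz' h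
    refine ⟨v, hv, hvl, ?_, fun x hx => hvu x (hx.trans hs.1.le)⟩
    filter_upwards [hv0] with p hp hp'
    exact hp fun hS => hp' ⟨hS.1, le_trans hS.2 (hs.2.le.trans (min_le_left _ _))⟩

theorem exists_clamp_ge (i : Fin k) {ρ ε : ℝ} (hρ : 0 < ρ) (hρa : ρ ≤ a) (hε : 0 < ε)
    {u : X → ℝ} (hu : Continuous u) (hl : G.EdgeLip u) {S : Set (G.E × ℝ)}
    (h : ∀ᵐ p ∂G.edgeMeasure, p ∉ S → G.dv u p = 0) :
    ∃ v : X → ℝ, Continuous v ∧ G.EdgeLip v ∧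
      (∀ᵐ p ∂G.edgeMeasure, p ∉ S ∩ {p | 0 < r i (G.point p) ∧ ρ - ε ≤ r i (G.point p)} →
        G.dv v p = 0) ∧ ∀ x, ρ ≤ r i x → v x = u x := by
  obtain ⟨s, hs, z, hz, hz'⟩ := H.exists_unique_level i
    (max_lt (sub_lt_self ρ hε) hρ) (le_max_right _ _) hρa
  obtain ⟨v, hv, hvl, hv0, hvu⟩ := hl.exists_clamp hu (H.continuous i).neg (c := -s)
    (fun x hx => hz x (neg_injective hx)) (hz'.mono fun p hp hp' => hp (neg_injective hp')) h
  refine ⟨v, hv, hvl, ?_, fun x hx => hvu x (neg_le_neg (hs.2.le.trans hx))⟩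
  filter_upwards [hv0] with p hp hp'
  refine hp fun hS => hp' ⟨hS.1, ?_⟩
  have h1 : s ≤ r i (G.point p) := neg_le_neg_iff.1 hS.2
  have h2 := max_lt_iff.1 hs.1
  exact ⟨h2.2.trans_le h1, h2.1.le.trans h1⟩

variable [ConnectedSpace X]

theorem dist_le_of_pos (ha : 0 ≤ a) (i : Fin k) {x y : X} (hx : 0 < r i x)
    (hxy : r i x ≤ r i y) : dist x y ≤ r i y - r i x := by
  have := H.isFiniteMeasure
  refine le_of_forall_pos_le_add fun ε hε => ?_
  have hl : G.EdgeLip (fun z => dist x z) := edgeLip_of_abs_sub_le_dist fun y z => by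
    rw [dist_comm x y, dist_comm x z]
    exact abs_dist_sub_le y z x
  obtain ⟨v, hv, hvl, hv0, hvu⟩ := H.exists_clamp_ge i hx (H.le i x) (half_pos hε)
    (continuous_const.dist continuous_id) hl (S := univ) (ae_of_all _ fun p hp => absurd trivial hp)
  obtain ⟨w, hw, hwl, hw0, hwv⟩ := H.exists_clamp_le i (hx.le.trans hxy) (H.le i y) (half_pos hε)
    hv hvl hv0
  have hA : MeasurableSet (Icc (r i x - ε / 2) (r i y + ε / 2)) := measurableSet_Icc
  have h1 := hwl.abs_sub_le_measureReal hw (S := {p | 0 < r i (G.point p) ∧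
    r i (G.point p) ∈ Icc (r i x - ε / 2) (r i y + ε / 2)})
    ((H.measurableSet i measurableSet_Ioi).inter (H.measurableSet i hA))
    (hw0.mono fun p hp hp' => hp fun hS => hp' ⟨hS.1.2.1, hS.1.2.2, hS.2⟩) y x
  rw [hwv y le_rfl, hwv x hxy, hvu y hxy, hvu x le_rfl, id, id, dist_self, sub_zero, abs_dist] at h1
  have h2 := ENNReal.toReal_mono (by simp) (H.measure_pos_le ha i hA)
  rw [Real.volume_Icc, ENNReal.toReal_ofReal (by linarith)] at h2
  have := h1.trans h2
  linarith

theorem dist_le_sum_max (ha : 0 ≤ a) (x y : X) : dist x y ≤ ∑ l, max (r l x) (r l y) := by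
  have := H.isFiniteMeasure
  have hl : G.EdgeLip (fun z => dist x z) := edgeLip_of_abs_sub_le_dist fun y z => by
    rw [dist_comm x y, dist_comm x z]
    exact abs_dist_sub_le y z x
  have hstep : ∀ ε > 0, dist x y ≤ ∑ l, (max (r l x) (r l y) + ε) := by
    intro ε hε
    have hclamp : ∀ F : Finset (Fin k), ∃ v : X → ℝ, Continuous v ∧ G.EdgeLip v ∧
        (∀ᵐ p ∂G.edgeMeasure, p ∉ {p | ∀ l ∈ F, r l (G.point p) ≤ max (r l x) (r l y) + ε} →
          G.dv v p = 0) ∧ v x = dist x x ∧ v y = dist x y := by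
      intro F
      induction F using Finset.induction_on with
      | empty =>
        exact ⟨_, continuous_const.dist continuous_id, hl, ae_of_all _ fun p hp => by simp at hp,
          rfl, rfl⟩
      | insert l F _ ih =>
        obtain ⟨v, hv, hvl, hv0, hvx, hvy⟩ := ih
        obtain ⟨w, hw, hwl, hw0, hwv⟩ := H.exists_clamp_le l
          ((H.nonneg l x).trans (le_max_left _ (r l y))) (max_le (H.le l x) (H.le l y)) hε
          hv hvl hv0
        refine ⟨w, hw, hwl, ?_, by rw [hwv x (le_max_left _ _), hvx],
          by rw [hwv y (le_max_right _ _), hvy]⟩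
        filter_upwards [hw0] with p hp hp'
        refine hp fun hS => hp' fun j hj => ?_
        rcases Finset.mem_insert.1 hj with rfl | hj
        · exact hS.2
        · exact hS.1 j hj
    obtain ⟨v, hv, hvl, hv0, hvx, hvy⟩ := hclamp Finset.univ
    have hB : ∀ l, MeasurableSet {p | 0 < r l (G.point p) ∧
        r l (G.point p) ∈ Icc 0 (max (r l x) (r l y) + ε)} := fun l =>
      (H.measurableSet l measurableSet_Ioi).inter (H.measurableSet l measurableSet_Icc)
    have h1 := hvl.abs_sub_le_measureReal hv (S := ⋃ l, {p | 0 < r l (G.point p) ∧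
        r l (G.point p) ∈ Icc 0 (max (r l x) (r l y) + ε)}) (MeasurableSet.iUnion hB) (by
      filter_upwards [hv0, (H.measureReal_Ioo ha).2] with p hp ⟨j, hj⟩ hp'
      exact hp fun hS => hp' (mem_iUnion.2 ⟨j, hj.1, hj.1.le, hS j (Finset.mem_univ j)⟩)) y x
    rw [hvx, hvy, dist_self, sub_zero, abs_dist] at h1
    refine h1.trans ((measureReal_iUnion_fintype_le _).trans (Finset.sum_le_sum fun l _ => ?_))
    have h2 := ENNReal.toReal_mono (by simp) (H.measure_pos_le ha l
      (measurableSet_Icc (a := 0) (b := max (r l x) (r l y) + ε)))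
    rw [Real.volume_Icc, sub_zero, ENNReal.toReal_ofReal
      (add_nonneg ((H.nonneg l x).trans (le_max_left _ _)) hε.le)] at h2
    exact h2
  have hlim : Tendsto (fun ε : ℝ => ∑ l, (max (r l x) (r l y) + ε)) (nhdsWithin 0 (Ioi 0))
      (nhds (∑ l, (max (r l x) (r l y) + 0))) :=
    (Continuous.tendsto (by fun_prop) 0).mono_left nhdsWithin_le_nhds
  simpa using ge_of_tendsto hlim (eventually_mem_nhdsWithin.mono hstep)

theorem isStar (ha : 0 < a) (hk : 2 ≤ k) : IsStar X k a := by
  have : NeZero k := ⟨by omega⟩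
  have h10 : (⟨1, hk⟩ : Fin k) ≠ 0 := by
    simp [Fin.ext_iff]
  have hφ : ∀ x, ∃ p : Fin k × ℝ, ∀ l, r l x = if l = p.1 then p.2 else 0 := by
    intro x
    by_cases h : ∃ i, r i x ≠ 0
    · obtain ⟨i, hi⟩ := h
      refine ⟨(i, r i x), fun l => ?_⟩
      split_ifs with hl
      · rw [hl]
      · exact (H.eq_zero l i hl x).resolve_right hi
    · push Not at h
      exact ⟨(0, 0), fun l => by simp [h l]⟩
  choose φ hφ using hφ
  have hr : ∀ x, r (φ x).1 x = (φ x).2 := fun x => by rw [hφ, if_pos rfl]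
  have hdist : ∀ x y, dist x y = if (φ x).1 = (φ y).1 ∨ (φ x).2 = 0 ∨ (φ y).2 = 0
      then |(φ x).2 - (φ y).2| else (φ x).2 + (φ y).2 := by
    have hnn : ∀ x, 0 ≤ (φ x).2 := fun x => hr x ▸ H.nonneg _ _
    have h0 : ∀ x y, (φ x).2 = 0 → dist x y = |(φ x).2 - (φ y).2| := by
      intro x y hx
      have h1 := H.dist_le_sum_max ha.le x y
      have h2 : ∀ l, max (r l x) (r l y) = if l = (φ y).1 then (φ y).2 else 0 := by
        intro l
        rw [hφ x, hφ y, hx, ite_self]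
        refine max_eq_right ?_
        split_ifs
        exacts [hnn y, le_rfl]
      simp only [h2, Finset.sum_ite_eq', Finset.mem_univ, if_true] at h1
      have h3 := (H.edgeLip (φ y).1).abs_sub_le_dist (H.continuous _) x y
      rw [hr y, hφ x, hx, ite_self] at h3
      rw [hx]
      refine le_antisymm ?_ h3
      rwa [zero_sub, abs_neg, abs_of_nonneg (hnn y)]
    intro x y
    by_cases hx : (φ x).2 = 0
    · rw [if_pos (Or.inr (Or.inl hx)), h0 x y hx]
    by_cases hy : (φ y).2 = 0
    · rw [if_pos (Or.inr (Or.inr hy)), dist_comm, abs_sub_comm, h0 y x hy]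
    by_cases hij : (φ x).1 = (φ y).1
    · rw [if_pos (Or.inl hij)]
      have h3 := (H.edgeLip (φ x).1).abs_sub_le_dist (H.continuous _) x y
      have hry : r (φ x).1 y = (φ y).2 := by rw [hij, hr]
      rw [hr x, hry] at h3
      refine le_antisymm ?_ h3
      rcases le_total (φ x).2 (φ y).2 with hle | hle
      · have := H.dist_le_of_pos ha.le (φ x).1 (x := x) (y := y)
          (by rw [hr]; exact (hnn x).lt_of_ne' hx) (by rw [hr, hry]; exact hle)
        rw [hr x, hry] at this
        rwa [abs_sub_comm, abs_of_nonneg (sub_nonneg.2 hle)]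
      · have := H.dist_le_of_pos ha.le (φ x).1 (x := y) (y := x)
          (by rw [hry]; exact (hnn y).lt_of_ne' hy) (by rw [hr, hry]; exact hle)
        rw [hr x, hry] at this
        rwa [dist_comm, abs_of_nonneg (sub_nonneg.2 hle)]
    · rw [if_neg (by simp [hij, hx, hy])]
      apply le_antisymm
      · refine (H.dist_le_sum_max ha.le x y).trans_eq ?_
        have h2 : ∀ l, max (r l x) (r l y) = (if l = (φ x).1 then (φ x).2 else 0) +
            if l = (φ y).1 then (φ y).2 else 0 := by
          intro l
          rw [hφ x, hφ y]
          split_ifs with h1 h2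
          · exact absurd (h1.symm.trans h2) hij
          · simpa using hnn x
          · simpa using hnn y
          · simp
        simp only [h2, Finset.sum_add_distrib, Finset.sum_ite_eq', Finset.mem_univ, if_true]
      · have h3 := (EdgeLip.sub_of_eq_zero (H.continuous (φ x).1) (H.continuous (φ y).1)
          (H.edgeLip _) (H.edgeLip _) (H.nonneg _) (H.nonneg _)
          (H.eq_zero _ _ hij)).abs_sub_le_dist
          ((H.continuous (φ x).1).sub (H.continuous (φ y).1)) x y
        have e1 : r (φ x).1 y = 0 := by rw [hφ y, if_neg hij]
        have e2 : r (φ y).1 x = 0 := by rw [hφ x, if_neg (Ne.symm hij)]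
        simp only [Pi.sub_apply] at h3
        rw [hr, hr, e1, e2, sub_zero, zero_sub, sub_neg_eq_add] at h3
        exact (le_abs_self _).trans h3
  refine ⟨φ, fun x y hxy => ?_, ?_, fun x => ?_, fun i t ht => ?_, hdist⟩
  · have := hdist x y
    rw [hxy] at this
    simpa using this
  · have hc : Continuous fun x => r 0 x - ∑ j ∈ Finset.univ.erase 0, r j x :=
      (H.continuous 0).sub (continuous_finsetSum _ fun j _ => H.continuous j)
    have hmid : a / 2 ∈ Ioo 0 a := ⟨by linarith, by linarith⟩
    obtain ⟨x, hx⟩ := H.subset_range 0 hmid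
    obtain ⟨y, hy⟩ := H.subset_range ⟨1, hk⟩ hmid
    have hx0 : ∀ j ∈ Finset.univ.erase (0 : Fin k), r j x = 0 := fun j hj =>
      (H.eq_zero j 0 (Finset.ne_of_mem_erase hj) x).resolve_right (by rw [hx]; exact hmid.1.ne')
    have hy0 : r 0 y = 0 :=
      (H.eq_zero 0 _ h10.symm y).resolve_right (by rw [hy]; exact hmid.1.ne')
    obtain ⟨z, hz⟩ := mem_range_of_exists_le_of_exists_ge hc (c := 0)
      ⟨y, by
        rw [hy0, zero_sub, neg_nonpos]
        exact Finset.sum_nonneg fun j _ => H.nonneg j y⟩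
      ⟨x, by rw [Finset.sum_eq_zero hx0, sub_zero]; exact H.nonneg 0 x⟩
    refine ⟨z, ?_⟩
    by_contra hne
    have hz' := sub_eq_zero.1 hz
    have hz1 : ∀ l, l ≠ (φ z).1 → r l z = 0 := fun l hl => by rw [hφ, if_neg hl]
    by_cases h0 : (φ z).1 = 0
    · rw [Finset.sum_eq_zero fun j hj => hz1 j (by rw [h0]; exact Finset.ne_of_mem_erase hj),
        ← h0, hr] at hz'
      exact hne hz'
    · rw [hz1 0 (Ne.symm h0), eq_comm, Finset.sum_eq_zero_iff_of_nonneg fun j _ =>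
        H.nonneg j z] at hz'
      exact hne (hr z ▸ hz' _ (Finset.mem_erase.2 ⟨h0, Finset.mem_univ _⟩))
  · exact hr x ▸ ⟨H.nonneg _ _, H.le _ _⟩
  · obtain ⟨x, hx⟩ := H.subset_range i ht
    have hi : i = (φ x).1 := by
      by_contra hne
      rw [hφ, if_neg hne] at hx
      exact ht.1.ne hx
    refine ⟨x, Prod.ext hi.symm ?_⟩
    rw [← hr x, ← hi, hx]

end IsArms

end MetricGraphOn

theorem abs_arcsin_mul_sub_le {δ : ℝ} (h0 : 0 ≤ δ) (h1 : δ < 1) {u v : ℝ}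
    (hu : u ∈ Icc (-1) 1) (hv : v ∈ Icc (-1) 1) :
    |Real.arcsin (δ * u) - Real.arcsin (δ * v)| ≤ 1 / √(1 - δ ^ 2) * |u - v| := by
  refine Convex.norm_image_sub_le_of_norm_hasDerivWithin_le
    (f := fun u => Real.arcsin (δ * u)) (f' := fun u => 1 / √(1 - (δ * u) ^ 2) * (δ * 1))
    (s := Icc (-1) 1) (x := v) (y := u) (fun x hx => ?_) (fun x hx => ?_) (convex_Icc _ _) hv hu
  · have hb := abs_le.1 ((abs_mul δ x).trans_le
      (mul_le_mul_of_nonneg_left (abs_le.2 hx) (abs_nonneg δ)))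
    rw [abs_of_nonneg h0, mul_one] at hb
    have ha : HasDerivAt Real.arcsin (1 / √(1 - (δ * x) ^ 2)) (δ * x) :=
      Real.hasDerivAt_arcsin (by linarith) (by linarith)
    exact (ha.comp x ((hasDerivAt_id x).const_mul δ)).hasDerivWithinAt
  · have hx2 : x ^ 2 ≤ 1 := (sq_le_one_iff_abs_le_one x).2 (abs_le.2 hx)
    have h2 : 1 - δ ^ 2 ≤ 1 - (δ * x) ^ 2 := by
      rw [mul_pow]
      nlinarith [sq_nonneg δ]
    have h3 : 0 < 1 - δ ^ 2 := by nlinarith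
    rw [Real.norm_eq_abs, abs_of_nonneg (by positivity), mul_one]
    calc 1 / √(1 - (δ * x) ^ 2) * δ ≤ 1 / √(1 - (δ * x) ^ 2) * 1 := by gcongr
      _ ≤ _ := by
        rw [mul_one]
        gcongr

namespace MetricGraphOn

variable {X : Type} [MetricSpace X] {G : MetricGraphOn X}

theorem EdgewiseAC.abs_sub_le_mul {g : X → ℝ} (hg : G.EdgewiseAC g) {K : ℝ}
    (hK : ∀ᵐ p ∂G.edgeMeasure, |G.dv g p| ≤ K) (e : G.E) {s t : ℝ}
    (hs : s ∈ Icc 0 (G.len e)) (ht : t ∈ Icc 0 (G.len e)) :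
    |g (G.edgeMap e s) - g (G.edgeMap e t)| ≤ K * |s - t| := by
  have h1 : AbsolutelyContinuousOnInterval (g ∘ G.edgeMap e) t s := (hg e).mono (by
    rw [uIcc_of_le (G.len_pos e).le]; exact ordConnected_Icc.uIcc_subset ht hs)
  have h2 := h1.integral_deriv_eq_sub
  change _ = g (G.edgeMap e s) - g (G.edgeMap e t) at h2
  rw [← h2]
  refine intervalIntegral.norm_integral_le_of_norm_le_const_ae
    (f := deriv (g ∘ G.edgeMap e)) (C := K) ?_
  have h3 := (ae_restrict_iff' measurableSet_Ioo).1 (G.ae_edgeMeasure_iff.1 hK e)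
  filter_upwards [h3, Measure.ae_ne volume (G.len e)] with x hx hne hxm
  have h4 : x ∈ Ioc 0 (G.len e) :=
    ⟨(le_min ht.1 hs.1).trans_lt hxm.1, hxm.2.trans (max_le ht.2 hs.2)⟩
  exact hx ⟨h4.1, h4.2.lt_of_ne hne⟩

theorem edgeLip_arcsin {h : X → ℝ} (hs : h ∈ G.sobolev) {M ω : ℝ} (hM : 0 < M) (hω : 0 < ω)
    (h0 : ∀ x, 0 ≤ h x) (hhM : ∀ x, h x ≤ M)
    (hd : ∀ᵐ p ∂G.edgeMeasure, |G.dv h p| ≤ ω * M * √(1 - (h (G.point p) / M) ^ 2)) :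
    G.EdgeLip (fun x => Real.arcsin (h x / M) / ω) := by
  have hmem : ∀ x, h x / M ∈ Icc (-1) 1 := fun x =>
    ⟨by linarith [div_nonneg (h0 x) hM.le], (div_le_one hM).2 (hhM x)⟩
  have key : ∀ δ, 0 < δ → δ < 1 → ∀ e, ∀ s ∈ Icc 0 (G.len e), ∀ t ∈ Icc 0 (G.len e),
      |Real.arcsin (δ * (h (G.edgeMap e s) / M)) - Real.arcsin (δ * (h (G.edgeMap e t) / M))| ≤
        ω * |s - t| := by
    intro δ hδ hδ1 e s hs' t ht'
    have hac : G.EdgewiseAC (fun x => Real.arcsin (δ * (h x / M))) := by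
      refine (sobolev.edgewiseAC hs).of_dist_le (K := 1 / √(1 - δ ^ 2) / M) fun x y => ?_
      refine (abs_arcsin_mul_sub_le hδ.le hδ1 (hmem x) (hmem y)).trans_eq ?_
      rw [← sub_div, abs_div, abs_of_pos hM, Real.dist_eq]
      ring
    refine hac.abs_sub_le_mul ?_ e hs' ht'
    filter_upwards [hd, (sobolev.edgewiseAC hs).ae_differentiableAt, ae_mem_Ioo (G := G)]
      with p hp hdiff hp'
    have hpt : G.point p = G.edgeMap p.1 p.2 := G.point_eq (Ioo_subset_Icc_self hp')
    rw [hpt] at hp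
    obtain ⟨hu1, hu2⟩ := hmem (G.edgeMap p.1 p.2)
    have hu0 := div_nonneg (h0 (G.edgeMap p.1 p.2)) hM.le
    set u := h (G.edgeMap p.1 p.2) / M with hu
    have hδu : δ * u < 1 := by nlinarith
    have hder : HasDerivAt (fun t => Real.arcsin (δ * (h (G.edgeMap p.1 t) / M)))
        (1 / √(1 - (δ * u) ^ 2) * (δ * (G.dv h p / M))) p.2 := by
      have ha : HasDerivAt Real.arcsin (1 / √(1 - (δ * u) ^ 2)) (δ * u) :=
        Real.hasDerivAt_arcsin (by nlinarith) hδu.ne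
      exact ha.comp p.2 ((hdiff.hasDerivAt.div_const M).const_mul δ)
    have : G.dv (fun x => Real.arcsin (δ * (h x / M))) p =
      1 / √(1 - (δ * u) ^ 2) * (δ * (G.dv h p / M)) := hder.deriv
    rw [this, abs_mul, abs_mul, abs_div (G.dv h p), abs_of_pos hM, abs_of_pos hδ,
      abs_of_nonneg (by positivity), one_div_mul_eq_div]
    have hpos : 0 < √(1 - (δ * u) ^ 2) := Real.sqrt_pos.2 (by nlinarith [mul_nonneg hδ.le hu0])
    rw [div_le_iff₀ hpos]
    have h1 : √(1 - u ^ 2) ≤ √(1 - (δ * u) ^ 2) := Real.sqrt_le_sqrt (by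
      rw [mul_pow]
      linarith [mul_le_of_le_one_left (sq_nonneg u) (pow_le_one₀ hδ.le hδ1.le (n := 2))])
    calc δ * (|G.dv h p| / M) ≤ 1 * (ω * M * √(1 - u ^ 2) / M) := by gcongr
      _ = ω * √(1 - u ^ 2) := by field_simp
      _ ≤ _ := by gcongr
  intro e s hs' t ht'
  have hlim : Tendsto (fun δ : ℝ => |Real.arcsin (δ * (h (G.edgeMap e s) / M)) -
      Real.arcsin (δ * (h (G.edgeMap e t) / M))|) (nhdsWithin 1 (Iio 1))
      (nhds |Real.arcsin (1 * (h (G.edgeMap e s) / M)) -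
        Real.arcsin (1 * (h (G.edgeMap e t) / M))|) :=
    (Continuous.tendsto (((Real.continuous_arcsin.comp (continuous_id.mul continuous_const)).sub
      (Real.continuous_arcsin.comp (continuous_id.mul continuous_const))).abs) 1).mono_left
        nhdsWithin_le_nhds
  have hle := le_of_tendsto hlim (b := ω * |s - t|) (by
    filter_upwards [Ioo_mem_nhdsLT (zero_lt_one (α := ℝ))] with δ hδ
    exact key δ hδ.1 hδ.2 e s hs' t ht')
  rw [one_mul, one_mul] at hle
  rw [← sub_div, abs_div, abs_of_pos hω, div_le_iff₀ hω, mul_comm]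
  exact hle

namespace sobolev

variable [IsFiniteMeasure G.edgeMeasure] [ConnectedSpace X] {h : X → ℝ}

/-- The Faber–Krahn inequality for the support of a Rayleigh quotient minimiser vanishing somewhere,
with its equality case. -/
theorem pi_div_le_measureReal (hs : h ∈ G.sobolev) (h0 : ∀ x, 0 ≤ h x) {x₀ : X} (hx₀ : h x₀ = 0)
    {ω M : ℝ} (hω : 0 < ω) (hM : 0 < M) (hMh : IsLUB (range h) M)
    (hq : ∫ p, G.dv h p * G.dv h p ∂G.edgeMeasure ≤
      ω ^ 2 * ∫ p, h (G.point p) * h (G.point p) ∂G.edgeMeasure) :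
    Real.pi / (2 * ω) ≤ G.edgeMeasure.real {p | 0 < h (G.point p)} ∧
      (G.edgeMeasure.real {p | 0 < h (G.point p)} ≤ Real.pi / (2 * ω) →
        ∀ᵐ p ∂G.edgeMeasure, |G.dv h p| ≤ ω * M * √(1 - (h (G.point p) / M) ^ 2)) := by
  obtain ⟨hY, hYd⟩ := comp_mem hs (hasDerivAt_halfDisc M) fun _ => sqrt_one_sub_sq_le _
  have hhM : ∀ x, h x ≤ M := fun x => hMh.1 (mem_range_self x)
  have hI : M * (Real.pi / 4) ≤ ∫ p, |G.dv (halfDisc M ∘ h) p| ∂G.edgeMeasure := by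
    have hcont : Continuous (halfDisc M) :=
      continuous_iff_continuousAt.2 fun s => (hasDerivAt_halfDisc M s).continuousAt
    have hcl : IsClosed {s | halfDisc M s ≤ ∫ p, |G.dv (halfDisc M ∘ h) p| ∂G.edgeMeasure} :=
      isClosed_le hcont continuous_const
    have hsub : range h ⊆ {s | halfDisc M s ≤ ∫ p, |G.dv (halfDisc M ∘ h) p| ∂G.edgeMeasure} := by
      rintro _ ⟨x, rfl⟩
      have := (le_abs_self _).trans (abs_sub_le hY x x₀)
      simpa [hx₀, halfDisc_zero] using this
    rw [← halfDisc_self hM.ne']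
    exact closure_minimal hsub hcl (hMh.mem_closure ⟨_, mem_range_self x₀⟩)
  set c := G.edgeMeasure.real {p | 0 < h (G.point p)} with hc
  have hc' : ∫ p, G.posInd h p ∂G.edgeMeasure = c := integral_indicator_one (measurableSet_pos hs.1)
  set W : G.E × ℝ → ℝ := fun p => G.posInd h p * √(1 - (h (G.point p) / M) ^ 2) with hW
  have hsq : ∀ᵐ p ∂G.edgeMeasure, (|G.dv h p| - ω * M * W p) ^ 2 =
      G.dv h p * G.dv h p - 2 * ω * M * |G.dv (halfDisc M ∘ h) p| +
        (ω * M) ^ 2 * G.posInd h p - ω ^ 2 * (h (G.point p) * h (G.point p)) := by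
    filter_upwards [dv_eq_zero_ae hs h0, hYd] with p hp hd
    rw [hd, abs_mul, abs_of_nonneg (Real.sqrt_nonneg _)]
    rcases (h0 (G.point p)).eq_or_lt with hz | hz
    · simp [hW, posInd, hp hz.symm, ← hz]
    · have hu : 0 ≤ 1 - (h (G.point p) / M) ^ 2 := by
        have h1 := div_nonneg hz.le hM.le
        have h2 := (div_le_one hM).2 (hhM (G.point p))
        nlinarith
      have hr := Real.sq_sqrt hu
      have hone : G.posInd h p = 1 := indicator_of_mem (show p ∈ {q | 0 < h (G.point q)} from hz) _
      simp only [hW, hone, one_mul]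
      have hz' : (h (G.point p) / M) ^ 2 * M ^ 2 = h (G.point p) ^ 2 := by
        field_simp
      have ha := sq_abs (G.dv h p)
      linear_combination ha + (ω * M) ^ 2 * hr - ω ^ 2 * hz'
  have hi1 := integrable_dv_mul hs hs
  have hi2 := ((integrable_dv hY).abs).const_mul (2 * ω * M)
  have hi3 := (integrable_posInd (G := G) hs.1).const_mul ((ω * M) ^ 2)
  have hi4 := (integrable_val_mul hs hs).const_mul (ω ^ 2)
  have hi12 : Integrable (fun p => G.dv h p * G.dv h p -
      2 * ω * M * |G.dv (halfDisc M ∘ h) p|) G.edgeMeasure := hi1.sub hi2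
  have hi123 : Integrable (fun p => G.dv h p * G.dv h p - 2 * ω * M * |G.dv (halfDisc M ∘ h) p| +
      (ω * M) ^ 2 * G.posInd h p) G.edgeMeasure := hi12.add hi3
  have h_int : Integrable (fun p => (|G.dv h p| - ω * M * W p) ^ 2) G.edgeMeasure :=
    (hi123.sub hi4).congr (hsq.mono fun p hp => hp.symm)
  have hval : ∫ p, (|G.dv h p| - ω * M * W p) ^ 2 ∂G.edgeMeasure =
      ∫ p, G.dv h p * G.dv h p ∂G.edgeMeasure -
        2 * ω * M * ∫ p, |G.dv (halfDisc M ∘ h) p| ∂G.edgeMeasure + (ω * M) ^ 2 * c -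
        ω ^ 2 * ∫ p, h (G.point p) * h (G.point p) ∂G.edgeMeasure := by
    rw [integral_congr_ae hsq, integral_sub hi123 hi4,
      integral_add hi12 hi3, integral_sub hi1 hi2, integral_const_mul, integral_const_mul,
      integral_const_mul, hc']
  have hle : ∫ p, (|G.dv h p| - ω * M * W p) ^ 2 ∂G.edgeMeasure ≤
      ω * M ^ 2 * (ω * c - Real.pi / 2) := by
    have : 2 * ω * M * (M * (Real.pi / 4)) ≤
        2 * ω * M * ∫ p, |G.dv (halfDisc M ∘ h) p| ∂G.edgeMeasure :=
      mul_le_mul_of_nonneg_left hI (by positivity)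
    rw [hval]
    nlinarith
  have hnn : 0 ≤ ∫ p, (|G.dv h p| - ω * M * W p) ^ 2 ∂G.edgeMeasure :=
    integral_nonneg fun p => sq_nonneg _
  have hωM : 0 < ω * M ^ 2 := by positivity
  have hge : 0 ≤ ω * c - Real.pi / 2 := by
    by_contra hn
    exact absurd (hnn.trans hle) (not_le.2 (mul_neg_of_pos_of_neg hωM (not_le.1 hn)))
  refine ⟨by rw [div_le_iff₀ (by positivity)]; linarith, fun hcle => ?_⟩
  rw [le_div_iff₀ (by positivity)] at hcle
  have hz : ∫ p, (|G.dv h p| - ω * M * W p) ^ 2 ∂G.edgeMeasure = 0 := by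
    refine le_antisymm (hle.trans ?_) hnn
    exact mul_nonpos_of_nonneg_of_nonpos hωM.le (by linarith)
  rw [integral_eq_zero_iff_of_nonneg (fun p => sq_nonneg _) h_int] at hz
  filter_upwards [hz] with p hp
  have hp' : |G.dv h p| - ω * M * W p = 0 := by simpa using hp
  rw [sub_eq_zero.1 hp']
  exact mul_le_mul_of_nonneg_left (mul_le_of_le_one_left (Real.sqrt_nonneg _)
    (posInd_le_one h p)) (by positivity)

end sobolev

theorem exists_isArms [IsFiniteMeasure G.edgeMeasure] [ConnectedSpace X] {k : ℕ} (hk : 2 ≤ k)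
    {ω : ℝ} (hω : 0 < ω)
    (hu : G.edgeMeasure univ = ENNReal.ofReal (k * (Real.pi / (2 * ω)))) {f : Fin k → X → ℝ}
    (hf : ∀ i, f i ∈ G.sobolev ∧ (∀ x, 0 ≤ f i x) ∧ (∃ x, 0 < f i x) ∧
      ∫ p, G.dv (f i) p * G.dv (f i) p ∂G.edgeMeasure ≤
        ω ^ 2 * ∫ p, f i (G.point p) * f i (G.point p) ∂G.edgeMeasure)
    (hd : ∀ i j, i ≠ j → ∀ x, f i x = 0 ∨ f j x = 0) :
    ∃ r, G.IsArms k (Real.pi / (2 * ω)) r := by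
  have : Nontrivial (Fin k) := Fin.nontrivial_iff_two_le.2 hk
  have hzero : ∀ i, ∃ x, f i x = 0 := fun i => by
    obtain ⟨j, hj⟩ := exists_ne i
    obtain ⟨x, hx⟩ := (hf j).2.2.1
    exact ⟨x, (hd i j hj.symm x).resolve_right hx.ne'⟩
  have hM : ∀ i, ∃ M, 0 < M ∧ IsLUB (range (f i)) M := fun i => by
    obtain ⟨B, hB⟩ := sobolev.exists_bound (hf i).1
    obtain ⟨x, hx⟩ := (hf i).2.2.1
    have hb : BddAbove (range (f i)) :=
      ⟨B, forall_mem_range.2 fun x => (le_abs_self _).trans (hB x)⟩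
    exact ⟨_, hx.trans_le (le_csSup hb (mem_range_self x)), isLUB_csSup ⟨_, mem_range_self x⟩ hb⟩
  choose M hM0 hM using hM
  have hfk := fun i => sobolev.pi_div_le_measureReal (hf i).1 (hf i).2.1 (hzero i).choose_spec hω
    (hM0 i) (hM i) (hf i).2.2.2
  set a := Real.pi / (2 * ω) with ha
  have ha0 : 0 < a := by positivity
  have hle : ∀ i, G.edgeMeasure.real {p | 0 < f i (G.point p)} ≤ a := by
    have hdis : Pairwise (Function.onFun Disjoint fun i => {p | 0 < f i (G.point p)}) := by
      intro i j hij
      refine Set.disjoint_left.2 fun p hp hp' => ?_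
      rcases hd i j hij (G.point p) with h | h
      · exact (show 0 < f i (G.point p) from hp).ne' h
      · exact (show 0 < f j (G.point p) from hp').ne' h
    have h1 : ∑ i, G.edgeMeasure.real {p | 0 < f i (G.point p)} ≤ ∑ _i : Fin k, a := by
      rw [← measureReal_iUnion_fintype hdis fun i => measurableSet_pos (hf i).1.1]
      refine (measureReal_mono (subset_univ _)).trans_eq ?_
      rw [Measure.real, hu, ENNReal.toReal_ofReal (by positivity)]
      simp
    have h2 : ∑ _i : Fin k, a = ∑ i, G.edgeMeasure.real {p | 0 < f i (G.point p)} :=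
      le_antisymm (Finset.sum_le_sum fun i _ => (hfk i).1) h1
    exact fun i => ((Finset.sum_eq_sum_iff_of_le fun i _ => (hfk i).1).1 h2 i
      (Finset.mem_univ i)).ge
  have hfM : ∀ i x, f i x ≤ M i := fun i x => (hM i).1 (mem_range_self x)
  have hzr : ∀ i x, f i x = 0 → Real.arcsin (f i x / M i) / ω = 0 := fun i x h => by simp [h]
  refine ⟨fun i x => Real.arcsin (f i x / M i) / ω, ?_, fun i => ?_, fun i x => ?_, fun i x => ?_,
    fun i j hij x => (hd i j hij x).imp (hzr i x) (hzr j x), fun i t ht => ?_, hu⟩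
  · exact fun i => (Real.continuous_arcsin.comp ((hf i).1.1.div_const _)).div_const _
  · exact edgeLip_arcsin (hf i).1 (hM0 i) hω (hf i).2.1 (hfM i) ((hfk i).2 (hle i))
  · exact div_nonneg (Real.arcsin_nonneg.2 (div_nonneg ((hf i).2.1 x) (hM0 i).le)) hω.le
  · rw [ha, ← div_div]
    gcongr
    exact Real.arcsin_le_pi_div_two _
  · have ht1 : 0 < ω * t := mul_pos hω ht.1
    have ht2 : ω * t < Real.pi / 2 := by
      have := mul_lt_mul_of_pos_left ht.2 hω
      rwa [ha, show ω * (Real.pi / (2 * ω)) = Real.pi / 2 by field_simp] at this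
    have hsin : Real.sin (ω * t) < 1 := by
      rw [← Real.sin_pi_div_two]
      exact Real.sin_lt_sin_of_lt_of_le_pi_div_two (by linarith) le_rfl ht2
    have hsin0 : 0 ≤ Real.sin (ω * t) := Real.sin_nonneg_of_nonneg_of_le_pi ht1.le (by linarith)
    obtain ⟨_, ⟨x, rfl⟩, hx, _⟩ := (hM i).exists_between
      (mul_lt_of_lt_one_right (hM0 i) hsin)
    obtain ⟨y, hy⟩ := hzero i
    obtain ⟨z, hz⟩ := mem_range_of_exists_le_of_exists_ge (hf i).1.1
      (c := M i * Real.sin (ω * t)) ⟨y, by rw [hy]; exact mul_nonneg (hM0 i).le hsin0⟩ ⟨x, hx.le⟩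
    refine ⟨z, ?_⟩
    simp only [hz]
    rw [mul_div_cancel_left₀ _ (hM0 i).ne', Real.arcsin_sin (by linarith) ht2.le,
      mul_div_cancel_left₀ _ hω.ne']

end MetricGraphOn

namespace LinearMap.BilinForm

variable {W : Type*} [AddCommGroup W] [Module ℝ W]

theorem apply_smul_add_sum (B : LinearMap.BilinForm ℝ W) (hB : ∀ f g, B f g = B g f) {k : ℕ}
    (e : W) (S : Fin k → W) {J : ℝ} (he : ∀ i, B e (S i) = J)
    (hS : ∀ i j, i ≠ j → B (S i) (S j) = 0) (c : ℝ) (b : Fin k → ℝ) (hb : ∑ i, b i = 0) :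
    B (c • e + ∑ i, b i • S i) (c • e + ∑ i, b i • S i) =
      c ^ 2 * B e e + ∑ i, b i ^ 2 * B (S i) (S i) := by
  have h1 : B e (∑ i, b i • S i) = 0 := by
    simp only [map_sum, map_smul, he, smul_eq_mul, ← Finset.sum_mul, hb, zero_mul]
  have h2 : B (∑ i, b i • S i) (∑ i, b i • S i) = ∑ i, b i ^ 2 * B (S i) (S i) := by
    simp only [map_sum, LinearMap.sum_apply, map_smul, LinearMap.smul_apply, smul_eq_mul]
    refine Finset.sum_congr rfl fun i _ => ?_
    rw [Finset.sum_eq_single i (fun j _ hj => by simp [hS j i hj]) (by simp)]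
    ring
  have h3 : B (∑ i, b i • S i) e = 0 := by rw [hB, h1]
  rw [← h2]
  simp only [map_add, LinearMap.add_apply, map_smul, LinearMap.smul_apply, h1, h3, smul_eq_mul]
  ring

theorem exists_submodule_le_of_star {M Q : LinearMap.BilinForm ℝ W}
    (hM : ∀ f g, M f g = M g f) (hQ : ∀ f g, Q f g = Q g f) {k : ℕ} (hk : 0 < k) (e : W)
    (S : Fin k → W) {J m q Λ : ℝ} (hme : 0 < M e e) (hmS : ∀ i, M e (S i) = J)
    (hm : 0 < m) (hSS : ∀ i j, M (S i) (S j) = if i = j then m else 0)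
    (hqe : Q e e = 0) (hqS : ∀ i, Q e (S i) = q) (hqSS : ∀ i j, i ≠ j → Q (S i) (S j) = 0)
    (hΛ : 0 ≤ Λ) (hqm : ∀ i, Q (S i) (S i) ≤ Λ * m) :
    ∃ V : Submodule ℝ W, FiniteDimensional ℝ V ∧ Module.finrank ℝ V = k ∧
      ∀ f ∈ V, Q f f ≤ Λ * M f f := by
  have hk' : (k : ℝ) ≠ 0 := by positivity
  let ψ : Fin k → W := fun i => e + (S i - (k : ℝ)⁻¹ • ∑ j, S j)
  have hψ : ∀ d : Fin k → ℝ, ∑ i, d i • ψ i =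
      (∑ i, d i) • e + ∑ i, (d i - (∑ j, d j) / k) • S i := fun d => by
    simp only [ψ, smul_add, smul_sub, Finset.sum_add_distrib, Finset.sum_sub_distrib,
      ← Finset.sum_smul, sub_smul, ← Finset.smul_sum, smul_smul, div_eq_mul_inv,
      Finset.sum_mul]
  have hb : ∀ d : Fin k → ℝ, ∑ i, (d i - (∑ j, d j) / k) = 0 := fun d => by
    simp [Finset.sum_sub_distrib, mul_div_cancel₀ _ hk']
  have hMψ : ∀ d : Fin k → ℝ, M (∑ i, d i • ψ i) (∑ i, d i • ψ i) =
      (∑ i, d i) ^ 2 * M e e + ∑ i, (d i - (∑ j, d j) / k) ^ 2 * m := fun d => by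
    rw [hψ, apply_smul_add_sum M hM e S hmS (fun i j hij => by simp [hSS, hij]) _ _ (hb d)]
    simp [hSS]
  have hlin : LinearIndependent ℝ ψ := by
    refine Fintype.linearIndependent_iff.2 fun d hd => ?_
    have h := hMψ d
    rw [hd, map_zero, eq_comm, add_eq_zero_iff_of_nonneg (by positivity)
      (Finset.sum_nonneg fun i _ => by positivity),
      Finset.sum_eq_zero_iff_of_nonneg fun i _ => by positivity] at h
    have h0 : ∑ i, d i = 0 := by simpa [hme.ne'] using h.1
    intro i
    simpa [h0, hm.ne'] using h.2 i (Finset.mem_univ i)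
  refine ⟨Submodule.span ℝ (Set.range ψ), FiniteDimensional.span_of_finite ℝ (Set.finite_range ψ),
    by rw [finrank_span_eq_card hlin, Fintype.card_fin], fun f hf => ?_⟩
  obtain ⟨d, rfl⟩ := (Submodule.mem_span_range_iff_exists_fun ℝ).1 hf
  rw [hMψ, hψ, apply_smul_add_sum Q hQ e S hqS hqSS _ _ (hb d), hqe, mul_add, Finset.mul_sum]
  refine add_le_add (by rw [mul_zero]; positivity) (Finset.sum_le_sum fun i _ => ?_)
  nlinarith [mul_le_mul_of_nonneg_left (hqm i) (sq_nonneg (d i - (∑ j, d j) / k))]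

end LinearMap.BilinForm

namespace MetricGraphOn

variable {X : Type} [MetricSpace X] {G : MetricGraphOn X}

theorem exists_isArms_of_isStar {k : ℕ} {a : ℝ} (ha : 0 < a) (h : IsStar X k a)
    (hu : G.edgeMeasure univ = ENNReal.ofReal (k * a)) : ∃ r, G.IsArms k a r := by
  obtain ⟨φ, -, -, hφ, hsub, hd⟩ := h
  have hr : ∀ i x y, |(if (φ x).1 = i then (φ x).2 else 0) -
      (if (φ y).1 = i then (φ y).2 else 0)| ≤ dist x y := by
    intro i x y
    have hx := (hφ x).1
    have hy := (hφ y).1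
    rw [hd x y]
    split_ifs with h1 h2 h3 h3 h2 h3 h3 <;> grind
  refine ⟨fun i x => if (φ x).1 = i then (φ x).2 else 0, fun i => ?_, fun i =>
    edgeLip_of_abs_sub_le_dist (hr i), fun i x => ?_, fun i x => ?_, fun i j hij x => ?_,
    fun i s hs => ?_, hu⟩
  · exact (LipschitzWith.of_dist_le_mul (K := 1) fun x y => by
      simpa [Real.dist_eq] using hr i x y).continuous
  · split_ifs
    exacts [(hφ x).1, le_rfl]
  · split_ifs
    exacts [(hφ x).2, ha.le]
  · split_ifs with h1 h2
    · exact absurd (h1.symm.trans h2) hij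
    · exact Or.inr rfl
    · exact Or.inl rfl
    · exact Or.inl rfl
  · obtain ⟨x, hx⟩ := hsub i hs
    exact ⟨x, by simp [hx]⟩

namespace IsArms

variable {k : ℕ} {a : ℝ} {r : Fin k → X → ℝ} (H : G.IsArms k a r)

include H

theorem integral_comp (ha : 0 ≤ a) (i : Fin k) {F : ℝ → ℝ} (hF : Measurable F) (hF0 : F 0 = 0) :
    ∫ p, F (r i (G.point p)) ∂G.edgeMeasure = ∫ s in (0)..a, F s := by
  have hm : Measurable fun p => r i (G.point p) := G.measurable_comp_point (H.continuous i)
  have hmap : (G.edgeMeasure.restrict {p | r i (G.point p) ∈ Ioo 0 a}).map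
      (fun p => r i (G.point p)) = volume.restrict (Ioo 0 a) := by
    refine Measure.ext fun A hA => ?_
    rw [Measure.map_apply hm hA, Measure.restrict_apply (hm hA), Measure.restrict_apply hA]
    exact H.measure_eq ha i (hA.inter measurableSet_Ioo) inter_subset_right
  rw [intervalIntegral.integral_of_le ha, integral_Ioc_eq_integral_Ioo, ← hmap,
    integral_map hm.aemeasurable hF.aestronglyMeasurable]
  symm
  refine setIntegral_eq_integral_of_ae_compl_eq_zero ?_
  filter_upwards [(H.measureReal_Ioo ha).2] with p ⟨j, hj⟩ hp
  have hij : i ≠ j := by rintro rfl; exact hp hj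
  rcases H.eq_zero i j hij (G.point p) with h | h
  · rw [h, hF0]
  · exact absurd h hj.1.ne'

theorem sobolev_sin (ω : ℝ) (i : Fin k) : (fun x => Real.sin (ω * r i x)) ∈ G.sobolev ∧
    ∀ᵐ p ∂G.edgeMeasure, |G.dv (fun x => Real.sin (ω * r i x)) p| ≤
      if r i (G.point p) = 0 then 0 else |ω * Real.cos (ω * r i (G.point p))| := by
  have := H.isFiniteMeasure
  obtain ⟨hs, hb⟩ := sobolev.of_lipschitz (G := G) (K := 1) (H.continuous i)
    fun e s hs t ht => by simpa using H.edgeLip i e s hs t ht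
  obtain ⟨h1, h2⟩ := sobolev.comp_mem hs (Y := fun s => Real.sin (ω * s))
    (y := fun s => ω * Real.cos (ω * s)) (K := |ω|)
    (fun s => by simpa [mul_comm] using ((hasDerivAt_id s).const_mul ω).sin) (fun s => by
      rw [abs_mul]
      exact mul_le_of_le_one_right (abs_nonneg _) (Real.abs_cos_le_one _))
  refine ⟨h1, ?_⟩
  filter_upwards [h2, hb, sobolev.dv_eq_zero_ae hs (H.nonneg i)] with p hp hp1 hp0
  change |G.dv ((fun s => Real.sin (ω * s)) ∘ r i) p| ≤ _
  rw [hp]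
  split_ifs with h
  · simp [hp0 h]
  · rw [abs_mul]
    exact mul_le_of_le_one_right (abs_nonneg _) hp1

theorem neumannEigen_le [ConnectedSpace X] (ha : 0 < a) (hk : 0 < k) {ω : ℝ}
    (hω : ω = Real.pi / (2 * a)) : G.neumannEigen k ≤ ω ^ 2 := by
  have := H.isFiniteMeasure
  have hω0 : 0 < ω := by rw [hω]; positivity
  have hωa : ω * a = Real.pi / 2 := by rw [hω]; field_simp
  rw [neumannEigen_eq]
  refine csInf_le (rayleighBounds_bddBelow hk) ?_
  let e : G.sobolev := ⟨fun _ => 1, sobolev.const_mem 1⟩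
  let S : Fin k → G.sobolev := fun i => ⟨_, (H.sobolev_sin ω i).1⟩
  have hsin : ∫ s in (0)..a, Real.sin (ω * s) ^ 2 = a / 2 := by
    rw [intervalIntegral.integral_comp_mul_left (fun x => Real.sin x ^ 2) hω0.ne', hωa,
      integral_sin_sq, hω]
    simp
    field_simp
  have hcos : ∫ s in (0)..a, Real.cos (ω * s) ^ 2 = a / 2 := by
    rw [intervalIntegral.integral_comp_mul_left (fun x => Real.cos x ^ 2) hω0.ne', hωa,
      integral_cos_sq, hω]
    simp
    field_simp
  have hdv0 : ∀ i, ∀ᵐ p ∂G.edgeMeasure, r i (G.point p) = 0 → G.dv (S i).1 p = 0 := fun i => by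
    filter_upwards [(H.sobolev_sin ω i).2] with p hp h
    rw [if_pos h] at hp
    exact abs_nonpos_iff.1 hp
  refine LinearMap.BilinForm.exists_submodule_le_of_star massForm_comm energyForm_comm hk e S
    (J := ∫ s in (0)..a, Real.sin (ω * s)) (m := a / 2) (q := 0) ?_ (fun i => ?_) (by positivity)
    (fun i j => ?_) ?_ (fun i => ?_) (fun i j hij => ?_) (sq_nonneg ω) fun i => ?_
  · rw [massForm_apply]
    have h : G.edgeMeasure.real univ = k * a := by
      rw [Measure.real, H.measure_univ, ENNReal.toReal_ofReal (by positivity)]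
    simpa [e, h] using mul_pos (Nat.cast_pos.2 hk) ha
  · rw [massForm_apply, ← H.integral_comp ha.le i (by fun_prop) (by simp)]
    simp [e, S]
  · rw [massForm_apply]
    split_ifs with h
    · subst h
      rw [← hsin, ← H.integral_comp ha.le i (by fun_prop) (by simp)]
      simp [S, sq]
    · refine (integral_congr_ae (Eventually.of_forall fun p => ?_)).trans (integral_zero _ ℝ)
      rcases H.eq_zero i j h (G.point p) with h | h <;> simp [S, h]
  · simp [energyForm_apply, e, dv_const]
  · simp [energyForm_apply, e, dv_const]
  · rw [energyForm_apply]
    refine (integral_congr_ae ?_).trans (integral_zero _ ℝ)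
    filter_upwards [hdv0 i, hdv0 j] with p hi hj
    rcases H.eq_zero i j hij (G.point p) with h | h
    · simp [hi h]
    · simp [hj h]
  · let F : ℝ → ℝ := fun s => if s = 0 then 0 else ω ^ 2 * Real.cos (ω * s) ^ 2
    have hF : Measurable F := Measurable.ite (measurableSet_singleton 0) measurable_const
      (by fun_prop)
    have hFi : ∫ s in (0)..a, F s = ω ^ 2 * (a / 2) := by
      rw [← hcos, ← intervalIntegral.integral_const_mul]
      refine intervalIntegral.integral_congr_ae (Eventually.of_forall fun s hs => ?_)
      rw [uIoc_of_le ha.le] at hs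
      exact if_neg hs.1.ne'
    rw [← hFi, ← H.integral_comp ha.le i hF (by simp [F]), energyForm_apply]
    refine integral_mono_ae (sobolev.integrable_dv_mul (S i).2 (S i).2) ?_ ?_
    · refine Integrable.of_bound (hF.comp
        (G.measurable_comp_point (H.continuous i))).aestronglyMeasurable (ω ^ 2)
        (Eventually.of_forall fun p => ?_)
      simp only [F, Real.norm_eq_abs]
      split_ifs
      · simp [sq_nonneg]
      · rw [abs_of_nonneg (by positivity)]
        exact mul_le_of_le_one_right (sq_nonneg _) (Real.cos_sq_le_one _)
    · filter_upwards [(H.sobolev_sin ω i).2, hdv0 i] with p hp hp0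
      simp only [F]
      split_ifs at hp ⊢ with h
      · simp [hp0 h]
      · rw [← mul_pow, ← sq]
        exact sq_le_sq.2 hp

end IsArms

end MetricGraphOn

open MetricGraphOn in
/-- Nicaise–Friedlander, Neumann extension. Let `G` be a locally
finite, connected metric graph of finite total length `L > 0`. Then
`μ_k(G) ≥ π²k²/(4L²)` for every `k ≥ 2`, with equality if and only if `G` is a star
of `k` (finite or infinite) path subgraphs of length `L/k` each, glued at a common
vertex. -/
theorem statement6 (X : Type) [MetricSpace X] (G : MetricGraphOn X)
    (hlf : G.LocallyFinite) (hconn : ConnectedSpace X)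
    (hsum : Summable G.len) (L : ℝ) (hL : L = ∑' e : G.E, G.len e) (hLpos : 0 < L)
    (k : ℕ) (hk : 2 ≤ k) :
    Real.pi ^ 2 * (k : ℝ) ^ 2 / (4 * L ^ 2) ≤ G.neumannEigen k ∧
    (G.neumannEigen k = Real.pi ^ 2 * (k : ℝ) ^ 2 / (4 * L ^ 2) ↔
      IsStar X k (L / k)) := by
  have hfin := G.isFiniteMeasure_edgeMeasure hsum
  have hk0 : (0 : ℝ) < k := by positivity
  have hkL : (k : ℝ) * (L / k) = L := mul_div_cancel₀ L hk0.ne'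
  have hu : G.edgeMeasure univ = ENNReal.ofReal (k * (L / k)) := by
    rw [hkL, G.edgeMeasure_univ hsum, hL]
  obtain ⟨m, rfl⟩ := Nat.exists_eq_add_of_le' hk
  set ω : ℝ := Real.pi * (m + 2) / (2 * L) with hω
  have hω0 : 0 < ω := by positivity
  have hω2 : Real.pi ^ 2 * ((m + 2 : ℕ) : ℝ) ^ 2 / (4 * L ^ 2) = ω ^ 2 := by
    rw [hω]
    push_cast
    ring
  have ha : Real.pi / (2 * ω) = L / ((m + 2 : ℕ) : ℝ) := by
    rw [hω]
    push_cast
    field_simp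
  have hω' : ω = Real.pi / (2 * (L / ((m + 2 : ℕ) : ℝ))) := by
    rw [← ha]
    field_simp
  obtain ⟨hle, heq⟩ := le_neumannEigen hsum hL hLpos hω
  rw [hω2]
  refine ⟨hle, fun h => ?_, fun h => ?_⟩
  · obtain ⟨f, hf, hd⟩ := heq h
    obtain ⟨r, hr⟩ := exists_isArms hk hω0 (by rw [ha, hu]) hf hd
    rw [ha] at hr
    exact hr.isStar (by positivity) hk
  · obtain ⟨r, hr⟩ := exists_isArms_of_isStar (by positivity) h hu
    exact le_antisymm (hr.neumannEigen_le (by positivity) (by lia) hω') hle
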